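/- arXiv:1810.12811 — 6 statements merged into one kernel-verified Lean document; each statement's English description precedes it below -/
import Mathlib

section
/- Suppose char(F) = 2 and let q have reduced Witt index n ≥ 2, anisotropic defect d₀ and singular defect d (so N = 2n + d₀ + d); q may be degenerate. Then for every integer k with 1 ≤ k ≤ n, the Grassmann image G_k(q) coincides with the symplectic Grassmann image S_k(f_q) of the bilinearization f_q, and dim G_k(q) = binom(N, k) − binom(N, k−2), with the convention binom(N, −1) := 0. -/
noncomputable section

namespace PolarGrass

open Module

variable (F : Type*) [Field F] (V : Type*) [AddCommGroup V] [Module F V]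

/-- A subspace `W` is totally singular for the pairing `B` if `B` vanishes identically on it. -/
def TotSingB (B : V → V → F) (W : Submodule F V) : Prop :=
  ∀ x ∈ W, ∀ y ∈ W, B x y = 0

/-- A subspace `W` is totally singular for the quadratic form `q` if `q` vanishes on it. -/
def TotSingQ (q : QuadraticForm F V) (W : Submodule F V) : Prop :=
  ∀ x ∈ W, q x = 0

/-- The polarization of a quadratic form, as a bare pairing. -/
def polarF (q : QuadraticForm F V) : V → V → F :=
  fun x y => QuadraticMap.polar (⇑q) x y

/-- The subspace of the `k`-th exterior power of `V` spanned by the pure wedges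
`v₁ ∧ ⋯ ∧ v_k` where `v₁, …, v_k` is a basis of a `k`-dimensional subspace satisfying `P`,
all of whose vectors lie in `U`. -/
def grassmannIn (P : Submodule F V → Prop) (U : Submodule F V) (k : ℕ) :
    Submodule F (ExteriorAlgebra F V) :=
  Submodule.span F {x | ∃ v : Fin k → V, (∀ t, v t ∈ U) ∧ LinearIndependent F v ∧
    P (Submodule.span F (Set.range v)) ∧ x = ExteriorAlgebra.ιMulti F k v}

/-- The Grassmann image: the subspace of the `k`-th exterior power of `V` spanned by the
pure wedges of bases of `k`-dimensional subspaces of `V` satisfying `P`. -/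
def grassmann (P : Submodule F V → Prop) (k : ℕ) : Submodule F (ExteriorAlgebra F V) :=
  grassmannIn F V P ⊤ k

/-- `B` is a `σ`-Hermitian form. -/
def IsHermitianForm (σ : F ≃+* F) (B : V → V → F) : Prop :=
  (∀ x y z : V, B (x + y) z = B x z + B y z) ∧
  (∀ x y z : V, B x (y + z) = B x y + B x z) ∧
  (∀ (a b : F) (x y : V), B (a • x) (b • y) = σ a * b * B x y) ∧
  (∀ x y : V, B y x = σ (B x y))

/-- `B` is an alternating bilinear form. -/
def IsAlternatingForm (B : V → V → F) : Prop :=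
  (∀ x y z : V, B (x + y) z = B x z + B y z) ∧
  (∀ x y z : V, B x (y + z) = B x y + B x z) ∧
  (∀ (a : F) (x y : V), B (a • x) y = a * B x y) ∧
  (∀ (a : F) (x y : V), B x (a • y) = a * B x y) ∧
  (∀ x : V, B x x = 0)

/-- `V` is the orthogonal (w.r.t. the pairing `B`) direct sum of the subspaces
`W 0, …, W (n-1), W₀, R`, where each `W i` is a hyperbolic plane (spanned by two singular
vectors pairing to `1`, singularity being measured by `sv`), `W₀` is anisotropic of
dimension `d₀` (it contains no nonzero singular vector) and `R` is the radical
(given as the set `RadSet`) and has dimension `d`. -/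
def IsWittDecomp (B : V → V → F) (sv : V → Prop) (RadSet : Set V) (n d₀ d : ℕ)
    (W : Fin n → Submodule F V) (W₀ R : Submodule F V) : Prop :=
  DirectSum.IsInternal (Sum.elim W ![W₀, R]) ∧
  (∀ j j' : Fin n ⊕ Fin 2, j ≠ j' →
    ∀ x ∈ Sum.elim W ![W₀, R] j, ∀ y ∈ Sum.elim W ![W₀, R] j', B x y = 0) ∧
  (∀ i : Fin n, ∃ e f : V, W i = Submodule.span F {e, f} ∧ sv e ∧ sv f ∧ B e f = 1) ∧
  (∀ v ∈ W₀, v ≠ 0 → ¬ sv v) ∧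
  Module.finrank F W₀ = d₀ ∧
  (R : Set V) = RadSet ∧
  Module.finrank F R = d

/-- There is a Witt decomposition of `V` as above: `B` has reduced Witt index `n`,
anisotropic defect `d₀` and singular defect `d`. -/
def HasWittDecomp (B : V → V → F) (sv : V → Prop) (RadSet : Set V) (n d₀ d : ℕ) : Prop :=
  ∃ (W : Fin n → Submodule F V) (W₀ R : Submodule F V),
    IsWittDecomp F V B sv RadSet n d₀ d W W₀ R

/-- The radical (as a set) of a sesquilinear/bilinear pairing. -/
def radSetB (B : V → V → F) : Set V := {v | ∀ w, B v w = 0}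

/-- The radical (as a set) of a quadratic form. -/
def radSetQ (q : QuadraticForm F V) : Set V :=
  {v | q v = 0 ∧ ∀ w, polarF F V q v w = 0}

/-- The image of `⋀^i U` inside the exterior algebra of `V`: the span of the pure wedges of
`i`-tuples of vectors of `U`. -/
def extPowOf (U : Submodule F V) (i : ℕ) : Submodule F (ExteriorAlgebra F V) :=
  Submodule.span F {x | ∃ v : Fin i → V, (∀ t, v t ∈ U) ∧ x = ExteriorAlgebra.ιMulti F i v}

/-- `Ḡ_j`: for `j ≥ 1` the span of the pure wedges of bases of `j`-dimensional subspaces of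
`U` satisfying `P`; for `j = 0` the scalars `F ⊆ ⋀^0 V`. -/
def gbar (P : Submodule F V → Prop) (U : Submodule F V) : ℕ → Submodule F (ExteriorAlgebra F V)
  | 0 => 1
  | (j + 1) => grassmannIn F V P U (j + 1)

end PolarGrass

namespace PolarGrass

section ops

variable {F : Type*} [Field F] {V : Type*} [AddCommGroup V] [Module F V]

/-- left contraction on the exterior algebra -/
def ctr (d : Module.Dual F V) : ExteriorAlgebra F V →ₗ[F] ExteriorAlgebra F V :=
  CliffordAlgebra.contractLeft (Q := (0 : QuadraticForm F V)) d

lemma ctr_mul (d : Module.Dual F V) (v : V) (x : ExteriorAlgebra F V) :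
    ctr d (ExteriorAlgebra.ι F v * x) = d v • x - ExteriorAlgebra.ι F v * ctr d x :=
  CliffordAlgebra.contractLeft_ι_mul d v x

lemma ctr_ctr (d : Module.Dual F V) (x : ExteriorAlgebra F V) : ctr d (ctr d x) = 0 :=
  CliffordAlgebra.contractLeft_contractLeft d x

lemma ctr_comm (d d' : Module.Dual F V) (x : ExteriorAlgebra F V) :
    ctr d (ctr d' x) = - ctr d' (ctr d x) :=
  CliffordAlgebra.contractLeft_comm d d' x

lemma ctr_algebraMap (d : Module.Dual F V) (r : F) :
    ctr d (algebraMap F (ExteriorAlgebra F V) r) = 0 :=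
  CliffordAlgebra.contractLeft_algebraMap _ d r

lemma ctr_one (d : Module.Dual F V) : ctr d (1 : ExteriorAlgebra F V) = 0 :=
  CliffordAlgebra.contractLeft_one _ d

lemma ctr_add_left (d d' : Module.Dual F V) (x : ExteriorAlgebra F V) :
    ctr (d + d') x = ctr d x + ctr d' x := by
  simp [ctr]

lemma ctr_smul_left (a : F) (d : Module.Dual F V) (x : ExteriorAlgebra F V) :
    ctr (a • d) x = a • ctr d x := by
  simp [ctr]

lemma ctr_zero_left (x : ExteriorAlgebra F V) :
    ctr (0 : Module.Dual F V) x = 0 := by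
  simp [ctr]

lemma ι_anti (v w : V) (x : ExteriorAlgebra F V) :
    ExteriorAlgebra.ι F v * (ExteriorAlgebra.ι F w * x)
      = - (ExteriorAlgebra.ι F w * (ExteriorAlgebra.ι F v * x)) := by
  have h := ExteriorAlgebra.ι_add_mul_swap (R := F) v w
  rw [← mul_assoc, ← mul_assoc, ← neg_mul, eq_neg_of_add_eq_zero_left h]

lemma ι_sq_mul (v : V) (x : ExteriorAlgebra F V) :
    ExteriorAlgebra.ι F v * (ExteriorAlgebra.ι F v * x) = 0 := by
  rw [← mul_assoc, ExteriorAlgebra.ι_sq_zero, zero_mul]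

lemma EA_left_induction {P : ExteriorAlgebra F V → Prop}
    (h0 : ∀ r : F, P (algebraMap _ _ r))
    (hadd : ∀ x y, P x → P y → P (x + y))
    (hm : ∀ x m, P x → P (ExteriorAlgebra.ι F m * x)) (x : ExteriorAlgebra F V) : P x :=
  CliffordAlgebra.left_induction (Q := (0 : QuadraticForm F V)) h0 hadd hm x

lemma toQ_zero (B : LinearMap.BilinForm F V) (hB : ∀ v, B v v = 0) :
    LinearMap.BilinMap.toQuadraticMap B = (0 : QuadraticForm F V) - 0 := by
  ext v
  simp [hB]

/-- exponential of the contraction with an alternating form -/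
def Eop (B : LinearMap.BilinForm F V) (hB : ∀ v, B v v = 0) :
    ExteriorAlgebra F V →ₗ[F] ExteriorAlgebra F V :=
  CliffordAlgebra.changeForm (toQ_zero B hB)

lemma Eop_mul (B : LinearMap.BilinForm F V) (hB : ∀ v, B v v = 0) (v : V)
    (x : ExteriorAlgebra F V) :
    Eop B hB (ExteriorAlgebra.ι F v * x)
      = ExteriorAlgebra.ι F v * Eop B hB x - ctr (B v) (Eop B hB x) :=
  CliffordAlgebra.changeForm_ι_mul (toQ_zero B hB) v x

lemma Eop_ctr (B : LinearMap.BilinForm F V) (hB : ∀ v, B v v = 0) (d : Module.Dual F V)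
    (x : ExteriorAlgebra F V) :
    Eop B hB (ctr d x) = ctr d (Eop B hB x) :=
  CliffordAlgebra.changeForm_contractLeft (toQ_zero B hB) d x

lemma Eop_algebraMap (B : LinearMap.BilinForm F V) (hB : ∀ v, B v v = 0) (r : F) :
    Eop B hB (algebraMap F (ExteriorAlgebra F V) r) = algebraMap F _ r :=
  CliffordAlgebra.changeForm_algebraMap (toQ_zero B hB) r

lemma Eop_one (B : LinearMap.BilinForm F V) (hB : ∀ v, B v v = 0) :
    Eop B hB (1 : ExteriorAlgebra F V) = 1 :=
  CliffordAlgebra.changeForm_one (toQ_zero B hB)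

/-- wedge of a list -/
def wedge (L : List V) : ExteriorAlgebra F V := (L.map (ExteriorAlgebra.ι F)).prod

lemma wedge_nil : wedge (F := F) ([] : List V) = 1 := rfl

lemma wedge_cons (v : V) (L : List V) :
    wedge (F := F) (v :: L) = ExteriorAlgebra.ι F v * wedge L := by
  simp [wedge]

lemma ctr_wedge (d : Module.Dual F V) (L : List V) (h : ∀ v ∈ L, d v = 0) :
    ctr d (wedge L) = 0 := by
  induction L with
  | nil => exact ctr_one d
  | cons v L ih =>
    rw [wedge_cons, ctr_mul, h v (by simp), ih (fun w hw => h w (by simp [hw]))]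
    simp

lemma Eop_wedge (B : LinearMap.BilinForm F V) (hB : ∀ v, B v v = 0) (L : List V)
    (h : ∀ v ∈ L, ∀ w ∈ L, B v w = 0) : Eop B hB (wedge L) = wedge L := by
  induction L with
  | nil => exact Eop_one B hB
  | cons v L ih =>
    rw [wedge_cons, Eop_mul, ih (fun w hw w' hw' => h w (by simp [hw]) w' (by simp [hw'])),
      ctr_wedge (B v) L (fun w hw => h v (by simp) w (by simp [hw])), sub_zero]

lemma ιMulti_eq_wedge {k : ℕ} (v : Fin k → V) :
    ExteriorAlgebra.ιMulti F k v = wedge (List.ofFn v) := by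
  rw [ExteriorAlgebra.ιMulti_apply, wedge, List.map_ofFn]
  rfl

/-! filtration by degree -/

/-- elements of degree at least `k` -/
def Fil (F : Type*) [Field F] (V : Type*) [AddCommGroup V] [Module F V] :
    ℕ → Submodule F (ExteriorAlgebra F V)
  | 0 => ⊤
  | k + 1 => Submodule.span F {x | ∃ v : V, ∃ y ∈ Fil F V k, x = ExteriorAlgebra.ι F v * y}

lemma Fil_mul {k : ℕ} (v : V) {x : ExteriorAlgebra F V} (hx : x ∈ Fil F V k) :
    ExteriorAlgebra.ι F v * x ∈ Fil F V (k + 1) :=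
  Submodule.subset_span ⟨v, x, hx, rfl⟩

lemma Fil_succ_le (k : ℕ) : Fil F V (k + 1) ≤ Fil F V k := by
  induction k with
  | zero => exact le_top
  | succ k ih =>
    refine Submodule.span_le.2 ?_
    rintro _ ⟨v, y, hy, rfl⟩
    exact Fil_mul v (ih hy)

lemma Fil_anti : Antitone (Fil F V) := antitone_nat_of_succ_le Fil_succ_le

lemma Fil_ctr (d : Module.Dual F V) (k : ℕ) {x : ExteriorAlgebra F V} (hx : x ∈ Fil F V k) :
    ctr d x ∈ Fil F V (k - 1) := by
  induction k generalizing x with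
  | zero => trivial
  | succ k ih =>
    have : Fil F V (k + 1) ≤ (Fil F V k).comap (ctr d) := by
      refine Submodule.span_le.2 ?_
      rintro _ ⟨v, y, hy, rfl⟩
      simp only [Submodule.comap_coe, Set.mem_preimage, SetLike.mem_coe]
      rw [ctr_mul]
      refine Submodule.sub_mem _ (Submodule.smul_mem _ _ hy) ?_
      rcases k with _ | k
      · trivial
      · exact Fil_mul v (ih hy)
    exact this hx

lemma Fil_mul' {k l : ℕ} (h : l ≤ k + 1) (v : V) {x : ExteriorAlgebra F V}
    (hx : x ∈ Fil F V k) : ExteriorAlgebra.ι F v * x ∈ Fil F V l :=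
  Fil_anti h (Fil_mul v hx)

lemma pow_le_Fil (k : ℕ) : ⋀[F]^k V ≤ Fil F V k := by
  induction k with
  | zero => exact le_top
  | succ k ih =>
    unfold ExteriorAlgebra.exteriorPower at ih ⊢
    rw [pow_succ', Submodule.mul_le]
    rintro _ ⟨v, rfl⟩ y hy
    exact Fil_mul v (ih hy)

lemma scalar_Fil (r : F) (h : algebraMap F (ExteriorAlgebra F V) r ∈ Fil F V 1) : r = 0 := by
  have : Fil F V 1 ≤ LinearMap.ker (ExteriorAlgebra.algebraMapInv (R := F) (M := V)).toLinearMap := by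
    refine Submodule.span_le.2 ?_
    rintro _ ⟨v, y, hy, rfl⟩
    simp [ExteriorAlgebra.algebraMapInv]
  have h2 := this h
  simpa using h2

lemma wedge_mem_pow (L : List V) : wedge L ∈ ⋀[F]^(L.length) V := by
  unfold ExteriorAlgebra.exteriorPower
  induction L with
  | nil => simp [wedge_nil]
  | cons v L ih =>
    rw [wedge_cons, List.length_cons, pow_succ']
    exact Submodule.mul_mem_mul ⟨v, rfl⟩ ih

lemma ctr_pow (d : Module.Dual F V) (k : ℕ) {x : ExteriorAlgebra F V} (hx : x ∈ ⋀[F]^(k+1) V) :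
    ctr d x ∈ ⋀[F]^k V := by
  unfold ExteriorAlgebra.exteriorPower at hx ⊢
  induction k generalizing x with
  | zero =>
    rw [zero_add, pow_one] at hx
    obtain ⟨v, rfl⟩ := hx
    rw [← mul_one (ExteriorAlgebra.ι F v), ctr_mul, ctr_one, mul_zero, sub_zero, pow_zero]
    exact Submodule.smul_mem _ _ (Submodule.one_le.1 le_rfl)
  | succ k ih =>
    have : (LinearMap.range (ExteriorAlgebra.ι F : V →ₗ[F] _)) ^ (k + 1 + 1) ≤
        ((LinearMap.range (ExteriorAlgebra.ι F : V →ₗ[F] _)) ^ (k + 1)).comap (ctr d) := by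
      rw [pow_succ', Submodule.mul_le]
      rintro _ ⟨v, rfl⟩ y hy
      rw [Submodule.mem_comap, ctr_mul]
      refine Submodule.sub_mem _ (Submodule.smul_mem _ _ hy) ?_
      rw [pow_succ']
      exact Submodule.mul_mem_mul ⟨v, rfl⟩ (ih hy)
    exact this hx

/-! elements killed by all contractions are scalars -/

lemma map_sub_rank_one (d : Module.Dual F V) (b : V) (x : ExteriorAlgebra F V) :
    ExteriorAlgebra.map (LinearMap.id - d.smulRight b) x
      = x - ExteriorAlgebra.ι F b * ctr d x := by
  induction x using EA_left_induction with
  | h0 r => simp [ctr_algebraMap]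
  | hadd x y hx hy => rw [map_add, hx, hy, map_add, mul_add]; abel
  | hm x v hx =>
    rw [map_mul, hx, ExteriorAlgebra.map_apply_ι, ctr_mul]
    simp only [LinearMap.sub_apply, LinearMap.id_apply, LinearMap.smulRight_apply, map_sub,
      map_smul, sub_mul, mul_sub, smul_mul_assoc, mul_smul_comm, ι_sq_mul, smul_zero]
    rw [ι_anti v b]
    abel

lemma killed_scalar [FiniteDimensional F V] (x : ExteriorAlgebra F V)
    (h : ∀ d : Module.Dual F V, ctr d x = 0) :
    ∃ r : F, x = algebraMap F _ r := by
  let b := Module.finBasis F V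
  have key : ∀ s : Finset (Fin (Module.finrank F V)),
      ExteriorAlgebra.map (LinearMap.id - ∑ i ∈ s, (b.coord i).smulRight (b i)) x = x := by
    intro s
    induction s using Finset.induction_on with
    | empty => simp [ExteriorAlgebra.map_id]
    | insert i s his ih =>
      have h1 := map_sub_rank_one (b.coord i) (b i) x
      rw [h, mul_zero, sub_zero] at h1
      have h2 : (LinearMap.id - ∑ j ∈ insert i s, (b.coord j).smulRight (b j)) =
          (LinearMap.id - (b.coord i).smulRight (b i)) ∘ₗ
            (LinearMap.id - ∑ j ∈ s, (b.coord j).smulRight (b j)) := by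
        rw [Finset.sum_insert his]
        apply b.ext
        intro l
        simp [LinearMap.sum_apply, Finsupp.single_apply]
        by_cases hl : l ∈ s
        · have : l ≠ i := fun hh => his (hh ▸ hl)
          simp [hl, this]
        · simp [hl]
      rw [h2, ← ExteriorAlgebra.map_comp_map, AlgHom.comp_apply, ih, h1]
  have h0 : (LinearMap.id - ∑ i, (b.coord i).smulRight (b i)) = (0 : V →ₗ[F] V) := by
    apply b.ext
    intro l
    simp [LinearMap.sum_apply, Finsupp.single_apply]
  have h1 := key Finset.univ
  rw [h0] at h1
  refine ⟨ExteriorAlgebra.algebraMapInv x, ?_⟩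
  conv_lhs => rw [← h1]
  have : (ExteriorAlgebra.map (0 : V →ₗ[F] V)) =
      (Algebra.ofId F (ExteriorAlgebra F V)).comp ExteriorAlgebra.algebraMapInv := by
    ext v
    simp [ExteriorAlgebra.algebraMapInv]
  rw [this]
  rfl

/-! dimension splitting -/

lemma finrank_split {M : Type*} [AddCommGroup M] [Module F M] (A : Submodule F M)
    [FiniteDimensional F A] (D : M →ₗ[F] M) :
    Module.finrank F A = Module.finrank F (A.map D) + Module.finrank F (A ⊓ LinearMap.ker D : Submodule F M) := by
  rw [← LinearMap.finrank_range_add_finrank_ker (D.domRestrict A)]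
  congr 1
  · rw [LinearMap.range_domRestrict]
  · have : (A ⊓ LinearMap.ker D : Submodule F M) = (LinearMap.ker (D.domRestrict A)).map A.subtype := by
      ext x
      simp
      tauto
    rw [this]
    exact (LinearEquiv.finrank_eq (Submodule.equivMapOfInjective A.subtype A.injective_subtype _))

end ops

end PolarGrass

namespace PolarGrass

section upper

variable {F : Type*} [Field F] {V : Type*} [AddCommGroup V] [Module F V]

/-- A frame: `n` hyperbolic pairs, `c` further vectors with coordinate functionals. -/
structure Frame (q : QuadraticForm F V) (B : LinearMap.BilinForm F V) (n c : ℕ) where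
  e : ℕ → V
  f : ℕ → V
  w : ℕ → V
  g : ℕ → Module.Dual F V
  qe : ∀ i < n, q (e i) = 0
  qf : ∀ i < n, q (f i) = 0
  ef : ∀ i < n, ∀ j < n, B (e i) (f j) = if i = j then 1 else 0
  fe : ∀ i < n, ∀ j < n, B (f i) (e j) = if i = j then 1 else 0
  ee : ∀ i < n, ∀ j < n, B (e i) (e j) = 0
  ff : ∀ i < n, ∀ j < n, B (f i) (f j) = 0
  ew : ∀ i < n, ∀ l < c, B (e i) (w l) = 0
  fw : ∀ i < n, ∀ l < c, B (f i) (w l) = 0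
  gw : ∀ l < c, ∀ l' < c, g l (w l') = if l = l' then 1 else 0
  ge : ∀ l < c, ∀ i < n, g l (e i) = 0
  gf : ∀ l < c, ∀ i < n, g l (f i) = 0
  sep : ∀ v, (∀ i < n, B (e i) v = 0) → (∀ i < n, B (f i) v = 0) → (∀ l < c, g l v = 0) → v = 0

/-- degree `k` elements fixed by `Eop` and killed by contraction with all `d ∈ Λ` -/
def XX (B : LinearMap.BilinForm F V) (hB : ∀ v, B v v = 0) (Λ : Set (Module.Dual F V)) (k : ℕ) :
    Submodule F (ExteriorAlgebra F V) where
  carrier := {x | x ∈ ⋀[F]^k V ∧ Eop B hB x = x ∧ ∀ d ∈ Λ, ctr d x = 0}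
  zero_mem' := ⟨Submodule.zero_mem _, by simp, by simp⟩
  add_mem' := by
    rintro x y ⟨h1, h2, h3⟩ ⟨h1', h2', h3'⟩
    refine ⟨Submodule.add_mem _ h1 h1', by rw [map_add, h2, h2'], fun d hd => ?_⟩
    rw [map_add, h3 d hd, h3' d hd, add_zero]
  smul_mem' := by
    rintro a x ⟨h1, h2, h3⟩
    refine ⟨Submodule.smul_mem _ _ h1, by rw [map_smul, h2], fun d hd => ?_⟩
    rw [map_smul, h3 d hd, smul_zero]

variable {B : LinearMap.BilinForm F V} {hB : ∀ v, B v v = 0}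

lemma mem_XX {Λ : Set (Module.Dual F V)} {k : ℕ} {x : ExteriorAlgebra F V} :
    x ∈ XX B hB Λ k ↔ x ∈ ⋀[F]^k V ∧ Eop B hB x = x ∧ ∀ d ∈ Λ, ctr d x = 0 := Iff.rfl

lemma XX_anti {Λ Λ' : Set (Module.Dual F V)} (h : Λ ⊆ Λ') (k : ℕ) :
    XX B hB Λ' k ≤ XX B hB Λ k := fun _ hx => ⟨hx.1, hx.2.1, fun d hd => hx.2.2 d (h hd)⟩

instance finEA [FiniteDimensional F V] : FiniteDimensional F (ExteriorAlgebra F V) :=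
  Module.Finite.of_basis (Module.Basis.ExteriorAlgebra (Module.finBasis F V))

lemma XX_zero_le [FiniteDimensional F V] (Λ : Set (Module.Dual F V)) :
    Module.finrank F (XX B hB Λ 0) ≤ 1 := by
  have h : XX B hB Λ 0 ≤ ⋀[F]^0 V := fun x hx => hx.1
  refine (Submodule.finrank_mono h).trans ?_
  rw [exteriorPower.finrank_eq]
  simp

lemma XX_step [FiniteDimensional F V] (Λ : Set (Module.Dual F V)) (d : Module.Dual F V) (k : ℕ) :
    Module.finrank F (XX B hB Λ (k + 1)) ≤
      Module.finrank F (XX B hB (insert d Λ) (k + 1)) + Module.finrank F (XX B hB (insert d Λ) k) := by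
  rw [finrank_split (XX B hB Λ (k + 1)) (ctr d), add_comm]
  refine add_le_add (Submodule.finrank_mono ?_) (Submodule.finrank_mono ?_)
  · rintro x ⟨⟨h1, h2, h3⟩, h4⟩
    refine ⟨h1, h2, fun d' hd' => ?_⟩
    rcases hd' with rfl | hd'
    · exact h4
    · exact h3 d' hd'
  · rintro _ ⟨x, ⟨h1, h2, h3⟩, rfl⟩
    refine ⟨ctr_pow d k h1, by rw [Eop_ctr, h2], fun d' hd' => ?_⟩
    rcases hd' with rfl | hd'
    · exact ctr_ctr _ _
    · rw [ctr_comm, h3 d' hd', map_zero, neg_zero]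

lemma XX_stepZ [FiniteDimensional F V] (Λ : Set (Module.Dual F V)) (d : Module.Dual F V) (k : ℕ) :
    (Module.finrank F (XX B hB Λ (k + 1)) : ℤ) ≤
      Module.finrank F (XX B hB (insert d Λ) (k + 1)) + Module.finrank F (XX B hB (insert d Λ) k) := by
  exact_mod_cast XX_step Λ d k

variable {q : QuadraticForm F V} {n c : ℕ}

/-- functionals vanishing on the first `i` pairs -/
def LamU (fr : Frame q B n c) (i : ℕ) : Set (Module.Dual F V) :=
  {d | (∃ l, i ≤ l ∧ l < n ∧ (d = B (fr.e l) ∨ d = B (fr.f l))) ∨ ∃ l < c, d = fr.g l}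

/-- functionals vanishing on all pairs and the first `j` further vectors -/
def LamC (fr : Frame q B n c) (j : ℕ) : Set (Module.Dual F V) :=
  {d | ∃ l, j ≤ l ∧ l < c ∧ d = fr.g l}

lemma killed_all [FiniteDimensional F V] (fr : Frame q B n c) (x : ExteriorAlgebra F V)
    (h : ∀ d ∈ LamU fr 0, ctr d x = 0) (d : Module.Dual F V) : ctr d x = 0 := by
  have hs : Submodule.span F (LamU fr 0) = ⊤ := by
    have h1 : (Submodule.span F (LamU fr 0)).dualCoannihilator = ⊥ := by
      rw [eq_bot_iff]
      intro v hv
      rw [Submodule.mem_dualCoannihilator] at hv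
      have hv' : ∀ d ∈ LamU fr 0, d v = 0 := fun d hd => hv d (Submodule.subset_span hd)
      rw [Submodule.mem_bot]
      apply fr.sep
      · exact fun i hi => hv' _ (Or.inl ⟨i, Nat.zero_le _, hi, Or.inl rfl⟩)
      · exact fun i hi => hv' _ (Or.inl ⟨i, Nat.zero_le _, hi, Or.inr rfl⟩)
      · exact fun l hl => hv' _ (Or.inr ⟨l, hl, rfl⟩)
    rw [← Subspace.dualCoannihilator_dualAnnihilator_eq (W := Submodule.span F (LamU fr 0)), h1]
    simp
  have hd : d ∈ Submodule.span F (LamU fr 0) := by rw [hs]; trivial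
  induction hd using Submodule.span_induction with
  | mem d hd => exact h d hd
  | zero => exact ctr_zero_left x
  | add a b _ _ ha hb => rw [ctr_add_left, ha, hb, add_zero]
  | smul a b _ hb => rw [ctr_smul_left, hb, smul_zero]

lemma vanish [FiniteDimensional F V] (fr : Frame q B n c) (i : ℕ) (hi : i ≤ n)
    (x : ExteriorAlgebra F V) (k l : ℕ) (hkl : 2 * i + 1 ≤ k + l)
    (hx : ∀ d ∈ LamU fr i, ctr d x = 0) (hk : x ∈ Fil F V k) (hl : Eop B hB x ∈ Fil F V l) :
    x = 0 := by
  induction i generalizing x k l with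
  | zero =>
    obtain ⟨r, rfl⟩ := killed_scalar x (killed_all fr x hx)
    rw [Eop_algebraMap] at hl
    have : algebraMap F (ExteriorAlgebra F V) r ∈ Fil F V 1 := by
      rcases Nat.lt_or_ge 0 k with h | h
      · exact Fil_anti h hk
      · exact Fil_anti (by omega) hl
    rw [scalar_Fil r this, map_zero]
  | succ i ih =>
    have hin : i < n := hi
    have ih' := fun x k l hkl => ih (by omega) x k l hkl
    set e := fr.e i with he
    set f := fr.f i with hf
    have hee : B e e = 0 := hB _
    have hff : B f f = 0 := hB _
    have hef : B e f = 1 := by rw [he, hf, fr.ef i hin i hin, if_pos rfl]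
    have hfe : B f e = 1 := by rw [he, hf, fr.fe i hin i hin, if_pos rfl]
    -- membership in the smaller stage
    have hmem : ∀ u : ExteriorAlgebra F V, ctr (B e) u = 0 → ctr (B f) u = 0 →
        (∀ d ∈ LamU fr (i + 1), ctr d u = 0) → ∀ d ∈ LamU fr i, ctr d u = 0 := by
      rintro u h1 h2 h3 d (⟨j, hij, hj, hd⟩ | hd)
      · rcases Nat.eq_or_lt_of_le hij with rfl | hij'
        · rcases hd with rfl | rfl
          · exact h1
          · exact h2
        · exact h3 d (Or.inl ⟨j, hij', hj, hd⟩)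
      · exact h3 d (Or.inr hd)
    have hde : ∀ d ∈ LamU fr (i + 1), d e = 0 ∧ d f = 0 := by
      rintro d (⟨j, hij, hj, rfl | rfl⟩ | ⟨j, hj, rfl⟩)
      · exact ⟨fr.ee j hj i hin, by rw [hf, fr.ef j hj i hin, if_neg (by omega)]⟩
      · exact ⟨by rw [he, fr.fe j hj i hin, if_neg (by omega)], fr.ff j hj i hin⟩
      · exact ⟨fr.ge j hj i hin, fr.gf j hj i hin⟩
    have hdm : ∀ u : ExteriorAlgebra F V, (∀ d ∈ LamU fr (i + 1), ctr d u = 0) →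
        (∀ d ∈ LamU fr (i + 1), ctr d (ExteriorAlgebra.ι F e * u) = 0) ∧
        (∀ d ∈ LamU fr (i + 1), ctr d (ExteriorAlgebra.ι F f * u) = 0) := by
      intro u hu
      constructor
      · intro d hd
        rw [ctr_mul, (hde d hd).1, hu d hd]; simp
      · intro d hd
        rw [ctr_mul, (hde d hd).2, hu d hd]; simp
    have hdc : ∀ (d' : Module.Dual F V) (u : ExteriorAlgebra F V), (∀ d ∈ LamU fr (i + 1), ctr d u = 0) →
        ∀ d ∈ LamU fr (i + 1), ctr d (ctr d' u) = 0 := by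
      intro d' u hu d hd
      rw [ctr_comm, hu d hd, map_zero, neg_zero]
    -- components
    obtain ⟨z, hz⟩ : ∃ z, z = ctr (B e) (ctr (B f) x) := ⟨_, rfl⟩
    obtain ⟨a, ha⟩ : ∃ a, a = ctr (B f) x - ExteriorAlgebra.ι F f * z := ⟨_, rfl⟩
    obtain ⟨b, hb⟩ : ∃ b, b = ctr (B e) x + ExteriorAlgebra.ι F e * z := ⟨_, rfl⟩
    obtain ⟨y, hy⟩ : ∃ y, y = x - ExteriorAlgebra.ι F e * a - ExteriorAlgebra.ι F f * b
      - ExteriorAlgebra.ι F e * (ExteriorAlgebra.ι F f * z) := ⟨_, rfl⟩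
    have hx' : x = y + ExteriorAlgebra.ι F e * a + ExteriorAlgebra.ι F f * b
      + ExteriorAlgebra.ι F e * (ExteriorAlgebra.ι F f * z) := by rw [hy]; abel
    have ze : ctr (B e) z = 0 := by rw [hz, ctr_ctr]
    have zf : ctr (B f) z = 0 := by rw [hz, ctr_comm, ctr_ctr, map_zero, neg_zero]
    have ae : ctr (B e) a = 0 := by
      rw [ha, map_sub, ctr_mul, hef, ze, ← hz]; simp
    have af : ctr (B f) a = 0 := by
      rw [ha, map_sub, ctr_mul, hff, zf, ctr_ctr]; simp
    have be : ctr (B e) b = 0 := by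
      rw [hb, map_add, ctr_mul, hee, ze, ctr_ctr]; simp
    have bf : ctr (B f) b = 0 := by
      rw [hb, map_add, ctr_mul, hfe, zf, ctr_comm, ← hz]; simp
    have ye : ctr (B e) y = 0 := by
      rw [hy]
      simp only [map_sub, ctr_mul, hee, hef, ae, be, ze]
      rw [hb]; simp
    have yf : ctr (B f) y = 0 := by
      rw [hy]
      simp only [map_sub, ctr_mul, hff, hfe, af, bf, zf]
      rw [ha]; simp
    have zL : ∀ d ∈ LamU fr (i + 1), ctr d z = 0 := by
      rw [hz]; exact hdc _ _ (hdc _ _ hx)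
    have aL : ∀ d ∈ LamU fr (i + 1), ctr d a = 0 := by
      intro d hd
      rw [ha, map_sub, hdc _ _ hx d hd, (hdm z zL).2 d hd, sub_zero]
    have bL : ∀ d ∈ LamU fr (i + 1), ctr d b = 0 := by
      intro d hd
      rw [hb, map_add, hdc _ _ hx d hd, (hdm z zL).1 d hd, add_zero]
    have yL : ∀ d ∈ LamU fr (i + 1), ctr d y = 0 := by
      intro d hd
      rw [hy, map_sub, map_sub, map_sub, hx d hd, (hdm a aL).1 d hd, (hdm b bL).2 d hd,
        (hdm _ (hdm z zL).2).1 d hd]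
      simp
    -- degrees of the components
    have zk : z ∈ Fil F V (k - 2) := by
      rw [hz]; exact Fil_ctr _ _ (Fil_ctr _ _ hk)
    have ak : a ∈ Fil F V (k - 1) := by
      rw [ha]; exact Submodule.sub_mem _ (Fil_ctr _ _ hk) (Fil_mul' (by omega) _ zk)
    have bk : b ∈ Fil F V (k - 1) := by
      rw [hb]; exact Submodule.add_mem _ (Fil_ctr _ _ hk) (Fil_mul' (by omega) _ zk)
    have yk : y ∈ Fil F V k := by
      rw [hy]
      refine Submodule.sub_mem _ (Submodule.sub_mem _ (Submodule.sub_mem _ hk ?_) ?_) ?_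
      · exact Fil_mul' (by omega) _ ak
      · exact Fil_mul' (by omega) _ bk
      · exact Fil_mul' (k := k - 2 + 1) (by omega) _ (Fil_mul _ zk)
    -- images
    set E := Eop B hB with hE
    have Ez : E z ∈ Fil F V (l - 2) := by
      rw [hz, hE, Eop_ctr, Eop_ctr]; exact Fil_ctr _ _ (Fil_ctr _ _ hl)
    have Ea : E a = ctr (B f) (E x) - ExteriorAlgebra.ι F f * E z := by
      rw [ha, map_sub, hE, Eop_mul, Eop_ctr, ← Eop_ctr B hB (B f) z, zf]; simp
    have Eb : E b = ctr (B e) (E x) + ExteriorAlgebra.ι F e * E z := by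
      rw [hb, map_add, hE, Eop_mul, Eop_ctr, ← Eop_ctr B hB (B e) z, ze]; simp
    have Eal : E a ∈ Fil F V (l - 1) := by
      rw [Ea]; exact Submodule.sub_mem _ (Fil_ctr _ _ hl) (Fil_mul' (by omega) _ Ez)
    have Ebl : E b ∈ Fil F V (l - 1) := by
      rw [Eb]; exact Submodule.add_mem _ (Fil_ctr _ _ hl) (Fil_mul' (by omega) _ Ez)
    have a0 : a = 0 := ih' a _ _ (by omega) (hmem a ae af aL) ak Eal
    have b0 : b = 0 := ih' b _ _ (by omega) (hmem b be bf bL) bk Ebl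
    have Ex : E (y - z) = E x - ExteriorAlgebra.ι F e * (ExteriorAlgebra.ι F f * E z) := by
      have h1 : E (ExteriorAlgebra.ι F f * z) = ExteriorAlgebra.ι F f * E z := by
        rw [hE, Eop_mul, ← Eop_ctr B hB (B f) z, zf]; simp
      have h2 : E (ExteriorAlgebra.ι F e * (ExteriorAlgebra.ι F f * z)) =
          ExteriorAlgebra.ι F e * (ExteriorAlgebra.ι F f * E z) - E z := by
        rw [hE, Eop_mul, ← hE, h1, ctr_mul, hef, hE, ← Eop_ctr B hB (B e) z, ze]; simp
      conv_rhs => rw [hx', a0, b0]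
      rw [mul_zero, mul_zero, add_zero, add_zero, map_add, h2, map_sub]
      abel
    have yz : y - z = 0 := by
      refine ih' (y - z) (k - 2) l (by omega) (hmem _ ?_ ?_ ?_) ?_ ?_
      · rw [map_sub, ye, ze, sub_zero]
      · rw [map_sub, yf, zf, sub_zero]
      · intro d hd
        rw [map_sub, yL d hd, zL d hd, sub_zero]
      · exact Submodule.sub_mem _ (Fil_anti (by omega) yk) zk
      · rw [Ex]
        exact Submodule.sub_mem _ hl (Fil_mul' (k := l - 2 + 1) (by omega) _ (Fil_mul _ Ez))
    have zy : z = y := (sub_eq_zero.1 yz).symm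
    have z0 : z = 0 := ih' z k (l - 2) (by omega) (hmem z ze zf zL) (zy ▸ yk) Ez
    rw [hx', a0, b0, ← zy, z0]
    simp

/-- the numbers `binom(N,k) - binom(N,k-2)` -/
def sd (N : ℕ) : ℕ → ℤ
  | 0 => 1
  | 1 => N
  | (k + 2) => (N.choose (k + 2) : ℤ) - N.choose k

lemma sd_succ (N k : ℕ) : sd (N + 1) (k + 1) = sd N (k + 1) + sd N k := by
  rcases k with _ | _ | k
  · simp [sd]
  · simp [sd, Nat.choose_succ_succ]; ring
  · simp only [sd, Nat.choose_succ_succ]; push_cast; ring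

lemma sd_boundary (i : ℕ) : sd (2 * i) (i + 1) = 0 := by
  rcases i with _ | i
  · simp [sd]
  · simp only [sd]
    have := Nat.choose_symm_of_eq_add (n := 2 * (i + 1)) (a := i + 2) (b := i) (by omega)
    rw [this]; simp

lemma upperU [FiniteDimensional F V] (fr : Frame q B n c) (i : ℕ) (hi : i ≤ n) (k : ℕ)
    (hk : k ≤ i + 1) : (Module.finrank F (XX B hB (LamU fr i) k) : ℤ) ≤ sd (2 * i) k := by
  induction i generalizing k with
  | zero =>
    rcases k with _ | k
    · simpa [sd] using XX_zero_le (B := B) (hB := hB) (LamU fr 0)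
    · obtain rfl : k = 0 := by omega
      have : XX B hB (LamU fr 0) 1 = ⊥ := by
        rw [eq_bot_iff]
        rintro x ⟨h1, h2, h3⟩
        have h4 := pow_le_Fil 1 h1
        exact vanish (hB := hB) fr 0 hi x 1 1 (by omega) h3 h4 (by rw [h2]; exact h4)
      rw [this]
      simp [sd]
  | succ i ih =>
    rcases k with _ | k
    · simpa [sd] using XX_zero_le (B := B) (hB := hB) (LamU fr (i + 1))
    · rcases Nat.eq_or_lt_of_le hk with hk' | hk'
      · obtain rfl : k = i + 1 := by omega
        have : XX B hB (LamU fr (i + 1)) (i + 1 + 1) = ⊥ := by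
          rw [eq_bot_iff]
          rintro x ⟨h1, h2, h3⟩
          have h4 := pow_le_Fil _ h1
          exact vanish (hB := hB) fr (i + 1) hi x (i + 1 + 1) (i + 1 + 1) (by omega) h3 h4 (by rw [h2]; exact h4)
        rw [this, sd_boundary]
        simp
      · have hsub : LamU fr i ⊆ insert (B (fr.f i)) (insert (B (fr.e i)) (LamU fr (i + 1))) := by
          rintro d (⟨j, hij, hj, hd⟩ | hd)
          · rcases Nat.eq_or_lt_of_le hij with rfl | hij'
            · rcases hd with rfl | rfl <;> simp
            · exact Or.inr (Or.inr (Or.inl ⟨j, hij', hj, hd⟩))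
          · exact Or.inr (Or.inr (Or.inr hd))
        have hm : ∀ t, (Module.finrank F (XX B hB (insert (B (fr.f i)) (insert (B (fr.e i))
            (LamU fr (i + 1)))) t) : ℤ) ≤ Module.finrank F (XX B hB (LamU fr i) t) :=
          fun t => by exact_mod_cast Submodule.finrank_mono (XX_anti hsub t)
        have s1 := fun t => XX_stepZ (B := B) (hB := hB) (LamU fr (i + 1)) (B (fr.e i)) t
        have s2 := fun t => XX_stepZ (B := B) (hB := hB) (insert (B (fr.e i)) (LamU fr (i + 1)))
          (B (fr.f i)) t
        have e1 : ∀ t, t ≤ i + 1 → (Module.finrank F (XX B hB (LamU fr i) t) : ℤ) ≤ sd (2 * i) t :=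
          fun t ht => ih (by omega) t ht
        have e2 : ∀ t, t ≤ i + 1 → (Module.finrank F (XX B hB (insert (B (fr.e i)) (LamU fr (i + 1))) t) : ℤ)
            ≤ sd (2 * i + 1) t := by
          intro t ht
          rcases t with _ | t
          · simpa [sd] using XX_zero_le (B := B) (hB := hB) (insert (B (fr.e i)) (LamU fr (i + 1)))
          · rw [sd_succ]
            linarith [s2 t, hm (t + 1), hm t, e1 (t + 1) ht, e1 t (by omega)]
        rw [show 2 * (i + 1) = 2 * i + 1 + 1 by ring, sd_succ]
        linarith [s1 k, e2 (k + 1) (by omega), e2 k (by omega)]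

lemma upperC [FiniteDimensional F V] (fr : Frame q B n c) (j : ℕ) (hj : j ≤ c) (k : ℕ)
    (hk : k ≤ n) : (Module.finrank F (XX B hB (LamC fr j) k) : ℤ) ≤ sd (2 * n + j) k := by
  induction j generalizing k with
  | zero =>
    have : LamU fr n ⊆ LamC fr 0 := by
      rintro d (⟨j, hij, hj, hd⟩ | ⟨l, hl, hd⟩)
      · omega
      · exact ⟨l, Nat.zero_le _, hl, hd⟩
    refine le_trans ?_ (upperU (hB := hB) fr n le_rfl k (by omega))
    exact_mod_cast Submodule.finrank_mono (XX_anti this k)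
  | succ j ih =>
    rcases k with _ | k
    · simpa [sd] using XX_zero_le (B := B) (hB := hB) (LamC fr (j + 1))
    · have hsub : LamC fr j ⊆ insert (fr.g j) (LamC fr (j + 1)) := by
        rintro d ⟨l, hjl, hl, rfl⟩
        rcases Nat.eq_or_lt_of_le hjl with rfl | hjl'
        · exact Or.inl rfl
        · exact Or.inr ⟨l, hjl', hl, rfl⟩
      have hm : ∀ t, (Module.finrank F (XX B hB (insert (fr.g j) (LamC fr (j + 1))) t) : ℤ) ≤
          Module.finrank F (XX B hB (LamC fr j) t) :=
        fun t => by exact_mod_cast Submodule.finrank_mono (XX_anti hsub t)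
      have s1 := XX_stepZ (B := B) (hB := hB) (LamC fr (j + 1)) (fr.g j) k
      rw [← add_assoc, sd_succ]
      linarith [hm (k + 1), hm k, ih (by omega) (k + 1) hk, ih (by omega) k (by omega)]

end upper

end PolarGrass

namespace PolarGrass

section lower

variable {F : Type*} [Field F] {V : Type*} [AddCommGroup V] [Module F V]
variable {B : LinearMap.BilinForm F V} {q : QuadraticForm F V} {n c : ℕ}

lemma finrank_ge {M : Type*} [AddCommGroup M] [Module F M] (A P Q : Submodule F M)
    [FiniteDimensional F M] (D : M →ₗ[F] M) (hP : P ≤ A) (hP' : ∀ x ∈ P, D x = 0)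
    (hQ : Q ≤ A.map D) :
    (Module.finrank F P : ℤ) + Module.finrank F Q ≤ Module.finrank F A := by
  have h := finrank_split A D
  have h1 : Module.finrank F P ≤ Module.finrank F (A ⊓ LinearMap.ker D : Submodule F M) :=
    Submodule.finrank_mono (le_inf hP hP')
  have h2 := Submodule.finrank_mono hQ
  omega

/-- lists supported on the first `i` hyperbolic pairs; the pairs in `H` are still free -/
structure GoodU (fr : Frame q B n c) (i : ℕ) (H : Finset ℕ) (L : List V) : Prop where
  sing : ∀ v ∈ L, q v = 0
  iso : ∀ v ∈ L, ∀ w ∈ L, B v w = 0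
  Hs : ∀ h ∈ H, h < i
  card : H.card + L.length = i
  ortH : ∀ v ∈ L, ∀ h ∈ H, B (fr.e h) v = 0 ∧ B (fr.f h) v = 0
  ortL : ∀ v ∈ L, ∀ l, i ≤ l → l < n → B (fr.e l) v = 0 ∧ B (fr.f l) v = 0
  g0 : ∀ v ∈ L, ∀ l < c, fr.g l v = 0
  w0 : ∀ v ∈ L, ∀ l < c, B v (fr.w l) = 0

/-- lists supported on the pairs and the first `j` further vectors -/
structure GoodC (fr : Frame q B n c) (j : ℕ) (H : Finset ℕ) (L : List V) : Prop where
  sing : ∀ v ∈ L, q v = 0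
  iso : ∀ v ∈ L, ∀ w ∈ L, B v w = 0
  Hs : ∀ h ∈ H, h < n
  card : H.card + L.length = n
  ortH : ∀ v ∈ L, ∀ h ∈ H, B (fr.e h) v = 0 ∧ B (fr.f h) v = 0
  g0 : ∀ v ∈ L, ∀ l, j ≤ l → l < c → fr.g l v = 0
  rep : ∀ l < c, ∃ u, (∀ l' < c, fr.g l' u = 0) ∧
    (∀ h ∈ H, B (fr.e h) u = 0 ∧ B (fr.f h) u = 0) ∧ ∀ v ∈ L, B v u = B v (fr.w l)

/-- span of the wedges of good lists -/
def TU (fr : Frame q B n c) (i k : ℕ) : Submodule F (ExteriorAlgebra F V) :=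
  Submodule.span F {x | ∃ H L, GoodU fr i H L ∧ L.length = k ∧ x = wedge L}

/-- span of the wedges of good lists -/
def TC (fr : Frame q B n c) (j k : ℕ) : Submodule F (ExteriorAlgebra F V) :=
  Submodule.span F {x | ∃ H L, GoodC fr j H L ∧ L.length = k ∧ x = wedge L}

lemma iso_cons (hs : ∀ x y, B x y = B y x) (hB : ∀ v, B v v = 0) (v : V) (L : List V)
    (hL : ∀ v ∈ L, ∀ w ∈ L, B v w = 0) (hv : ∀ w ∈ L, B v w = 0) :
    ∀ x ∈ v :: L, ∀ w ∈ v :: L, B x w = 0 := by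
  intro x hx w hw
  rcases List.mem_cons.1 hx with rfl | hx'
  · rcases List.mem_cons.1 hw with rfl | hw'
    · exact hB _
    · exact hv w hw'
  · rcases List.mem_cons.1 hw with rfl | hw'
    · rw [hs]; exact hv x hx'
    · exact hL x hx' w hw'

lemma GoodU.skip {fr : Frame q B n c} {i : ℕ} (hi : i < n) {H : Finset ℕ} {L : List V}
    (h : GoodU fr i H L) : GoodU fr (i + 1) (insert i H) L where
  sing := h.sing
  iso := h.iso
  Hs := by
    intro j hj
    rcases Finset.mem_insert.1 hj with rfl | hj
    · omega
    · have := h.Hs j hj; omega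
  card := by
    rw [Finset.card_insert_of_notMem (fun hh => lt_irrefl _ (h.Hs i hh))]
    have := h.card; omega
  ortH := by
    intro v hv j hj
    rcases Finset.mem_insert.1 hj with rfl | hj
    · exact h.ortL v hv _ le_rfl hi
    · exact h.ortH v hv j hj
  ortL := fun v hv l hl hl' => h.ortL v hv l (by omega) hl'
  g0 := h.g0
  w0 := h.w0

lemma GoodU.addE (hs : ∀ x y, B x y = B y x) (hB : ∀ v, B v v = 0)
    {fr : Frame q B n c} {i : ℕ} (hi : i < n) {H : Finset ℕ} {L : List V}
    (h : GoodU fr i H L) : GoodU fr (i + 1) H (fr.e i :: L) where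
  sing := List.forall_mem_cons.2 ⟨fr.qe i hi, h.sing⟩
  iso := iso_cons hs hB _ _ h.iso (fun w hw => (h.ortL w hw i le_rfl hi).1)
  Hs := fun j hj => (h.Hs j hj).trans (Nat.lt_succ_self i)
  card := by have := h.card; simp; omega
  ortH := List.forall_mem_cons.2 ⟨fun j hj => by
    have := h.Hs j hj
    rw [fr.ee j (by omega) i hi, fr.fe j (by omega) i hi, if_neg (by omega)]; simp, h.ortH⟩
  ortL := List.forall_mem_cons.2 ⟨fun j hj hj' => by
    rw [fr.ee j (by omega) i hi, fr.fe j (by omega) i hi, if_neg (by omega)]; simp,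
    fun v hv l hl hl' => h.ortL v hv l (by omega) hl'⟩
  g0 := List.forall_mem_cons.2 ⟨fun l hl => fr.ge l hl i hi, h.g0⟩
  w0 := List.forall_mem_cons.2 ⟨fun l hl => fr.ew i hi l hl, h.w0⟩

lemma GoodU.addF (hs : ∀ x y, B x y = B y x) (hB : ∀ v, B v v = 0)
    {fr : Frame q B n c} {i : ℕ} (hi : i < n) {H : Finset ℕ} {L : List V}
    (h : GoodU fr i H L) : GoodU fr (i + 1) H (fr.f i :: L) where
  sing := List.forall_mem_cons.2 ⟨fr.qf i hi, h.sing⟩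
  iso := iso_cons hs hB _ _ h.iso (fun w hw => (h.ortL w hw i le_rfl hi).2)
  Hs := fun j hj => (h.Hs j hj).trans (Nat.lt_succ_self i)
  card := by have := h.card; simp; omega
  ortH := List.forall_mem_cons.2 ⟨fun j hj => by
    have := h.Hs j hj
    rw [fr.ff j (by omega) i hi, fr.ef j (by omega) i hi, if_neg (by omega)]; simp, h.ortH⟩
  ortL := List.forall_mem_cons.2 ⟨fun j hj hj' => by
    rw [fr.ff j (by omega) i hi, fr.ef j (by omega) i hi, if_neg (by omega)]; simp,
    fun v hv l hl hl' => h.ortL v hv l (by omega) hl'⟩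
  g0 := List.forall_mem_cons.2 ⟨fun l hl => fr.gf l hl i hi, h.g0⟩
  w0 := List.forall_mem_cons.2 ⟨fun l hl => fr.fw i hi l hl, h.w0⟩

lemma GoodU.pair (hs : ∀ x y, B x y = B y x) (hB : ∀ v, B v v = 0)
    (hq : ∀ x y, q (x + y) = q x + q y + B x y) (h2 : ∀ a : F, a + a = 0)
    {fr : Frame q B n c} {i : ℕ} (hi : i < n) {H : Finset ℕ} {L : List V}
    (h : GoodU fr i H L) (t : ℕ) (ht : t ∈ H) :
    GoodU fr (i + 1) (H.erase t) ((fr.e i + fr.e t) :: (fr.f i + fr.f t) :: L) := by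
  have hti := h.Hs t ht
  have htn : t < n := by omega
  have hne : i ≠ t := by omega
  have hcard := Finset.card_erase_of_mem ht
  have hpos : 0 < H.card := Finset.card_pos.2 ⟨t, ht⟩
  refine ⟨?_, ?_, ?_, ?_, ?_, ?_, ?_, ?_⟩
  · refine List.forall_mem_cons.2 ⟨?_, List.forall_mem_cons.2 ⟨?_, h.sing⟩⟩
    · rw [hq, fr.qe i hi, fr.qe t htn, fr.ee i hi t htn]; simp
    · rw [hq, fr.qf i hi, fr.qf t htn, fr.ff i hi t htn]; simp
  · refine iso_cons hs hB _ _ (iso_cons hs hB _ _ h.iso ?_) (List.forall_mem_cons.2 ⟨?_, ?_⟩)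
    · intro w hw
      simp [(h.ortL w hw i le_rfl hi).2, (h.ortH w hw t ht).2]
    · simp [fr.ef i hi i hi, fr.ef t htn t htn, fr.ef i hi t htn, fr.ef t htn i hi, hne, hne.symm, h2]
    · intro w hw
      simp [(h.ortL w hw i le_rfl hi).1, (h.ortH w hw t ht).1]
  · intro j hj
    have := h.Hs j (Finset.mem_of_mem_erase hj)
    omega
  · have := h.card
    simp only [List.length_cons]
    omega
  · have key : ∀ j ∈ H.erase t, j < n ∧ j ≠ i ∧ j ≠ t := by
      intro j hj
      have := h.Hs j (Finset.mem_of_mem_erase hj)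
      exact ⟨by omega, by omega, Finset.ne_of_mem_erase hj⟩
    refine List.forall_mem_cons.2 ⟨?_, List.forall_mem_cons.2 ⟨?_, ?_⟩⟩
    · intro j hj
      obtain ⟨h1, h3, h4⟩ := key j hj
      simp [fr.ee j h1 i hi, fr.ee j h1 t htn, fr.fe j h1 i hi, fr.fe j h1 t htn, h3, h4]
    · intro j hj
      obtain ⟨h1, h3, h4⟩ := key j hj
      simp [fr.ff j h1 i hi, fr.ff j h1 t htn, fr.ef j h1 i hi, fr.ef j h1 t htn, h3, h4]
    · exact fun v hv j hj => h.ortH v hv j (Finset.mem_of_mem_erase hj)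
  · refine List.forall_mem_cons.2 ⟨?_, List.forall_mem_cons.2 ⟨?_, ?_⟩⟩
    · intro j hj h1
      have h3 : j ≠ i := by omega
      have h4 : j ≠ t := by omega
      simp [fr.ee j h1 i hi, fr.ee j h1 t htn, fr.fe j h1 i hi, fr.fe j h1 t htn, h3, h4]
    · intro j hj h1
      have h3 : j ≠ i := by omega
      have h4 : j ≠ t := by omega
      simp [fr.ff j h1 i hi, fr.ff j h1 t htn, fr.ef j h1 i hi, fr.ef j h1 t htn, h3, h4]
    · exact fun v hv j hj => h.ortL v hv j (by omega)
  · refine List.forall_mem_cons.2 ⟨?_, List.forall_mem_cons.2 ⟨?_, h.g0⟩⟩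
    · intro l hl
      simp [fr.ge l hl i hi, fr.ge l hl t htn]
    · intro l hl
      simp [fr.gf l hl i hi, fr.gf l hl t htn]
  · refine List.forall_mem_cons.2 ⟨?_, List.forall_mem_cons.2 ⟨?_, h.w0⟩⟩
    · intro l hl
      simp [fr.ew i hi l hl, fr.ew t htn l hl]
    · intro l hl
      simp [fr.fw i hi l hl, fr.fw t htn l hl]

lemma TU_killed {fr : Frame q B n c} {i k l : ℕ} (hil : i ≤ l) (hl : l < n)
    {x : ExteriorAlgebra F V} (hx : x ∈ TU fr i k) :
    ctr (B (fr.e l)) x = 0 ∧ ctr (B (fr.f l)) x = 0 := by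
  have h1 : TU fr i k ≤ LinearMap.ker (ctr (B (fr.e l))) ⊓ LinearMap.ker (ctr (B (fr.f l))) := by
    refine Submodule.span_le.2 ?_
    rintro _ ⟨H, L, hL, -, rfl⟩
    exact ⟨ctr_wedge _ _ (fun v hv => (hL.ortL v hv l hil hl).1),
      ctr_wedge _ _ (fun v hv => (hL.ortL v hv l hil hl).2)⟩
  exact h1 hx

lemma TU_zero (fr : Frame q B n c) [FiniteDimensional F V] (i : ℕ) :
    (1 : ℤ) ≤ Module.finrank F (TU fr i 0) := by
  have h1 : (1 : ExteriorAlgebra F V) ∈ TU fr i 0 :=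
    Submodule.subset_span ⟨Finset.range i, [],
      ⟨by simp, by simp, by simp, by simp, by simp, by simp, by simp, by simp⟩, rfl, rfl⟩
  have : Module.finrank F (TU fr i 0) ≠ 0 := by
    intro h0
    rw [Submodule.finrank_eq_zero] at h0
    rw [h0, Submodule.mem_bot] at h1
    exact one_ne_zero h1
  omega

lemma lowerU [FiniteDimensional F V] (hs : ∀ x y, B x y = B y x) (hB : ∀ v, B v v = 0)
    (hq : ∀ x y, q (x + y) = q x + q y + B x y) (h2 : ∀ a : F, a + a = 0)
    (fr : Frame q B n c) (i : ℕ) (hi : i ≤ n) (k : ℕ)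
    (hk : k ≤ i + 1) : sd (2 * i) k ≤ (Module.finrank F (TU fr i k) : ℤ) := by
  induction i generalizing k with
  | zero =>
    rcases k with _ | k
    · exact TU_zero fr 0
    · obtain rfl : k = 0 := by omega
      simp [sd]
  | succ i ih =>
    rcases k with _ | k
    · exact TU_zero fr _
    · rcases Nat.eq_or_lt_of_le hk with hk' | hk'
      · obtain rfl : k = i + 1 := by omega
        rw [sd_boundary]
        positivity
      · have hin : i < n := hi
        have hee : B (fr.e i) (fr.e i) = 0 := hB _
        have hff : B (fr.f i) (fr.f i) = 0 := hB _
        have hef : B (fr.e i) (fr.f i) = 1 := by rw [fr.ef i hin i hin, if_pos rfl]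
        have hfe : B (fr.f i) (fr.e i) = 1 := by rw [fr.fe i hin i hin, if_pos rfl]
        have ih' := fun k hk => ih (by omega) k hk
        set De := ctr (B (fr.f i)) with hDe
        set Df := ctr (B (fr.e i)) with hDf
        set A := TU fr (i + 1) (k + 1) with hA
        have kl : ∀ {t : ℕ} {x : ExteriorAlgebra F V}, x ∈ TU fr i t → Df x = 0 ∧ De x = 0 :=
          fun hx => TU_killed le_rfl hin hx
        -- inclusions
        have i1 : TU fr i (k + 1) ≤ A := by
          refine Submodule.span_le.2 ?_
          rintro _ ⟨H, L, hL, hl, rfl⟩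
          exact Submodule.subset_span ⟨_, L, hL.skip hin, hl, rfl⟩
        have i2 : TU fr i k ≤ A.comap (LinearMap.mulLeft F (ExteriorAlgebra.ι F (fr.e i))) := by
          refine Submodule.span_le.2 ?_
          rintro _ ⟨H, L, hL, hl, rfl⟩
          exact Submodule.subset_span ⟨_, _, hL.addE hs hB hin, by simp [hl],
            (wedge_cons _ _).symm⟩
        have i3 : TU fr i k ≤ A.comap (LinearMap.mulLeft F (ExteriorAlgebra.ι F (fr.f i))) := by
          refine Submodule.span_le.2 ?_
          rintro _ ⟨H, L, hL, hl, rfl⟩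
          exact Submodule.subset_span ⟨_, _, hL.addF hs hB hin, by simp [hl],
            (wedge_cons _ _).symm⟩
        set K := TU fr i (k + 1) ⊔ (TU fr i k).map (LinearMap.mulLeft F (ExteriorAlgebra.ι F (fr.f i)))
          with hK
        have hKA : K ≤ A := sup_le i1 (Submodule.map_le_iff_le_comap.2 i3)
        have hK0 : K ≤ LinearMap.ker De := by
          refine sup_le (fun x hx => (kl hx).2) ?_
          rintro _ ⟨x, hx, rfl⟩
          rw [LinearMap.mem_ker, LinearMap.mulLeft_apply, hDe, ctr_mul, hff, ← hDe, (kl hx).2]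
          simp
        have d1 := finrank_ge A K (A.map De) De hKA hK0 le_rfl
        have d2 := finrank_ge K (TU fr i (k + 1)) (TU fr i k) Df le_sup_left
          (fun x hx => (kl hx).1) (by
            intro x hx
            refine ⟨ExteriorAlgebra.ι F (fr.f i) * x, le_sup_right (a := TU fr i (k + 1)) ⟨x, hx, rfl⟩, ?_⟩
            rw [hDf, ctr_mul, hef, ← hDf, (kl hx).1]; simp)
        have i4 : TU fr i k ≤ A.map De := by
          intro x hx
          refine ⟨_, i2 hx, ?_⟩
          rw [LinearMap.mulLeft_apply, hDe, ctr_mul, hfe, ← hDe, (kl hx).2]; simp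
        rw [show 2 * (i + 1) = 2 * i + 1 + 1 by ring, sd_succ]
        rcases k with _ | k
        · have d3 := Submodule.finrank_mono i4
          have e1 := ih' 1 (by omega)
          have e2 := ih' 0 (by omega)
          have : sd (2 * i + 1) 0 = sd (2 * i) 0 := rfl
          rw [sd_succ, this]
          simp only [zero_add] at *
          have d3' : (Module.finrank F (TU fr i 0) : ℤ) ≤ Module.finrank F (A.map De) := by
            exact_mod_cast d3
          linarith
        · have d3 := finrank_ge (A.map De) (TU fr i (k + 1)) (TU fr i k) Df i4
            (fun x hx => (kl hx).1) (by
              refine Submodule.span_le.2 ?_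
              rintro _ ⟨H, L, hL, hl, rfl⟩
              have hpos : 0 < H.card := by have := hL.card; omega
              obtain ⟨t, ht⟩ := Finset.card_pos.1 hpos
              have hti := hL.Hs t ht
              have hL0 : wedge L ∈ TU fr i k := Submodule.subset_span ⟨H, L, hL, hl, rfl⟩
              refine ⟨_, ⟨_, Submodule.subset_span ⟨_, _, hL.pair hs hB hq h2 hin t ht, by simp [hl], rfl⟩,
                rfl⟩, ?_⟩
              rw [wedge_cons, wedge_cons, hDe, ctr_mul, ctr_mul, ← hDe, (kl hL0).2]
              have c1 : B (fr.f i) (fr.e i + fr.e t) = 1 := by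
                rw [map_add, hfe, fr.fe i hin t (by omega), if_neg (by omega), add_zero]
              have c2 : B (fr.f i) (fr.f i + fr.f t) = 0 := by
                rw [map_add, hff, fr.ff i hin t (by omega), add_zero]
              have c3 : B (fr.e i) (fr.f i + fr.f t) = 1 := by
                rw [map_add, hef, fr.ef i hin t (by omega), if_neg (by omega), add_zero]
              rw [c1, c2]
              simp only [one_smul, zero_smul, mul_zero, sub_zero]
              rw [hDf, ctr_mul, c3, ← hDf, (kl hL0).1]
              simp)
          have e1 := ih' (k + 1 + 1) (by omega)
          have e2 := ih' (k + 1) (by omega)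
          have e3 := ih' k (by omega)
          rw [sd_succ, sd_succ]
          linarith

lemma GoodC.addC (hs : ∀ x y, B x y = B y x) (hB : ∀ v, B v v = 0)
    (hq : ∀ x y, q (x + y) = q x + q y + B x y) (h2 : ∀ a : F, a + a = 0)
    {fr : Frame q B n c} {j : ℕ} (hj : j < c) {H : Finset ℕ} {L : List V}
    (h : GoodC fr j H L) (t : ℕ) (ht : t ∈ H) :
    ∃ v, fr.g j v = 1 ∧ GoodC fr (j + 1) (H.erase t) (v :: L) := by
  obtain ⟨u, u1, u2, u3⟩ := h.rep j hj
  have htn := h.Hs t ht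
  have hcard := Finset.card_erase_of_mem ht
  have hpos : 0 < H.card := Finset.card_pos.2 ⟨t, ht⟩
  set a := q (fr.w j + u) with ha
  have qs : ∀ (r : F) x, q x = 0 → q (r • x) = 0 := fun r x hx => by
    rw [QuadraticMap.map_smul, hx, smul_zero]
  have htt : B (fr.e t) (fr.f t) = 1 := by rw [fr.ef t htn t htn, if_pos rfl]
  have key : ∀ y ∈ H.erase t, y ∈ H ∧ y < n ∧ y ≠ t := fun y hy =>
    ⟨Finset.mem_of_mem_erase hy, h.Hs y (Finset.mem_of_mem_erase hy), Finset.ne_of_mem_erase hy⟩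
  refine ⟨(fr.w j + u) + (fr.e t + a • fr.f t), ?_, ?_⟩
  · simp [fr.gw j hj j hj, u1 j hj, fr.ge j hj t htn, fr.gf j hj t htn]
  refine ⟨?_, ?_, ?_, ?_, ?_, ?_, ?_⟩
  · refine List.forall_mem_cons.2 ⟨?_, h.sing⟩
    rw [hq, hq (fr.e t), fr.qe t htn, qs a _ (fr.qf t htn), hs (fr.w j + u), ← ha]
    simp [htt, fr.ew t htn j hj, fr.fw t htn j hj, u2 t ht, h2]
  · refine iso_cons hs hB _ _ h.iso ?_
    intro v hv
    rw [hs]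
    simp [u3 v hv, hs v (fr.e t), hs v (fr.f t), h.ortH v hv t ht, h2]
  · exact fun y hy => (key y hy).2.1
  · have := h.card
    simp only [List.length_cons]
    omega
  · refine List.forall_mem_cons.2 ⟨?_, fun v hv y hy => h.ortH v hv y (key y hy).1⟩
    intro y hy
    obtain ⟨k1, k2, k3⟩ := key y hy
    simp [fr.ew y k2 j hj, fr.fw y k2 j hj, u2 y k1, fr.ee y k2 t htn, fr.ef y k2 t htn,
      fr.fe y k2 t htn, fr.ff y k2 t htn, k3]
  · refine List.forall_mem_cons.2 ⟨?_, fun v hv l hl hl' => h.g0 v hv l (by omega) hl'⟩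
    intro l hl hl'
    have : l ≠ j := by omega
    simp [fr.gw l hl' j hj, u1 l hl', fr.ge l hl' t htn, fr.gf l hl' t htn, this]
  · intro l hl
    obtain ⟨u', v1, v2, v3⟩ := h.rep l hl
    set v := (fr.w j + u) + (fr.e t + a • fr.f t) with hv
    have hvf : B v (fr.f t) = 1 := by
      rw [hs, hv]
      simp [fr.fw t htn j hj, u2 t ht, fr.fe t htn t htn, hB]
    refine ⟨u' + (B v (fr.w l) - B v u') • fr.f t, ?_, ?_, ?_⟩
    · intro l' hl'
      simp [v1 l' hl', fr.gf l' hl' t htn]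
    · intro y hy
      obtain ⟨k1, k2, k3⟩ := key y hy
      simp [v2 y k1, fr.ef y k2 t htn, fr.ff y k2 t htn, k3]
    · refine List.forall_mem_cons.2 ⟨?_, ?_⟩
      · rw [map_add, map_smul, hvf]; simp
      · intro x hx
        rw [map_add, map_smul, hs x (fr.f t), (h.ortH x hx t ht).2, v3 x hx]; simp

lemma lowerC [FiniteDimensional F V] (hs : ∀ x y, B x y = B y x) (hB : ∀ v, B v v = 0)
    (hq : ∀ x y, q (x + y) = q x + q y + B x y) (h2 : ∀ a : F, a + a = 0)
    (fr : Frame q B n c) (j : ℕ) (hj : j ≤ c) (k : ℕ)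
    (hk : k ≤ n) : sd (2 * n + j) k ≤ (Module.finrank F (TC fr j k) : ℤ) := by
  induction j generalizing k with
  | zero =>
    refine (lowerU hs hB hq h2 fr n le_rfl k (by omega)).trans ?_
    have : TU fr n k ≤ TC fr 0 k := by
      refine Submodule.span_mono ?_
      rintro _ ⟨H, L, h, hl, rfl⟩
      refine ⟨H, L, ⟨h.sing, h.iso, h.Hs, h.card, h.ortH, fun v hv l _ hl => h.g0 v hv l hl, ?_⟩, hl, rfl⟩
      intro l hl
      exact ⟨0, by simp, by simp, fun v hv => by rw [h.w0 v hv l hl, map_zero]⟩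
    exact_mod_cast Submodule.finrank_mono this
  | succ j ih =>
    have mono : ∀ k, TC fr j k ≤ TC fr (j + 1) k := by
      intro k
      refine Submodule.span_mono ?_
      rintro _ ⟨H, L, h, hl, rfl⟩
      exact ⟨H, L, ⟨h.sing, h.iso, h.Hs, h.card, h.ortH,
        fun v hv l hl hl' => h.g0 v hv l (by omega) hl', h.rep⟩, hl, rfl⟩
    have kl : ∀ k, TC fr j k ≤ LinearMap.ker (ctr (fr.g j)) := by
      intro k
      refine Submodule.span_le.2 ?_
      rintro _ ⟨H, L, h, hl, rfl⟩
      exact ctr_wedge _ _ (fun v hv => h.g0 v hv j le_rfl hj)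
    rcases k with _ | k
    · have e := ih (by omega) 0 (by omega)
      refine le_trans ?_ (e.trans (by exact_mod_cast Submodule.finrank_mono (mono 0)))
      simp [sd]
    · have d := finrank_ge (TC fr (j + 1) (k + 1)) (TC fr j (k + 1)) (TC fr j k) (ctr (fr.g j))
        (mono _) (fun x hx => kl _ hx) (by
          refine Submodule.span_le.2 ?_
          rintro _ ⟨H, L, h, hl, rfl⟩
          have hpos : 0 < H.card := by have := h.card; omega
          obtain ⟨t, ht⟩ := Finset.card_pos.1 hpos
          obtain ⟨v, hv, hg⟩ := h.addC hs hB hq h2 hj t ht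
          refine ⟨_, Submodule.subset_span ⟨_, _, hg, by simp [hl], rfl⟩, ?_⟩
          have h0 : ctr (fr.g j) (wedge L) = 0 :=
            ctr_wedge _ _ (fun v hv => h.g0 v hv j le_rfl hj)
          rw [wedge_cons, ctr_mul, hv, h0]; simp)
      rw [← add_assoc, sd_succ]
      linarith [ih (by omega) (k + 1) hk, ih (by omega) k (by omega)]

end lower

end PolarGrass

namespace PolarGrass

section final

variable {F : Type*} [Field F] {V : Type*} [AddCommGroup V] [Module F V]

lemma exists_frame [FiniteDimensional F V] (q : QuadraticForm F V) (B : LinearMap.BilinForm F V)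
    (hs : ∀ x y, B x y = B y x) (hB : ∀ v, B v v = 0) (n d₀ d : ℕ) (RS : Set V)
    (hdec : HasWittDecomp F V (fun x y => B x y) (fun v => q v = 0) RS n d₀ d) :
    Nonempty (Frame q B n (d₀ + d)) := by
  obtain ⟨W, W₀, R, hInternal, horth, hhyp, -, hd₀, -, hd⟩ := hdec
  choose E G hW hE hG hEG using hhyp
  have hEW : ∀ i, E i ∈ W i := fun i => by
    rw [hW i]; exact Submodule.subset_span (by simp)
  have hGW : ∀ i, G i ∈ W i := fun i => by
    rw [hW i]; exact Submodule.subset_span (by simp)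
  have hWW : ∀ i j : Fin n, i ≠ j → ∀ x ∈ W i, ∀ y ∈ W j, B x y = 0 := fun i j hij x hx y hy =>
    horth (Sum.inl i) (Sum.inl j) (by simpa using hij) x hx y hy
  have hW0 : ∀ i : Fin n, ∀ x ∈ W i, ∀ y ∈ W₀, B x y = 0 := fun i x hx y hy =>
    horth (Sum.inl i) (Sum.inr 0) (by simp) x hx y (by simpa using hy)
  have hWR : ∀ i : Fin n, ∀ x ∈ W i, ∀ y ∈ R, B x y = 0 := fun i x hx y hy =>
    horth (Sum.inl i) (Sum.inr 1) (by simp) x hx y (by simpa using hy)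
  have hWC : ∀ i : Fin n, ∀ x ∈ W i, ∀ y ∈ W₀ ⊔ R, B x y = 0 := by
    intro i x hx y hy
    obtain ⟨a, ha, b, hb, rfl⟩ := Submodule.mem_sup.1 hy
    rw [map_add, hW0 i x hx a ha, hWR i x hx b hb, add_zero]
  have bEG : ∀ i j, B (E i) (G j) = if i = j then 1 else 0 := by
    intro i j
    split_ifs with h
    · subst h; exact hEG i
    · exact hWW i j h _ (hEW i) _ (hGW j)
  have bGE : ∀ i j, B (G i) (E j) = if i = j then 1 else 0 := by
    intro i j
    rw [hs, bEG]; simp [eq_comm]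
  have bEE : ∀ i j, B (E i) (E j) = 0 := by
    intro i j
    by_cases h : i = j
    · subst h; exact hB _
    · exact hWW i j h _ (hEW i) _ (hEW j)
  have bGG : ∀ i j, B (G i) (G j) = 0 := by
    intro i j
    by_cases h : i = j
    · subst h; exact hB _
    · exact hWW i j h _ (hGW i) _ (hGW j)
  let p : V →ₗ[F] V := LinearMap.id - ∑ i, (B (G i)).smulRight (E i)
    - ∑ i, (B (E i)).smulRight (G i)
  have hp : ∀ v, p v = v - ∑ i, B (G i) v • E i - ∑ i, B (E i) v • G i := by
    intro v; simp [p, LinearMap.sum_apply]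
  have pE : ∀ i, p (E i) = 0 := by
    intro i; rw [hp]; simp [bGE, bEE]
  have pG : ∀ i, p (G i) = 0 := by
    intro i; rw [hp]; simp [bGG, bEG]
  have pC : ∀ x ∈ W₀ ⊔ R, p x = x := by
    intro x hx
    rw [hp, Finset.sum_eq_zero, Finset.sum_eq_zero, sub_zero, sub_zero]
    · intro i _; rw [hWC i _ (hEW i) x hx, zero_smul]
    · intro i _; rw [hWC i _ (hGW i) x hx, zero_smul]
  have pm : ∀ v, p v ∈ W₀ ⊔ R := by
    have key : (⊤ : Submodule F V) ≤ (W₀ ⊔ R).comap p := by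
      rw [← hInternal.submodule_iSup_eq_top]
      refine iSup_le fun j => ?_
      rcases j with i | j
      · simp only [Sum.elim_inl]
        rw [hW i, Submodule.span_le]
        rintro x (rfl | rfl)
        · simp [pE]
        · simp [pG]
      · fin_cases j
        · intro x hx
          have hx' : x ∈ W₀ := by simpa using hx
          have := Submodule.mem_sup_left (T := R) hx'
          rw [Submodule.mem_comap, pC x this]; exact this
        · intro x hx
          have hx' : x ∈ R := by simpa using hx
          have := Submodule.mem_sup_right (S := W₀) hx'
          rw [Submodule.mem_comap, pC x this]; exact this
    exact fun v => key (Submodule.mem_top)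
  have hfin : Module.finrank F ↥(W₀ ⊔ R) = d₀ + d := by
    have hdis : Disjoint W₀ R := by
      have := hInternal.submodule_iSupIndep.pairwiseDisjoint
        (show (Sum.inr 0 : Fin n ⊕ Fin 2) ≠ Sum.inr 1 by simp)
      simpa [Function.onFun] using this
    have h := Submodule.finrank_sup_add_finrank_inf_eq W₀ R
    rw [hdis.eq_bot, finrank_bot, hd₀, hd] at h
    simpa using h
  let b := Module.finBasisOfFinrankEq F ↥(W₀ ⊔ R) hfin
  let P : V →ₗ[F] ↥(W₀ ⊔ R) := p.codRestrict (W₀ ⊔ R) pm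
  have PC : ∀ x : ↥(W₀ ⊔ R), P x = x := fun x => Subtype.ext (pC x x.2)
  refine ⟨{
    e := fun i => if h : i < n then E ⟨i, h⟩ else 0
    f := fun i => if h : i < n then G ⟨i, h⟩ else 0
    w := fun l => if h : l < d₀ + d then (b ⟨l, h⟩ : V) else 0
    g := fun l => if h : l < d₀ + d then (b.coord ⟨l, h⟩) ∘ₗ P else 0
    qe := ?_, qf := ?_, ef := ?_, fe := ?_, ee := ?_, ff := ?_, ew := ?_, fw := ?_
    gw := ?_, ge := ?_, gf := ?_, sep := ?_ }⟩
  · intro i hi; simp only [hi, dif_pos]; exact hE _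
  · intro i hi; simp only [hi, dif_pos]; exact hG _
  · intro i hi j hj; simp only [hi, hj, dif_pos]; rw [bEG]; simp
  · intro i hi j hj; simp only [hi, hj, dif_pos]; rw [bGE]; simp
  · intro i hi j hj; simp only [hi, hj, dif_pos]; exact bEE _ _
  · intro i hi j hj; simp only [hi, hj, dif_pos]; exact bGG _ _
  · intro i hi l hl; simp only [hi, hl, dif_pos]; exact hWC _ _ (hEW _) _ (b _).2
  · intro i hi l hl; simp only [hi, hl, dif_pos]; exact hWC _ _ (hGW _) _ (b _).2
  · intro l hl l' hl'
    simp only [hl, hl', dif_pos, LinearMap.comp_apply, PC, Module.Basis.coord_apply,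
      Module.Basis.repr_self, Finsupp.single_apply, Fin.mk.injEq]
    simp only [eq_comm]
  · intro l hl i hi
    simp only [hl, hi, dif_pos, LinearMap.comp_apply]
    rw [show P (E ⟨i, hi⟩) = 0 from Subtype.ext (pE _), map_zero]
  · intro l hl i hi
    simp only [hl, hi, dif_pos, LinearMap.comp_apply]
    rw [show P (G ⟨i, hi⟩) = 0 from Subtype.ext (pG _), map_zero]
  · intro v h1 h2 h3
    have hpv : p v = v := by
      rw [hp, Finset.sum_eq_zero, Finset.sum_eq_zero, sub_zero, sub_zero]
      · intro i _
        have := h1 i i.2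
        simp only [i.2, dif_pos] at this
        rw [this, zero_smul]
      · intro i _
        have := h2 i i.2
        simp only [i.2, dif_pos] at this
        rw [this, zero_smul]
    have hP : P v = 0 := by
      apply b.ext_elem
      intro i
      have := h3 i i.2
      simp only [i.2, dif_pos, LinearMap.comp_apply, Module.Basis.coord_apply] at this
      simpa using this
    rw [← hpv]
    exact congrArg Subtype.val hP

variable {B : LinearMap.BilinForm F V} {q : QuadraticForm F V} {n c : ℕ}

lemma TC_le_grassmann (hq : ∀ x y, q (x + y) = q x + q y + B x y) (fr : Frame q B n c) (k : ℕ) :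
    TC fr c k ≤ grassmann F V (TotSingQ F V q) k := by
  refine Submodule.span_le.2 ?_
  rintro _ ⟨H, L, hL, rfl, rfl⟩
  have hw : wedge L = ExteriorAlgebra.ιMulti F L.length L.get := by
    rw [ιMulti_eq_wedge, List.ofFn_get]
  rw [hw]
  by_cases hli : LinearIndependent F L.get
  · refine Submodule.subset_span ⟨L.get, fun _ => trivial, hli, ?_, rfl⟩
    have hr : ∀ x ∈ Set.range L.get, x ∈ L := by
      rintro _ ⟨i, rfl⟩; exact List.get_mem _ _
    have hb : ∀ x ∈ Submodule.span F (Set.range L.get),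
        ∀ y ∈ Submodule.span F (Set.range L.get), B x y = 0 := by
      intro x hx y hy
      induction hx, hy using Submodule.span_induction₂ with
      | mem_mem x y hx hy => exact hL.iso x (hr x hx) y (hr y hy)
      | zero_left y hy => simp
      | zero_right x hx => simp
      | add_left x y z hx hy hz h1 h2 => simp [h1, h2]
      | add_right x y z hx hy hz h1 h2 => simp [h1, h2]
      | smul_left r x y hx hy h => simp [h]
      | smul_right r x y hx hy h => simp [h]
    intro x hx
    induction hx using Submodule.span_induction with
    | mem x hx => exact hL.sing x (hr x hx)
    | zero => simp
    | add x y hx hy h1 h2 => rw [hq, h1, h2, hb x hx y hy]; simp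
    | smul a x hx h => rw [QuadraticMap.map_smul, h, smul_zero]
  · rw [AlternatingMap.map_linearDependent _ _ hli]
    exact Submodule.zero_mem _

lemma grassmann_mono (k : ℕ) {P Q : Submodule F V → Prop} (h : ∀ W, P W → Q W) :
    grassmann F V P k ≤ grassmann F V Q k := by
  refine Submodule.span_mono ?_
  rintro x ⟨v, h1, h2, h3, rfl⟩
  exact ⟨v, h1, h2, h _ h3, rfl⟩

lemma grassmann_le_XX (hB : ∀ v, B v v = 0) (fr : Frame q B n c) (k : ℕ) :
    grassmann F V (TotSingB F V (fun x y => B x y)) k ≤ XX B hB (LamC fr c) k := by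
  refine Submodule.span_le.2 ?_
  rintro _ ⟨v, -, -, h3, rfl⟩
  have hm : ∀ x ∈ List.ofFn v, x ∈ Submodule.span F (Set.range v) := by
    intro x hx
    rw [List.mem_ofFn] at hx
    exact Submodule.subset_span hx
  refine ⟨?_, ?_, ?_⟩
  · have := wedge_mem_pow (F := F) (List.ofFn v)
    rw [ιMulti_eq_wedge]
    simpa using this
  · rw [ιMulti_eq_wedge]
    exact Eop_wedge B hB _ fun x hx y hy => h3 x (hm x hx) y (hm y hy)
  · rintro d ⟨l, h1, h2, -⟩
    omega

end final

end PolarGrass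

open PolarGrass Module in
/-- `char F = 2`, a possibly degenerate quadratic form of reduced Witt index
`n ≥ 2`, anisotropic defect `d₀` and singular defect `d` (`N = 2n + d₀ + d`); for
`1 ≤ k ≤ n` the Grassmann image coincides with the symplectic Grassmann image of the
bilinearization and has dimension `N.choose k - N.choose (k-2)`. -/
theorem stmt3 (F : Type*) [Field F] (V : Type*) [AddCommGroup V] [Module F V]
    [FiniteDimensional F V]
    (hchar : ringChar F = 2)
    (q : QuadraticForm F V)
    (n d₀ d N : ℕ) (hn : 2 ≤ n)
    (hdec : HasWittDecomp F V (polarF F V q) (fun v => q v = 0) (radSetQ F V q) n d₀ d)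
    (hNV : Module.finrank F V = N) (hN : N = 2 * n + d₀ + d) :
    ∀ k : ℕ, 1 ≤ k → k ≤ n →
      grassmann F V (TotSingQ F V q) k = grassmann F V (TotSingB F V (polarF F V q)) k ∧
      Module.finrank F ↥(grassmann F V (TotSingQ F V q) k)
        = N.choose k - (if 2 ≤ k then N.choose (k - 2) else 0) := by
  intro k hk1 hk
  haveI : CharP F 2 := by rw [← hchar]; exact ringChar.charP F
  have h2 : ∀ a : F, a + a = 0 := CharTwo.add_self_eq_zero
  let B : LinearMap.BilinForm F V := q.polarBilin
  have hBp : ∀ x y, B x y = polarF F V q x y := fun x y => rfl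
  have hs : ∀ x y, B x y = B y x := fun x y => QuadraticMap.polar_comm q x y
  have hq : ∀ x y, q (x + y) = q x + q y + B x y := fun x y => by
    rw [hBp, polarF, QuadraticMap.polar]; ring
  have hB : ∀ v, B v v = 0 := fun v => by
    have h : B v v = 2 • q v := QuadraticMap.polar_self q v
    rw [h, two_nsmul, h2]
  obtain ⟨fr⟩ := exists_frame q B hs hB n d₀ d _ hdec
  have i1 := TC_le_grassmann hq fr k
  have i2 : grassmann F V (TotSingQ F V q) k ≤ grassmann F V (TotSingB F V (polarF F V q)) k := by
    refine grassmann_mono k fun W hW x hx y hy => ?_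
    rw [polarF, QuadraticMap.polar, hW x hx, hW y hy, hW _ (W.add_mem hx hy)]; simp
  have i3 : grassmann F V (TotSingB F V (polarF F V q)) k ≤ XX B hB (LamC fr (d₀ + d)) k :=
    grassmann_le_XX hB fr k
  have lo := lowerC hs hB hq h2 fr (d₀ + d) le_rfl k hk
  have up := upperC (hB := hB) fr (d₀ + d) le_rfl k hk
  have j1 := Submodule.finrank_mono i1
  have j2 := Submodule.finrank_mono i2
  have j3 := Submodule.finrank_mono i3
  refine ⟨Submodule.eq_of_le_of_finrank_le i2 (by omega), ?_⟩
  have hNe : 2 * n + (d₀ + d) = N := by omega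
  rw [hNe] at lo up
  have hfin : (finrank F ↥(grassmann F V (TotSingQ F V q) k) : ℤ) = sd N k := by omega
  match k, hk1, hfin with
  | 1, _, hfin =>
    simp only [sd] at hfin
    simp
    exact_mod_cast hfin
  | (m + 2), _, hfin =>
    simp only [sd] at hfin
    simp only [show 2 ≤ m + 2 by omega, if_true, Nat.add_sub_cancel]
    omega
end
end

section
/- Let η have reduced Witt index n ≥ 2 and singular defect d, with fixed decomposition V = V̄ ⊕ R where R = Rad(η) has dimension d and V̄ := V₁ ⊕ ⋯ ⊕ Vₙ ⊕ V₀ has dimension N − d. For 1 ≤ j ≤ n let Ḡ_j denote the subspace of ⋀^j V̄ spanned by all pure wedges of bases of totally singular j-dimensional subspaces of V̄. If dim Ḡ_h = binom(N−d, h) for every h = 1, 2, …, n, then dim G_k(η) = binom(N, k) for every 1 ≤ k ≤ n. -/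
noncomputable section

open ExteriorAlgebra in
theorem PolarGrass.pow_le_extPowOf (F : Type*) [Field F] (V : Type*) [AddCommGroup V] [Module F V]
    (U : Submodule F V) (m : ℕ) :
    (U.map (ExteriorAlgebra.ι F)) ^ m ≤ PolarGrass.extPowOf F V U m := by
  induction m with
  | zero =>
    rw [pow_zero, Submodule.one_eq_span]
    apply Submodule.span_mono
    rintro x rfl
    exact ⟨Fin.elim0, fun t => t.elim0, by simp⟩
  | succ m ih =>
    rw [pow_succ']
    refine (mul_le_mul_right ih _).trans ?_
    rw [Submodule.mul_le]
    rintro _ ⟨u, hu, rfl⟩ y hy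
    unfold PolarGrass.extPowOf at hy
    induction hy using Submodule.span_induction with
    | mem x hx =>
      obtain ⟨v, hv, rfl⟩ := hx
      refine Submodule.subset_span ⟨Fin.cons u v, ?_, ?_⟩
      · intro t
        refine Fin.cases ?_ ?_ t
        · simpa using hu
        · intro i; simpa using hv i
      · rw [ιMulti_succ_apply]
        congr 1
    | zero => simp
    | add x y _ _ hx hy => rw [mul_add]; exact add_mem hx hy
    | smul a x _ hx => rw [mul_smul_comm]; exact Submodule.smul_mem _ _ hx

theorem PolarGrass.extPowOf_le_map (F : Type*) [Field F] (V : Type*) [AddCommGroup V] [Module F V]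
    (U : Submodule F V) (m : ℕ) :
    PolarGrass.extPowOf F V U m ≤
      (⋀[F]^m U).map (ExteriorAlgebra.map U.subtype).toLinearMap := by
  unfold PolarGrass.extPowOf
  rw [Submodule.span_le]
  rintro _ ⟨v, hv, rfl⟩
  refine ⟨ExteriorAlgebra.ιMulti F m (fun t => (⟨v t, hv t⟩ : U)),
    ExteriorAlgebra.ιMulti_range F m ⟨_, rfl⟩, ?_⟩
  simp [ExteriorAlgebra.map_apply_ιMulti]
  rfl

theorem PolarGrass.grassmannIn_eq (F : Type*) [Field F] (V : Type*) [AddCommGroup V] [Module F V]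
    [FiniteDimensional F V] (P : Submodule F V → Prop)
    (U : Submodule F V) (m : ℕ)
    (h : Module.finrank F (PolarGrass.grassmannIn F V P U m) = (Module.finrank F U).choose m) :
    PolarGrass.extPowOf F V U m ≤ PolarGrass.grassmannIn F V P U m := by
  have h1 : PolarGrass.grassmannIn F V P U m ≤ PolarGrass.extPowOf F V U m := by
    apply Submodule.span_mono
    rintro x ⟨v, hv, -, -, rfl⟩
    exact ⟨v, hv, rfl⟩
  have h2 := h1.trans (PolarGrass.extPowOf_le_map F V U m)
  have h3 := Submodule.eq_of_le_of_finrank_le h2 (by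
    rw [h, ← exteriorPower.finrank_eq]
    exact Submodule.finrank_map_le _ _)
  rw [h3]
  exact PolarGrass.extPowOf_le_map F V U m

theorem PolarGrass.commute_map (F : Type*) [Field F] (V : Type*) [AddCommGroup V] [Module F V]
    (U R : Submodule F V) :
    Commute (U.map (ExteriorAlgebra.ι F)) (R.map (ExteriorAlgebra.ι F)) := by
  have key : ∀ A B : Submodule F V, A.map (ExteriorAlgebra.ι F) * B.map (ExteriorAlgebra.ι F) ≤
      B.map (ExteriorAlgebra.ι F) * A.map (ExteriorAlgebra.ι F) := by
    intro A B
    rw [Submodule.mul_le]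
    rintro _ ⟨a, ha, rfl⟩ _ ⟨b, hb, rfl⟩
    rw [eq_neg_of_add_eq_zero_left (ExteriorAlgebra.ι_add_mul_swap (R := F) a b)]
    exact neg_mem (Submodule.mul_mem_mul ⟨b, hb, rfl⟩ ⟨a, ha, rfl⟩)
  exact le_antisymm (key U R) (key R U)

theorem PolarGrass.core (F : Type*) [Field F] (V : Type*) [AddCommGroup V] [Module F V]
    [FiniteDimensional F V] (P : Submodule F V → Prop) (U R : Submodule F V) (k : ℕ)
    (hUR : IsCompl U R) (hbot : P ⊥)
    (hP : ∀ X Y : Submodule F V, P X → Y ≤ X ⊔ R → P Y)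
    (h : ∀ m, 1 ≤ m → m ≤ k →
      Module.finrank F (PolarGrass.grassmannIn F V P U m) = (Module.finrank F U).choose m) :
    Module.finrank F (PolarGrass.grassmann F V P k) = (Module.finrank F V).choose k := by
  have hext : ∀ m, m ≤ k → PolarGrass.extPowOf F V U m ≤ PolarGrass.grassmannIn F V P U m := by
    intro m hm
    rcases Nat.eq_zero_or_pos m with rfl | hm0
    · apply Submodule.span_mono
      rintro x ⟨v, hv, rfl⟩
      refine ⟨v, hv, linearIndependent_empty_type, ?_, rfl⟩
      simpa [Set.range_eq_empty] using hbot
    · exact PolarGrass.grassmannIn_eq F V P U m (h m hm0 hm)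
  have hprod : ∀ m j, PolarGrass.grassmannIn F V P U m * PolarGrass.extPowOf F V R j ≤
      PolarGrass.grassmann F V P (m + j) := by
    intro m j
    unfold PolarGrass.grassmannIn PolarGrass.extPowOf
    rw [Submodule.span_mul_span, Submodule.span_le]
    rintro _ ⟨_, ⟨u, hu, -, hPu, rfl⟩, _, ⟨r, hr, rfl⟩, rfl⟩
    simp only [SetLike.mem_coe, ExteriorAlgebra.ιMulti_mul_ιMulti]
    by_cases hli : LinearIndependent F (Fin.append u r)
    · refine Submodule.subset_span ⟨_, fun _ => trivial, hli, hP _ _ hPu ?_, rfl⟩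
      rw [Submodule.span_le]
      rintro _ ⟨t, rfl⟩
      refine Fin.addCases ?_ ?_ t
      · intro i
        rw [Fin.append_left]
        exact Submodule.mem_sup_left (Submodule.subset_span ⟨i, rfl⟩)
      · intro i
        rw [Fin.append_right]
        exact Submodule.mem_sup_right (hr i)
    · rw [AlternatingMap.map_linearDependent _ _ hli]
      exact zero_mem _
  have hle : ⋀[F]^k V ≤ PolarGrass.grassmann F V P k := by
    have hr : LinearMap.range (ExteriorAlgebra.ι F : V →ₗ[F] _) =
        U.map (ExteriorAlgebra.ι F) + R.map (ExteriorAlgebra.ι F) := by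
      rw [Submodule.add_eq_sup, ← Submodule.map_sup, hUR.sup_eq_top, Submodule.map_top]
    have hpow : ⋀[F]^k V = (LinearMap.range (ExteriorAlgebra.ι F : V →ₗ[F] _)) ^ k := rfl
    rw [hpow, hr, (PolarGrass.commute_map F V U R).add_pow']
    apply Finset.sum_induction _ (fun X => X ≤ PolarGrass.grassmann F V P k)
    · intro a b ha hb
      exact sup_le ha hb
    · exact bot_le
    · rintro ⟨m, j⟩ hmj
      rw [Finset.HasAntidiagonal.mem_antidiagonal] at hmj
      have hns : ∀ (c : ℕ) (X Y : Submodule F (ExteriorAlgebra F V)), X ≤ Y → c • X ≤ Y := by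
        intro c X Y hX
        induction c with
        | zero => rw [zero_smul]; exact bot_le
        | succ c ih => rw [succ_nsmul]; exact sup_le ih hX
      apply hns
      dsimp at hmj ⊢
      subst hmj
      refine le_trans (mul_le_mul' ?_ ?_) (hprod m j)
      · exact (PolarGrass.pow_le_extPowOf F V U m).trans (hext m (by omega))
      · exact PolarGrass.pow_le_extPowOf F V R j
  have hge : PolarGrass.grassmann F V P k ≤ ⋀[F]^k V := by
    unfold PolarGrass.grassmann PolarGrass.grassmannIn
    rw [Submodule.span_le]
    rintro _ ⟨v, -, -, -, rfl⟩
    exact ExteriorAlgebra.ιMulti_range F k ⟨v, rfl⟩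
  rw [le_antisymm hge hle, exteriorPower.finrank_eq]

open PolarGrass Module in
/-- with a fixed Witt decomposition `V = V̄ ⊕ R` (`dim V̄ = N - d`), if
`dim Ḡ_h = (N-d).choose h` for every `1 ≤ h ≤ n`, then `dim G_k(η) = N.choose k` for
every `1 ≤ k ≤ n`. -/
theorem stmt9 (F : Type*) [Field F] (V : Type*) [AddCommGroup V] [Module F V]
    [FiniteDimensional F V]
    (Orth : V → V → F) (sv : V → Prop) (Sing : Submodule F V → Prop) (RadSet : Set V)
    (hcase :
      (∃ (σ : F ≃+* F) (h : V → V → F), (∀ a, σ (σ a) = a) ∧ IsHermitianForm F V σ h ∧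
        Orth = h ∧ sv = (fun v => h v v = 0) ∧ Sing = TotSingB F V h ∧
        RadSet = radSetB F V h) ∨
      (∃ s : V → V → F, IsAlternatingForm F V s ∧ Orth = s ∧
        sv = (fun v => s v v = 0) ∧ Sing = TotSingB F V s ∧ RadSet = radSetB F V s) ∨
      (∃ q : QuadraticForm F V, Orth = polarF F V q ∧ sv = (fun v => q v = 0) ∧
        Sing = TotSingQ F V q ∧ RadSet = radSetQ F V q))
    (n d₀ d N : ℕ) (hn : 2 ≤ n)
    (W : Fin n → Submodule F V) (W₀ R : Submodule F V)
    (hdec : IsWittDecomp F V Orth sv RadSet n d₀ d W W₀ R)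
    (hNV : Module.finrank F V = N) (hN : N = 2 * n + d₀ + d)
    (hGbar : ∀ h : ℕ, 1 ≤ h → h ≤ n →
      Module.finrank F ↥(grassmannIn F V Sing ((⨆ j, W j) ⊔ W₀) h) = (N - d).choose h) :
    ∀ k : ℕ, 1 ≤ k → k ≤ n →
      Module.finrank F ↥(grassmann F V Sing k) = N.choose k := by
  obtain ⟨hDS, -, -, -, -, hR, hRd⟩ := hdec
  have hUR : IsCompl ((⨆ j, W j) ⊔ W₀) R := by
    constructor
    · have h1 := hDS.submodule_iSupIndep (Sum.inr 1)
      refine (h1.mono_right ?_).symm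
      refine sup_le (iSup_le fun j => ?_) ?_
      · exact le_iSup₂_of_le (Sum.inl j) (by simp) (by simp)
      · exact le_iSup₂_of_le (Sum.inr 0) (by simp) (by simp)
    · rw [codisjoint_iff, eq_top_iff, ← hDS.submodule_iSup_eq_top]
      refine iSup_le ?_
      rintro (j | j)
      · exact le_sup_of_le_left (le_sup_of_le_left (le_iSup W j))
      · fin_cases j
        · exact le_sup_of_le_left le_sup_right
        · exact le_sup_right
  have hdim := Submodule.finrank_add_eq_of_isCompl hUR
  have hU : Module.finrank F ↥((⨆ j, W j) ⊔ W₀) = N - d := by omega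
  have hbot : Sing ⊥ := by
    rcases hcase with ⟨σ, h, -, ⟨h1, h2, h3, h4⟩, -, -, rfl, -⟩ | ⟨s, ⟨h1, h2, -⟩, -, -, rfl, -⟩ |
      ⟨q, -, -, rfl, -⟩
    · rintro x hx y hy
      rw [Submodule.mem_bot] at hx hy
      subst hx hy
      simpa using h1 0 0 0
    · rintro x hx y hy
      rw [Submodule.mem_bot] at hx hy
      subst hx hy
      simpa using h1 0 0 0
    · rintro x hx
      rw [Submodule.mem_bot] at hx
      subst hx
      simp
  have hP : ∀ X Y : Submodule F V, Sing X → Y ≤ X ⊔ R → Sing Y := by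
    intro X Y hX hY
    rcases hcase with ⟨σ, h, -, ⟨h1, h2, h3, h4⟩, -, -, rfl, rfl⟩ |
      ⟨s, ⟨h1, h2, h3, h4, h5⟩, -, -, rfl, rfl⟩ | ⟨q, -, -, rfl, rfl⟩
    · rintro x hx y hy
      obtain ⟨a, ha, r, hr, rfl⟩ := Submodule.mem_sup.1 (hY hx)
      obtain ⟨b, hb, t, ht, rfl⟩ := Submodule.mem_sup.1 (hY hy)
      have hr' : r ∈ radSetB F V h := hR ▸ hr
      have ht' : t ∈ radSetB F V h := hR ▸ ht
      rw [h1, h2, hX a ha b hb, hr' _, h4 t a, ht' a]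
      simp
    · rintro x hx y hy
      obtain ⟨a, ha, r, hr, rfl⟩ := Submodule.mem_sup.1 (hY hx)
      obtain ⟨b, hb, t, ht, rfl⟩ := Submodule.mem_sup.1 (hY hy)
      have hr' : r ∈ radSetB F V s := hR ▸ hr
      have ht' : t ∈ radSetB F V s := hR ▸ ht
      have hsw := h5 (a + t)
      rw [h1, h2, h2, h5, h5, ht' a] at hsw
      rw [h1, h2, hX a ha b hb, hr' _]
      simpa using hsw
    · rintro x hx
      obtain ⟨a, ha, r, hr, rfl⟩ := Submodule.mem_sup.1 (hY hx)
      have hr' : r ∈ radSetQ F V q := hR ▸ hr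
      have h2 := hr'.2 a
      unfold polarF QuadraticMap.polar at h2
      rw [hr'.1, hX a ha, add_comm r a] at h2
      simpa using h2
  intro k hk hkn
  rw [← hNV]
  refine PolarGrass.core F V Sing _ R k hUR hbot hP ?_
  intro m hm hmk
  rw [hU]
  exact hGbar m hm (hmk.trans hkn)
end
end

section
/- Let η have reduced Witt index n ≥ 2 and singular defect d, with fixed decomposition V = V̄ ⊕ R where R = Rad(η) has dimension d and V̄ := V₁ ⊕ ⋯ ⊕ Vₙ ⊕ V₀ has dimension N − d. For 1 ≤ j ≤ n let Ḡ_j denote the subspace of ⋀^j V̄ spanned by all pure wedges of bases of totally singular j-dimensional subspaces of V̄. If dim Ḡ_h = binom(N−d, h) − binom(N−d, h−2) for every h = 1, 2, …, n (with binom(m, −1) := 0), then dim G_k(η) = binom(N, k) − binom(N, k−2) for every 1 ≤ k ≤ n. -/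
noncomputable section

namespace PolarGrassAux

open PolarGrass Module

/-- Expansion of a wedge of vectors `u t + c t • r`. -/
theorem wedge_expand {F : Type*} [Field F] {V : Type*} [AddCommGroup V] [Module F V] (r : V) :
    ∀ (n : ℕ) (u : Fin n → V) (c : Fin n → F),
      ∃ z ∈ Submodule.span F {x | ∃ (m : ℕ) (f : Fin m → Fin n), m + 1 = n ∧
        x = ExteriorAlgebra.ιMulti F m (u ∘ f)},
      ExteriorAlgebra.ιMulti F n (fun t => u t + c t • r)
        = ExteriorAlgebra.ιMulti F n u + ExteriorAlgebra.ι F r * z := by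
  intro n
  induction n with
  | zero =>
    intro u c
    exact ⟨0, Submodule.zero_mem _, by simp⟩
  | succ n ih =>
    intro u c
    obtain ⟨z, hz, hzeq⟩ := ih (Matrix.vecTail u) (Matrix.vecTail c)
    refine ⟨c 0 • ExteriorAlgebra.ιMulti F n (Matrix.vecTail u)
      - ExteriorAlgebra.ι F (u 0) * z, ?_, ?_⟩
    · refine Submodule.sub_mem _ (Submodule.smul_mem _ _ (Submodule.subset_span
        ⟨n, Fin.succ, rfl, rfl⟩)) ?_
      clear hzeq
      induction hz using Submodule.span_induction with
      | mem x hx =>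
        obtain ⟨m, f, hm, rfl⟩ := hx
        refine Submodule.subset_span ⟨m + 1, Fin.cons 0 (Fin.succ ∘ f), by omega, ?_⟩
        rw [ExteriorAlgebra.ιMulti_succ_apply]
        rfl
      | zero => simp
      | add x y _ _ hx hy => rw [mul_add]; exact Submodule.add_mem _ hx hy
      | smul a x _ hx => rw [mul_smul_comm]; exact Submodule.smul_mem _ _ hx
    · rw [ExteriorAlgebra.ιMulti_succ_apply, ExteriorAlgebra.ιMulti_succ_apply]
      have h1 : Matrix.vecTail (fun t => u t + c t • r)
          = fun t => Matrix.vecTail u t + Matrix.vecTail c t • r := rfl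
      rw [h1, hzeq]
      have h2 := ExteriorAlgebra.ι_add_mul_swap (R := F) (u 0) r
      have h2' : ExteriorAlgebra.ι F (u 0) * ExteriorAlgebra.ι F r
          = - (ExteriorAlgebra.ι F r * ExteriorAlgebra.ι F (u 0)) := eq_neg_of_add_eq_zero_left h2
      have h3 := ExteriorAlgebra.ι_sq_zero (R := F) r
      simp only [map_add, map_smul, add_mul, mul_add, mul_sub, smul_mul_assoc, mul_smul_comm]
      rw [← mul_assoc, ← mul_assoc, ← mul_assoc, h2', h3]
      simp only [neg_mul, zero_mul, smul_zero]
      abel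

/-- Contraction with a functional vanishing on `U` kills wedges of vectors of `U`. -/
theorem contract_wedge {F : Type*} [Field F] {V : Type*} [AddCommGroup V] [Module F V]
    (φ : Module.Dual F V) :
    ∀ (n : ℕ) (u : Fin n → V), (∀ t, φ (u t) = 0) →
      CliffordAlgebra.contractLeft (Q := (0 : QuadraticForm F V)) φ
        (ExteriorAlgebra.ιMulti F n u) = 0 := by
  intro n
  induction n with
  | zero =>
    intro u _
    rw [ExteriorAlgebra.ιMulti_zero_apply]
    exact CliffordAlgebra.contractLeft_one _ _
  | succ n ih =>
    intro u hu
    rw [ExteriorAlgebra.ιMulti_succ_apply]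
    refine (CliffordAlgebra.contractLeft_ι_mul _ _ _).trans ?_
    rw [hu 0, ih (Matrix.vecTail u) (fun t => hu t.succ)]
    simp

theorem contract_grass {F : Type*} [Field F] {V : Type*} [AddCommGroup V] [Module F V]
    (φ : Module.Dual F V) (P : Submodule F V → Prop) (U : Submodule F V)
    (hU : U ≤ LinearMap.ker φ) (k : ℕ) (x : ExteriorAlgebra F V)
    (hx : x ∈ grassmannIn F V P U k) :
    CliffordAlgebra.contractLeft (Q := (0 : QuadraticForm F V)) φ x = 0 := by
  have : grassmannIn F V P U k ≤ LinearMap.ker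
      (CliffordAlgebra.contractLeft (Q := (0 : QuadraticForm F V)) φ) := by
    refine Submodule.span_le.2 ?_
    rintro _ ⟨v, hv, -, -, rfl⟩
    exact contract_wedge φ k v (fun t => hU (hv t))
  exact this hx

theorem grass_fin {F : Type*} [Field F] {V : Type*} [AddCommGroup V] [Module F V]
    [FiniteDimensional F V] (P : Submodule F V → Prop) (U : Submodule F V) (k : ℕ) :
    FiniteDimensional F ↥(grassmannIn F V P U k) := by
  have h : grassmannIn F V P U k ≤ ⋀[F]^k V := by
    refine Submodule.span_le.2 ?_
    rintro _ ⟨v, hv, -, -, rfl⟩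
    exact ExteriorAlgebra.ιMulti_range F k ⟨v, rfl⟩
  exact Submodule.finiteDimensional_of_le h

theorem mul_contract {F : Type*} [Field F] {V : Type*} [AddCommGroup V] [Module F V]
    (φ : Module.Dual F V) (r : V) (y : ExteriorAlgebra F V)
    (hy : CliffordAlgebra.contractLeft (Q := (0 : QuadraticForm F V)) φ y = 0) :
    CliffordAlgebra.contractLeft (Q := (0 : QuadraticForm F V)) φ (ExteriorAlgebra.ι F r * y)
      = φ r • y := by
  refine (CliffordAlgebra.contractLeft_ι_mul _ _ _).trans ?_
  rw [hy]
  simp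

theorem grass_step_eq {F : Type*} [Field F] {V : Type*} [AddCommGroup V] [Module F V]
    (P : Submodule F V → Prop) (U R : Submodule F V)
    (hmono : ∀ S T : Submodule F V, S ≤ T → P T → P S)
    (hadd : ∀ S, P S → P (S ⊔ R)) (r : V) (hr : r ∈ R) (hrU : r ∉ U) (k : ℕ) :
    grassmannIn F V P (U ⊔ Submodule.span F {r}) (k + 1)
      = grassmannIn F V P U (k + 1) ⊔
        (grassmannIn F V P U k).map (LinearMap.mulLeft F (ExteriorAlgebra.ι F r)) := by
  apply le_antisymm
  · refine Submodule.span_le.2 ?_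
    rintro _ ⟨v, hv, -, hPv, rfl⟩
    have hdec : ∀ t, ∃ u ∈ U, ∃ c : F, u + c • r = v t := by
      intro t
      obtain ⟨u, hu, y, hy, he⟩ := Submodule.mem_sup.1 (hv t)
      obtain ⟨c, rfl⟩ := Submodule.mem_span_singleton.1 hy
      exact ⟨u, hu, c, he⟩
    choose u hu c hc using hdec
    have hv' : v = fun t => u t + c t • r := funext fun t => (hc t).symm
    have key : ∀ (m : ℕ) (f : Fin m → Fin (k + 1)),
        ExteriorAlgebra.ιMulti F m (u ∘ f) ∈ grassmannIn F V P U m := by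
      intro m f
      by_cases hli : LinearIndependent F (u ∘ f)
      · refine Submodule.subset_span ⟨u ∘ f, fun t => hu _, hli, ?_, rfl⟩
        refine hmono _ _ ?_ (hadd _ hPv)
        rw [Submodule.span_le]
        rintro _ ⟨t, rfl⟩
        have : (u ∘ f) t = v (f t) + (-(c (f t))) • r := by
          rw [← hc (f t)]; simp
        rw [this]
        exact Submodule.add_mem_sup (Submodule.subset_span ⟨_, rfl⟩) (R.smul_mem _ hr)
      · rw [AlternatingMap.map_linearDependent _ _ hli]
        exact Submodule.zero_mem _
    obtain ⟨z, hz, he⟩ := wedge_expand r (k + 1) u c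
    rw [hv', he]
    refine Submodule.add_mem_sup (key (k + 1) id) ⟨z, ?_, rfl⟩
    refine (Submodule.span_le.2 ?_ : _ ≤ grassmannIn F V P U k) hz
    rintro _ ⟨m, f, hm, rfl⟩
    obtain rfl : m = k := by omega
    exact key m f
  · refine sup_le ?_ ?_
    · refine Submodule.span_mono ?_
      rintro _ ⟨v, hv, h1, h2, rfl⟩
      exact ⟨v, fun t => Submodule.mem_sup_left (hv t), h1, h2, rfl⟩
    · rw [grassmannIn, Submodule.map_span, Submodule.span_le]
      rintro _ ⟨_, ⟨v, hv, h1, h2, rfl⟩, rfl⟩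
      refine Submodule.subset_span ⟨Fin.cons r v, ?_, ?_, ?_, ?_⟩
      · intro t
        refine Fin.cases ?_ (fun i => ?_) t
        · exact Submodule.mem_sup_right (Submodule.mem_span_singleton_self r)
        · exact Submodule.mem_sup_left (hv i)
      · rw [linearIndependent_finCons]
        refine ⟨h1, fun hmem => hrU ?_⟩
        refine (Submodule.span_le.2 ?_ : _ ≤ U) hmem
        rintro _ ⟨t, rfl⟩
        exact hv t
      · refine hmono _ _ ?_ (hadd _ h2)
        rw [Submodule.span_le]
        rintro _ ⟨t, rfl⟩
        refine Fin.cases ?_ (fun i => ?_) t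
        · exact Submodule.mem_sup_right hr
        · exact Submodule.mem_sup_left (Submodule.subset_span ⟨i, rfl⟩)
      · rw [ExteriorAlgebra.ιMulti_succ_apply]
        rfl

theorem grass_step_rank {F : Type*} [Field F] {V : Type*} [AddCommGroup V] [Module F V]
    [FiniteDimensional F V] (P : Submodule F V → Prop) (U R : Submodule F V)
    (hmono : ∀ S T : Submodule F V, S ≤ T → P T → P S)
    (hadd : ∀ S, P S → P (S ⊔ R)) (r : V) (hr : r ∈ R) (hrU : r ∉ U) (k : ℕ) :
    finrank F ↥(grassmannIn F V P (U ⊔ Submodule.span F {r}) (k + 1))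
      = finrank F ↥(grassmannIn F V P U (k + 1)) + finrank F ↥(grassmannIn F V P U k) := by
  rw [grass_step_eq P U R hmono hadd r hr hrU k]
  obtain ⟨φ, hφr, hφU⟩ := Submodule.exists_le_ker_of_notMem hrU
  have hf1 := grass_fin P U (k + 1)
  have hf2 := grass_fin P U k
  have hz : ∀ y ∈ grassmannIn F V P U k,
      CliffordAlgebra.contractLeft (Q := (0 : QuadraticForm F V)) φ
        (ExteriorAlgebra.ι F r * y) = 0 → y = 0 := by
    intro y hy h0
    rw [mul_contract φ r y (contract_grass φ P U hφU k y hy)] at h0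
    exact (smul_eq_zero.1 h0).resolve_left hφr
  have hdisj : grassmannIn F V P U (k + 1) ⊓
      (grassmannIn F V P U k).map (LinearMap.mulLeft F (ExteriorAlgebra.ι F r)) = ⊥ := by
    rw [eq_bot_iff]
    rintro x ⟨hx, y, hy, rfl⟩
    have := hz y hy (contract_grass φ P U hφU (k + 1) _ hx)
    subst this
    simp
  have hrank : finrank F ↥((grassmannIn F V P U k).map
      (LinearMap.mulLeft F (ExteriorAlgebra.ι F r))) = finrank F ↥(grassmannIn F V P U k) := by
    have hinj : Function.Injective
        ((LinearMap.mulLeft F (ExteriorAlgebra.ι F r)).domRestrict (grassmannIn F V P U k)) := by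
      rw [injective_iff_map_eq_zero]
      rintro ⟨y, hy⟩ h0
      have h0' : ExteriorAlgebra.ι F r * y = 0 := h0
      have := hz y hy (by rw [h0']; exact map_zero _)
      exact Subtype.ext this
    rw [← LinearMap.range_domRestrict]
    exact LinearMap.finrank_range_of_inj hinj
  have := Submodule.finrank_sup_add_finrank_inf_eq (grassmannIn F V P U (k + 1))
    ((grassmannIn F V P U k).map (LinearMap.mulLeft F (ExteriorAlgebra.ι F r)))
  rw [hdisj, finrank_bot, add_zero, hrank] at this
  exact this

theorem grass_zero {F : Type*} [Field F] {V : Type*} [AddCommGroup V] [Module F V]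
    (P : Submodule F V → Prop) (U : Submodule F V) (hbot : P ⊥) :
    finrank F ↥(grassmannIn F V P U 0) = 1 := by
  have : grassmannIn F V P U 0 = Submodule.span F {1} := by
    unfold grassmannIn
    congr 1
    ext x
    constructor
    · rintro ⟨v, -, -, -, rfl⟩
      simp
    · intro hx
      refine ⟨Fin.elim0, fun t => t.elim0, linearIndependent_empty_type, ?_, ?_⟩
      · simpa using hbot
      · simpa using hx
  rw [this]
  exact finrank_span_singleton one_ne_zero

theorem grass_chain {F : Type*} [Field F] {V : Type*} [AddCommGroup V] [Module F V]
    [FiniteDimensional F V] (P : Submodule F V → Prop) (R : Submodule F V)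
    (hmono : ∀ S T : Submodule F V, S ≤ T → P T → P S)
    (hadd : ∀ S, P S → P (S ⊔ R)) (hbot : P ⊥) (n : ℕ) :
    ∀ (m M : ℕ) (U : Submodule F V), U ⊔ R = ⊤ → finrank F U + m = finrank F V →
      (∀ k ≤ n, finrank F ↥(grassmannIn F V P U k) + (if 2 ≤ k then M.choose (k - 2) else 0)
        = M.choose k) →
      ∀ k ≤ n, finrank F ↥(grassmannIn F V P ⊤ k)
        + (if 2 ≤ k then (M + m).choose (k - 2) else 0) = (M + m).choose k := by
  intro m
  induction m with
  | zero =>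
    intro M U hUR hU hk
    have : U = ⊤ := Submodule.eq_top_of_finrank_eq (by omega)
    subst this
    simpa using hk
  | succ m ih =>
    intro M U hUR hU hk
    have : ∃ r ∈ R, r ∉ U := by
      by_contra hcon
      push Not at hcon
      have hle : R ≤ U := hcon
      rw [sup_eq_left.2 hle] at hUR
      rw [hUR, finrank_top] at hU
      omega
    obtain ⟨r, hr, hrU⟩ := this
    have hM : M + (m + 1) = (M + 1) + m := by omega
    rw [hM]
    refine ih (M + 1) (U ⊔ Submodule.span F {r}) ?_ ?_ ?_
    · rw [eq_top_iff, ← hUR]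
      exact sup_le_sup_right le_sup_left _
    · rw [Submodule.finrank_sup_span_singleton hrU]
      omega
    · intro k hkn
      match k with
      | 0 => simp [grass_zero P _ hbot]
      | 1 =>
        rw [grass_step_rank P U R hmono hadd r hr hrU 0, grass_zero P _ hbot]
        have := hk 1 hkn
        simp at this ⊢
        omega
      | 2 =>
        rw [grass_step_rank P U R hmono hadd r hr hrU 1]
        have h1 := hk 1 (by omega)
        have h2 := hk 2 hkn
        have h3 := Nat.choose_succ_succ M 1
        simp at h1 h2 h3 ⊢
        omega
      | k + 3 =>
        have hs : finrank F ↥(grassmannIn F V P (U ⊔ Submodule.span F {r}) (k + 3))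
            = finrank F ↥(grassmannIn F V P U (k + 3))
              + finrank F ↥(grassmannIn F V P U (k + 2)) :=
          grass_step_rank P U R hmono hadd r hr hrU (k + 2)
        rw [hs]
        have h1 := hk (k + 2) (by omega)
        have h2 := hk (k + 3) hkn
        have h3 := Nat.choose_succ_succ M (k + 2)
        have h4 := Nat.choose_succ_succ M k
        rw [if_pos (by omega)] at h1 h2
        rw [if_pos (by omega)]
        simp only [Nat.succ_eq_add_one, show k + 3 - 2 = k + 1 by omega,
          show k + 2 - 2 = k by omega, show k + 2 + 1 = k + 3 by omega] at *
        omega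

theorem choose_mono_two (M h : ℕ) (hh : 2 ≤ h) (hM : 2 * h ≤ M) :
    M.choose (h - 2) ≤ M.choose h := by
  obtain ⟨j, rfl⟩ := Nat.exists_eq_add_of_le' hh
  rw [Nat.add_sub_cancel]
  exact (Nat.choose_le_succ_of_lt_half_left (by omega)).trans
    (Nat.choose_le_succ_of_lt_half_left (by omega))

theorem sing_facts {F : Type*} [Field F] {V : Type*} [AddCommGroup V] [Module F V]
    (Orth : V → V → F) (sv : V → Prop) (Sing : Submodule F V → Prop) (RadSet : Set V)
    (hcase :
      (∃ (σ : F ≃+* F) (h : V → V → F), (∀ a, σ (σ a) = a) ∧ IsHermitianForm F V σ h ∧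
        Orth = h ∧ sv = (fun v => h v v = 0) ∧ Sing = TotSingB F V h ∧
        RadSet = radSetB F V h) ∨
      (∃ s : V → V → F, IsAlternatingForm F V s ∧ Orth = s ∧
        sv = (fun v => s v v = 0) ∧ Sing = TotSingB F V s ∧ RadSet = radSetB F V s) ∨
      (∃ q : QuadraticForm F V, Orth = polarF F V q ∧ sv = (fun v => q v = 0) ∧
        Sing = TotSingQ F V q ∧ RadSet = radSetQ F V q))
    (R : Submodule F V) (hR : (R : Set V) = RadSet) :
    (∀ S T : Submodule F V, S ≤ T → Sing T → Sing S) ∧ (∀ S, Sing S → Sing (S ⊔ R)) ∧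
      Sing ⊥ := by
  have hB : ∀ B : V → V → F, (∀ x y z : V, B (x + y) z = B x z + B y z) →
      (∀ x y z : V, B x (y + z) = B x y + B x z) → (∀ r x, B r x = 0 → B x r = 0) →
      (R : Set V) = radSetB F V B →
      (∀ S T : Submodule F V, S ≤ T → TotSingB F V B T → TotSingB F V B S) ∧
      (∀ S, TotSingB F V B S → TotSingB F V B (S ⊔ R)) ∧ TotSingB F V B ⊥ := by
    intro B hl hr hsym hRB
    have hrad : ∀ r ∈ R, ∀ w, B r w = 0 := by
      intro r hrR
      have : r ∈ (R : Set V) := hrR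
      rw [hRB] at this
      exact this
    refine ⟨fun S T hST hT x hx y hy => hT x (hST hx) y (hST hy), ?_, ?_⟩
    · intro S hS x hx y hy
      obtain ⟨a, ha, r, hrR, rfl⟩ := Submodule.mem_sup.1 hx
      obtain ⟨b, hb, t, htR, rfl⟩ := Submodule.mem_sup.1 hy
      rw [hl, hr, hS a ha b hb, hrad r hrR, hsym t a (hrad t htR a)]
      simp
    · intro x hx y hy
      rw [Submodule.mem_bot] at hx
      subst hx
      exact hrad 0 R.zero_mem y
  rcases hcase with ⟨σ, h, hσ, hh, -, -, rfl, rfl⟩ | ⟨s, hs, -, -, rfl, rfl⟩ |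
    ⟨q, -, -, rfl, rfl⟩
  · refine hB h hh.1 hh.2.1 (fun r x hrx => ?_) hR
    rw [hh.2.2.2 r x, hrx, map_zero]
  · refine hB s hs.1 hs.2.1 (fun r x hrx => ?_) hR
    have h1 := hs.2.2.2.2 (r + x)
    rw [hs.1, hs.2.1, hs.2.1, hs.2.2.2.2 r, hs.2.2.2.2 x, hrx] at h1
    simpa using h1
  · refine ⟨fun S T hST hT x hx => hT x (hST hx), ?_, ?_⟩
    · intro S hS x hx
      obtain ⟨a, ha, r, hrR, rfl⟩ := Submodule.mem_sup.1 hx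
      have h1 : r ∈ (R : Set V) := hrR
      rw [hR] at h1
      have h2 := h1.2 a
      unfold polarF QuadraticMap.polar at h2
      rw [h1.1, hS a ha, add_comm r a] at h2
      simpa using h2
    · intro x hx
      rw [Submodule.mem_bot] at hx
      subst hx
      exact QuadraticMap.map_zero q

end PolarGrassAux

open PolarGrass Module in
/-- with a fixed Witt decomposition `V = V̄ ⊕ R` (`dim V̄ = N - d`), if
`dim Ḡ_h = (N-d).choose h - (N-d).choose (h-2)` for every `1 ≤ h ≤ n` (with the
convention `choose m (-1) = 0`), then `dim G_k(η) = N.choose k - N.choose (k-2)` for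
every `1 ≤ k ≤ n`. -/
theorem stmt10 (F : Type*) [Field F] (V : Type*) [AddCommGroup V] [Module F V]
    [FiniteDimensional F V]
    (Orth : V → V → F) (sv : V → Prop) (Sing : Submodule F V → Prop) (RadSet : Set V)
    (hcase :
      (∃ (σ : F ≃+* F) (h : V → V → F), (∀ a, σ (σ a) = a) ∧ IsHermitianForm F V σ h ∧
        Orth = h ∧ sv = (fun v => h v v = 0) ∧ Sing = TotSingB F V h ∧
        RadSet = radSetB F V h) ∨
      (∃ s : V → V → F, IsAlternatingForm F V s ∧ Orth = s ∧
        sv = (fun v => s v v = 0) ∧ Sing = TotSingB F V s ∧ RadSet = radSetB F V s) ∨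
      (∃ q : QuadraticForm F V, Orth = polarF F V q ∧ sv = (fun v => q v = 0) ∧
        Sing = TotSingQ F V q ∧ RadSet = radSetQ F V q))
    (n d₀ d N : ℕ) (hn : 2 ≤ n)
    (W : Fin n → Submodule F V) (W₀ R : Submodule F V)
    (hdec : IsWittDecomp F V Orth sv RadSet n d₀ d W W₀ R)
    (hNV : Module.finrank F V = N) (hN : N = 2 * n + d₀ + d)
    (hGbar : ∀ h : ℕ, 1 ≤ h → h ≤ n →
      Module.finrank F ↥(grassmannIn F V Sing ((⨆ j, W j) ⊔ W₀) h)
        = (N - d).choose h - (if 2 ≤ h then (N - d).choose (h - 2) else 0)) :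
    ∀ k : ℕ, 1 ≤ k → k ≤ n →
      Module.finrank F ↥(grassmann F V Sing k)
        = N.choose k - (if 2 ≤ k then N.choose (k - 2) else 0) := by
  obtain ⟨hint, -, -, -, hd0, hR, hRd⟩ := hdec
  obtain ⟨hmono, hadd, hbot⟩ := PolarGrassAux.sing_facts Orth sv Sing RadSet hcase R hR
  obtain ⟨hind, htop⟩ := (DirectSum.isInternal_submodule_iff_iSupIndep_and_iSup_eq_top _).1 hint
  have hsup : ((⨆ j, W j) ⊔ W₀) ⊔ R = ⊤ := by
    rw [eq_top_iff, ← htop]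
    refine iSup_le ?_
    rintro (j | j)
    · exact (le_iSup W j).trans (le_sup_left.trans le_sup_left)
    · fin_cases j
      · exact le_sup_right.trans le_sup_left
      · exact le_sup_right
  have hdis : Disjoint ((⨆ j, W j) ⊔ W₀) R := by
    have h1 := hind (Sum.inr 1)
    refine Disjoint.symm (Disjoint.mono_right ?_ h1)
    refine sup_le (iSup_le fun j => ?_) ?_
    · exact le_iSup₂_of_le (f := fun (i : Fin n ⊕ Fin 2) (_ : i ≠ Sum.inr 1) =>
        Sum.elim W ![W₀, R] i) (Sum.inl j) (by simp) le_rfl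
    · exact le_iSup₂_of_le (f := fun (i : Fin n ⊕ Fin 2) (_ : i ≠ Sum.inr 1) =>
        Sum.elim W ![W₀, R] i) (Sum.inr 0) (by simp) le_rfl
  have hrk := Submodule.finrank_add_eq_of_isCompl (IsCompl.of_eq hdis.eq_bot hsup)
  have hmain := PolarGrassAux.grass_chain Sing R hmono hadd hbot n d (N - d)
    ((⨆ j, W j) ⊔ W₀) hsup (by omega) (by
      intro h hh
      rcases Nat.eq_zero_or_pos h with rfl | hpos
      · simp [PolarGrassAux.grass_zero Sing _ hbot]
      · rw [hGbar h hpos hh]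
        by_cases h2 : 2 ≤ h
        · have := PolarGrassAux.choose_mono_two (N - d) h h2 (by omega)
          simp only [if_pos h2]
          omega
        · simp only [if_neg h2]
          omega)
  intro k _ hk
  have hfin := hmain k hk
  rw [show N - d + d = N by omega] at hfin
  unfold grassmann
  omega
end
end

section
/- Let U be a 4-dimensional F-vector space carrying a σ-Hermitian form h which is an h-orthogonal direct sum of two hyperbolic planes (i.e., U has a basis e₁, e₂, e₃, e₄ with h(e₁,e₁) = h(e₂,e₂) = h(e₃,e₃) = h(e₄,e₄) = 0, h(e₁,e₂) = h(e₃,e₄) = 1, and h(eᵢ,eⱼ) = 0 for all other pairs i < j). Then the subspace of ⋀² U spanned by all wedges u ∧ v, where u, v is a basis of a 2-dimensional totally singular subspace of U, equals all of ⋀² U (which has dimension 6). -/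
noncomputable section

open PolarGrass Module in
lemma aux_mem {F : Type*} [Field F] {U : Type*} [AddCommGroup U] [Module F U]
    {σ : F ≃+* F} {h : U → U → F} (hherm : IsHermitianForm F U σ h) (u v : U)
    (hli : LinearIndependent F ![u, v]) (huu : h u u = 0) (huv : h u v = 0) (hvv : h v v = 0) :
    ExteriorAlgebra.ι F u * ExteriorAlgebra.ι F v ∈ grassmann F U (TotSingB F U h) 2 := by
  obtain ⟨ha, hb, hc, hd⟩ := hherm
  apply Submodule.subset_span
  refine ⟨![u, v], fun _ => trivial, hli, ?_, ?_⟩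
  · intro x hx y hy
    have hr : Set.range ![u, v] = {u, v} := by simp [Matrix.range_cons, Set.pair_comm]
    rw [hr, Submodule.mem_span_pair] at hx hy
    obtain ⟨p, q, rfl⟩ := hx
    obtain ⟨r, s, rfl⟩ := hy
    have hvu : h v u = 0 := by rw [hd u v, huv, map_zero]
    simp [ha, hb, hc, huu, huv, hvv, hvu]
  · simp [ExteriorAlgebra.ιMulti_apply]

open PolarGrass Module in
/-- a 4-dimensional space carrying a σ-Hermitian form which is the orthogonal
sum of two hyperbolic planes; the span of the wedges of bases of totally singular
2-dimensional subspaces is all of `⋀² U`, which has dimension 6. -/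
theorem stmt11 (F : Type*) [Field F] (U : Type*) [AddCommGroup U] [Module F U]
    (σ : F ≃+* F) (hσinv : ∀ a, σ (σ a) = a) (hσne : σ ≠ RingEquiv.refl F)
    (h : U → U → F) (hherm : IsHermitianForm F U σ h)
    (b : Basis (Fin 4) F U)
    (hdiag : ∀ i : Fin 4, h (b i) (b i) = 0)
    (h01 : h (b 0) (b 1) = 1) (h23 : h (b 2) (b 3) = 1)
    (hoth : ∀ i j : Fin 4, i < j → ¬(i = 0 ∧ j = 1) → ¬(i = 2 ∧ j = 3) →
      h (b i) (b j) = 0) :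
    grassmann F U (TotSingB F U h) 2 = ⋀[F]^2 U ∧
    Module.finrank F ↥(⋀[F]^2 U) = 6 := by
  constructor
  · apply le_antisymm
    · apply Submodule.span_le.2
      rintro x ⟨v, -, -, -, rfl⟩
      exact ExteriorAlgebra.ιMulti_range F 2 ⟨v, rfl⟩
    have hmem := fun u v => aux_mem hherm u v
    set S := grassmann F U (TotSingB F U h) 2 with hS
    have anti : ∀ u v : U, ExteriorAlgebra.ι F u * ExteriorAlgebra.ι F v =
        - (ExteriorAlgebra.ι F v * ExteriorAlgebra.ι F u) := fun u v =>
      eq_neg_of_add_eq_zero_left (ExteriorAlgebra.ι_add_mul_swap u v)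
    have h02 := hoth 0 2 (by decide) (by decide) (by decide)
    have h03 := hoth 0 3 (by decide) (by decide) (by decide)
    have h12 := hoth 1 2 (by decide) (by decide) (by decide)
    have h13 := hoth 1 3 (by decide) (by decide) (by decide)
    have hli : ∀ i j : Fin 4, i ≠ j → LinearIndependent F ![b i, b j] := by
      intro i j hij
      rw [LinearIndependent.pair_iff]
      intro s t hst
      have e1 := congrArg (fun x => b.repr x i) hst
      have e2 := congrArg (fun x => b.repr x j) hst
      simp [Finsupp.single_apply, hij, hij.symm] at e1 e2
      exact ⟨e1, e2⟩
    have m02 := hmem _ _ (hli 0 2 (by decide)) (hdiag _) h02 (hdiag _)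
    have m03 := hmem _ _ (hli 0 3 (by decide)) (hdiag _) h03 (hdiag _)
    have m12 := hmem _ _ (hli 1 2 (by decide)) (hdiag _) h12 (hdiag _)
    have m13 := hmem _ _ (hli 1 3 (by decide)) (hdiag _) h13 (hdiag _)
    have key : ∀ a : F, a ≠ 0 → ExteriorAlgebra.ι F (b 0) * ExteriorAlgebra.ι F (b 1)
        - (a / σ a) • (ExteriorAlgebra.ι F (b 2) * ExteriorAlgebra.ι F (b 3)) ∈ S := by
      intro a ha
      have hsa : σ a ≠ 0 := by simpa using ha
      obtain ⟨hA, hB, hC, hD⟩ := hherm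
      have hl : ∀ (a : F) (x y : U), h (a • x) y = σ a * h x y := fun a x y => by
        simpa using hC a 1 x y
      have hr : ∀ (a : F) (x y : U), h x (a • y) = a * h x y := fun a x y => by
        simpa using hC 1 a x y
      have h20 : h (b 2) (b 0) = 0 := by rw [hD (b 0), h02, map_zero]
      have h21 : h (b 2) (b 1) = 0 := by rw [hD (b 1), h12, map_zero]
      have h31 : h (b 3) (b 1) = 0 := by rw [hD (b 1), h13, map_zero]
      obtain ⟨c, hc⟩ : ∃ c, c = -(σ a)⁻¹ := ⟨_, rfl⟩
      have hac : σ a * c = -1 := by rw [hc]; field_simp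
      have hm := hmem (b 0 + a • b 2) (b 1 + c • b 3) ?_ ?_ ?_ ?_
      · simp only [map_add, map_smul, add_mul, mul_add, smul_mul_assoc, mul_smul_comm,
          smul_smul] at hm
        rw [anti (b 2) (b 1)] at hm
        have := S.sub_mem (S.sub_mem hm (S.smul_mem c m03)) (S.smul_mem (-a) m12)
        convert this using 1
        rw [div_eq_mul_inv, ← neg_neg ((σ a)⁻¹), ← hc]
        module
      · rw [LinearIndependent.pair_iff]
        intro s t hst
        have e1 := congrArg (fun x => b.repr x 0) hst
        have e2 := congrArg (fun x => b.repr x 1) hst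
        simp [Finsupp.single_apply] at e1 e2
        exact ⟨e1, e2⟩
      · simp [hA, hB, hl, hr, hdiag, h02, h20]
      · simp [hA, hB, hl, hr, h01, h03, h21, h23, mul_comm c, hac]
      · simp [hA, hB, hl, hr, hdiag, h13, h31]
    obtain ⟨a, ha⟩ : ∃ a, σ a ≠ a := by
      by_contra! hc
      exact hσne (RingEquiv.ext hc)
    have ha0 : a ≠ 0 := by rintro rfl; simp at ha
    have hsa : σ a ≠ 0 := by simpa using ha0
    have k1 := key 1 one_ne_zero
    have k2 := key a ha0
    have hne : a / σ a - 1 ≠ 0 := by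
      rw [sub_ne_zero, Ne, div_eq_one_iff_eq hsa]
      exact fun h => ha h.symm
    have m23 : ExteriorAlgebra.ι F (b 2) * ExteriorAlgebra.ι F (b 3) ∈ S := by
      rw [← S.smul_mem_iff hne]
      convert S.sub_mem k1 k2 using 1
      simp only [map_one, div_one]
      module
    have m01 : ExteriorAlgebra.ι F (b 0) * ExteriorAlgebra.ι F (b 1) ∈ S := by
      convert S.add_mem k1 m23 using 1
      simp
    have hlt : ∀ i j : Fin 4, i < j →
        ExteriorAlgebra.ι F (b i) * ExteriorAlgebra.ι F (b j) ∈ S := by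
      intro i j hij
      fin_cases i <;> fin_cases j <;> first | assumption | (exact absurd hij (by decide))
    have hall : ∀ i j : Fin 4, ExteriorAlgebra.ι F (b i) * ExteriorAlgebra.ι F (b j) ∈ S := by
      intro i j
      rcases lt_trichotomy i j with hij | rfl | hij
      · exact hlt i j hij
      · rw [ExteriorAlgebra.ι_sq_zero]; exact S.zero_mem
      · rw [anti]; exact S.neg_mem (hlt j i hij)
    rw [← ExteriorAlgebra.ιMulti_span_fixedDegree, Submodule.span_le]
    rintro x ⟨v, rfl⟩
    have : ExteriorAlgebra.ιMulti F 2 v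
        = ExteriorAlgebra.ι F (v 0) * ExteriorAlgebra.ι F (v 1) := by
      simp [ExteriorAlgebra.ιMulti_apply]
      rfl
    rw [this, ← b.sum_repr (v 0), ← b.sum_repr (v 1), map_sum, map_sum, Finset.sum_mul_sum]
    refine S.sum_mem fun i _ => S.sum_mem fun j _ => ?_
    rw [map_smul, map_smul, smul_mul_smul_comm]
    exact S.smul_mem _ (hall i j)
  · have := Module.Finite.of_basis b
    rw [exteriorPower.finrank_eq, Module.finrank_eq_card_basis b]
    decide
end
end

section
/- Suppose h is non-degenerate with Witt index n ≥ 2 and arbitrary anisotropic defect d₀ = N − 2n, i.e., V is an h-orthogonal direct sum V = V₁ ⊕ ⋯ ⊕ Vₙ ⊕ V₀ with each Vᵢ a hyperbolic plane and V₀ anisotropic of dimension d₀. Then for every integer k with 1 ≤ k ≤ n, the Grassmann image G_k(h) equals all of ⋀^k V; in particular dim G_k(h) = binom(N, k). -/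
noncomputable section

namespace PolarGrass

variable {F : Type*} [Field F] {V : Type*} [AddCommGroup V] [Module F V]
  {σ : F ≃+* F} {h : V → V → F}

namespace IsHermitianForm

theorem addL (H : IsHermitianForm F V σ h) (x y z : V) : h (x + y) z = h x z + h y z := H.1 x y z

theorem addR (H : IsHermitianForm F V σ h) (x y z : V) : h x (y + z) = h x y + h x z := H.2.1 x y z

theorem smulR (H : IsHermitianForm F V σ h) (b : F) (x y : V) : h x (b • y) = b * h x y := by
  have := H.2.2.1 1 b x y
  simpa using this

theorem smulL (H : IsHermitianForm F V σ h) (a : F) (x y : V) : h (a • x) y = σ a * h x y := by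
  have := H.2.2.1 a 1 x y
  simpa using this

theorem zeroR (H : IsHermitianForm F V σ h) (x : V) : h x 0 = 0 := by
  have := H.smulR 0 x 0
  simpa using this

theorem zeroL (H : IsHermitianForm F V σ h) (x : V) : h 0 x = 0 := by
  have := H.smulL 0 0 x
  simpa using this

theorem subR (H : IsHermitianForm F V σ h) (x y z : V) : h x (y - z) = h x y - h x z := by
  have := H.smulR (-1) x z
  rw [sub_eq_add_neg, H.addR, ← neg_one_smul F z, this]; ring

theorem subL (H : IsHermitianForm F V σ h) (x y z : V) : h (x - y) z = h x z - h y z := by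
  have := H.smulL (-1) y z
  rw [sub_eq_add_neg, H.addL, ← neg_one_smul F y, this]; simp [sub_eq_add_neg]

theorem symm0 (H : IsHermitianForm F V σ h) {x y : V} (hxy : h x y = 0) : h y x = 0 := by
  rw [H.2.2.2 x y, hxy, map_zero]

/-- The orthogonal complement of a vector. -/
def perp (H : IsHermitianForm F V σ h) (r : V) : Submodule F V where
  carrier := {v | h r v = 0}
  add_mem' := by
    intro a b ha hb
    simp only [Set.mem_ofPred_eq] at *
    rw [H.addR, ha, hb, add_zero]
  zero_mem' := H.zeroR r
  smul_mem' := by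
    intro c x hx
    simp only [Set.mem_ofPred_eq] at *
    rw [H.smulR, hx, mul_zero]

theorem mem_perp (H : IsHermitianForm F V σ h) {r v : V} : v ∈ H.perp r ↔ h r v = 0 := Iff.rfl

end IsHermitianForm

/-- `U` contains `k` pairwise orthogonal hyperbolic pairs. -/
def HP (h : V → V → F) (k : ℕ) (U : Submodule F V) : Prop :=
  ∃ e f : Fin k → V, (∀ i, e i ∈ U) ∧ (∀ i, f i ∈ U) ∧ (∀ i j, h (e i) (e j) = 0) ∧
    (∀ i j, h (f i) (f j) = 0) ∧ (∀ i j, h (e i) (f j) = if i = j then 1 else 0)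

/-- span of wedges of (possibly dependent) totally singular tuples. -/
def GS (h : V → V → F) (U : Submodule F V) (k : ℕ) : Submodule F (ExteriorAlgebra F V) :=
  Submodule.span F {x | ∃ v : Fin k → V, (∀ t, v t ∈ U) ∧ (∀ i j, h (v i) (v j) = 0) ∧
    x = ExteriorAlgebra.ιMulti F k v}

theorem HP.mono {k l : ℕ} (hkl : k ≤ l) {U : Submodule F V} (hp : HP h l U) : HP h k U := by
  obtain ⟨e, f, he, hf, hee, hff, hef⟩ := hp
  refine ⟨fun i => e (Fin.castLE hkl i), fun i => f (Fin.castLE hkl i), fun i => he _,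
    fun i => hf _, fun i j => hee _ _, fun i j => hff _ _, fun i j => ?_⟩
  simp only [hef, Fin.castLE_inj]

theorem HP.modify (H : IsHermitianForm F V σ h) {k : ℕ} {U : Submodule F V} (g r : V)
    (hg : g ∈ U) (hgg : h g g = 0) (hrg : h r g ≠ 0) (hp : HP h k (U ⊓ H.perp g)) :
    HP h k (U ⊓ H.perp r) ∧ (HP h k ((U ⊓ H.perp g) ⊓ H.perp r)) := by
  obtain ⟨e, f, he, hf, hee, hff, hef⟩ := hp
  suffices hs : HP h k ((U ⊓ H.perp g) ⊓ H.perp r) by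
    refine ⟨?_, hs⟩
    obtain ⟨e, f, he, hf, h3⟩ := hs
    exact ⟨e, f, fun i => ⟨(he i).1.1, (he i).2⟩, fun i => ⟨(hf i).1.1, (hf i).2⟩, h3⟩
  have hge : ∀ i, h g (e i) = 0 := fun i => (he i).2
  have hgf : ∀ i, h g (f i) = 0 := fun i => (hf i).2
  have heg : ∀ i, h (e i) g = 0 := fun i => H.symm0 (hge i)
  have hfg : ∀ i, h (f i) g = 0 := fun i => H.symm0 (hgf i)
  have hG : g ∈ U ⊓ H.perp g := ⟨hg, hgg⟩
  refine ⟨fun i => e i - (h r (e i) / h r g) • g, fun i => f i - (h r (f i) / h r g) • g,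
    fun i => ⟨sub_mem (he i) (Submodule.smul_mem _ _ hG), ?_⟩,
    fun i => ⟨sub_mem (hf i) (Submodule.smul_mem _ _ hG), ?_⟩,
    fun i j => ?_, fun i j => ?_, fun i j => ?_⟩
  · show h r (e i - (h r (e i) / h r g) • g) = 0
    rw [H.subR, H.smulR]; field_simp; ring
  · show h r (f i - (h r (f i) / h r g) • g) = 0
    rw [H.subR, H.smulR]; field_simp; ring
  · simp [H.subR, H.subL, H.smulR, H.smulL, hge, heg, hgg, hee]
  · simp [H.subR, H.subL, H.smulR, H.smulL, hgf, hfg, hgg, hff]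
  · simp [H.subR, H.subL, H.smulR, H.smulL, hgf, heg, hgg, hef]

theorem HP.perp (H : IsHermitianForm F V σ h) {k : ℕ} {U : Submodule F V} (r : V)
    (hp : HP h (k + 1) U) : HP h k (U ⊓ H.perp r) := by
  obtain ⟨e, f, he, hf, hee, hff, hef⟩ := hp
  have hfe : ∀ i j, i ≠ j → h (f i) (e j) = 0 := fun i j hij =>
    H.symm0 (by rw [hef, if_neg hij.symm])
  by_cases h1 : ∃ i, h r (e i) ≠ 0
  · obtain ⟨i, hi⟩ := h1
    refine (HP.modify H (e i) r (he i) (hee i i) hi ?_).1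
    refine ⟨fun j => e (i.succAbove j), fun j => f (i.succAbove j), fun j => ⟨he _, hee _ _⟩,
      fun j => ⟨hf _, ?_⟩, fun _ _ => hee _ _, fun _ _ => hff _ _, fun a b => ?_⟩
    · show h (e i) (f (i.succAbove j)) = 0
      rw [hef, if_neg (Fin.succAbove_ne i j).symm]
    · simp [hef]
  by_cases h2 : ∃ i, h r (f i) ≠ 0
  · obtain ⟨i, hi⟩ := h2
    refine (HP.modify H (f i) r (hf i) (hff i i) hi ?_).1
    refine ⟨fun j => e (i.succAbove j), fun j => f (i.succAbove j), fun j => ⟨he _, ?_⟩,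
      fun j => ⟨hf _, hff _ _⟩, fun _ _ => hee _ _, fun _ _ => hff _ _, fun a b => ?_⟩
    · exact hfe _ _ (Fin.succAbove_ne i j).symm
    · simp [hef]
  push Not at h1 h2
  exact ⟨fun j => e j.succ, fun j => f j.succ, fun j => ⟨he _, h1 _⟩, fun j => ⟨hf _, h2 _⟩,
    fun _ _ => hee _ _, fun _ _ => hff _ _, fun a b => by simp [hef]⟩

theorem ext_cons (k : ℕ) (u : V) (v : Fin k → V) :
    ExteriorAlgebra.ι F u * ExteriorAlgebra.ιMulti F k v =
      ExteriorAlgebra.ιMulti F (k + 1) (Fin.cons u v : Fin (k + 1) → V) := by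
  rw [ExteriorAlgebra.ιMulti_succ_apply]; rfl

theorem ext_uncons (k : ℕ) (v : Fin (k + 1) → V) :
    ExteriorAlgebra.ιMulti F (k + 1) v = ExteriorAlgebra.ι F (v 0) *
      ExteriorAlgebra.ιMulti F k (fun i => v i.succ) := by
  rw [ExteriorAlgebra.ιMulti_succ_apply]; rfl

theorem ext_mem {U : Submodule F V} {k : ℕ} {u : V} {x : ExteriorAlgebra F V} (hu : u ∈ U)
    (hx : x ∈ extPowOf F V U k) : ExteriorAlgebra.ι F u * x ∈ extPowOf F V U (k + 1) := by
  induction hx using Submodule.span_induction with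
  | mem x hx =>
    obtain ⟨v, hv, rfl⟩ := hx
    refine Submodule.subset_span ⟨Fin.cons u v, fun t => ?_, ext_cons _ _ _⟩
    refine Fin.cases hu (fun i => ?_) t
    simpa using hv i
  | zero => simp
  | add x y _ _ hx hy => rw [mul_add]; exact add_mem hx hy
  | smul a x _ hx => rw [mul_smul_comm]; exact Submodule.smul_mem _ _ hx

theorem GS_mem (H : IsHermitianForm F V σ h) {U : Submodule F V} {k : ℕ} {r : V}
    {x : ExteriorAlgebra F V} (hr : r ∈ U) (hrr : h r r = 0)
    (hx : x ∈ GS h (U ⊓ H.perp r) k) : ExteriorAlgebra.ι F r * x ∈ GS h U (k + 1) := by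
  induction hx using Submodule.span_induction with
  | mem x hx =>
    obtain ⟨v, hv, hvv, rfl⟩ := hx
    refine Submodule.subset_span ⟨Fin.cons r v, fun t => ?_, fun i j => ?_, ext_cons _ _ _⟩
    · refine Fin.cases hr (fun i => ?_) t
      simpa using (hv i).1
    · refine Fin.cases ?_ (fun i => ?_) i <;> refine Fin.cases ?_ (fun j => ?_) j
      · simpa using hrr
      · simpa using H.mem_perp.1 (hv j).2
      · simpa using H.symm0 (hv i).2
      · simpa using hvv i j
  | zero => simp
  | add x y _ _ hx hy => rw [mul_add]; exact add_mem hx hy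
  | smul a x _ hx => rw [mul_smul_comm]; exact Submodule.smul_mem _ _ hx

/-- The inductive claim. -/
def TT (h : V → V → F) (k : ℕ) : Prop :=
  ∀ U : Submodule F V, HP h k U → extPowOf F V U k ≤ GS h U k

theorem TT.P (H : IsHermitianForm F V σ h) {k : ℕ} (T : TT h k) {U : Submodule F V}
    (hp : HP h (k + 1) U) {r : V} (hr : r ∈ U) (hrr : h r r = 0) {x : ExteriorAlgebra F V}
    (hx : x ∈ extPowOf F V (U ⊓ H.perp r) k) : ExteriorAlgebra.ι F r * x ∈ GS h U (k + 1) :=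
  GS_mem H hr hrr (T _ (hp.perp H r) hx)

theorem TT.step {k : ℕ} (T : TT h k)
    (hs : ∀ U : Submodule F V, HP h (k + 1) U → ∀ u ∈ U, ∀ v : Fin k → V, (∀ t, v t ∈ U) →
      (∀ i j, h (v i) (v j) = 0) →
      ExteriorAlgebra.ι F u * ExteriorAlgebra.ιMulti F k v ∈ GS h U (k + 1)) :
    TT h (k + 1) := by
  intro U hp
  refine Submodule.span_le.2 ?_
  rintro _ ⟨v, hv, rfl⟩
  rw [ext_uncons]
  have hx : ExteriorAlgebra.ιMulti F k (fun i => v i.succ) ∈ GS h U k :=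
    T U (hp.mono (Nat.le_succ k)) (Submodule.subset_span ⟨_, fun i => hv _, rfl⟩)
  show _ ∈ GS h U (k + 1)
  generalize ExteriorAlgebra.ιMulti F k (fun i => v i.succ) = x at hx
  induction hx using Submodule.span_induction with
  | mem x hx =>
    obtain ⟨w, hw, hww, rfl⟩ := hx
    exact hs U hp _ (hv 0) w hw hww
  | zero => simp
  | add x y _ _ hx hy => rw [mul_add]; exact add_mem hx hy
  | smul a x _ hx => rw [mul_smul_comm]; exact Submodule.smul_mem _ _ hx

theorem TT_zero : TT h 0 := by
  intro U _
  refine Submodule.span_mono ?_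
  rintro _ ⟨v, hv, rfl⟩
  exact ⟨v, hv, fun i => i.elim0, rfl⟩

theorem exists_trace (hσinv : ∀ a, σ (σ a) = a) (hσne : σ ≠ RingEquiv.refl F) (c : F)
    (hc : σ c = c) : ∃ a, a + σ a = c := by
  have ht : ∃ t, t + σ t ≠ 0 := by
    by_contra! ht
    apply hσne
    ext t
    have h1 := ht 1
    have h2 := ht t
    rw [map_one] at h1
    show σ t = t
    linear_combination h2 - t * h1
  obtain ⟨t, ht⟩ := ht
  refine ⟨c * t / (t + σ t), ?_⟩
  rw [map_div₀, map_add, map_mul, hc, hσinv, add_comm (σ t) t]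
  field_simp

/-- singular vectors span -/
theorem sing_span (H : IsHermitianForm F V σ h) (hσinv : ∀ a, σ (σ a) = a)
    (hσne : σ ≠ RingEquiv.refl F) (U : Submodule F V) (hp : HP h 1 U) :
    U ≤ Submodule.span F {v | v ∈ U ∧ h v v = 0} := by
  obtain ⟨e, f, he, hf, hee, hff, hef⟩ := hp
  replace he := he 0
  replace hf := hf 0
  replace hee := hee 0 0
  replace hff := hff 0 0
  replace hef := hef 0 0
  generalize e 0 = e at *
  generalize f 0 = f at *
  simp only [if_true] at hef
  have hfe : h f e = 1 := by rw [H.2.2.2 e f, hef, map_one]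
  intro v hv
  set w := v - h f v • e - h e v • f with hw
  have hwU : w ∈ U := sub_mem (sub_mem hv (U.smul_mem _ he)) (U.smul_mem _ hf)
  have hew : h e w = 0 := by rw [hw, H.subR, H.subR, H.smulR, H.smulR, hee, hef]; ring
  have hfw : h f w = 0 := by rw [hw, H.subR, H.subR, H.smulR, H.smulR, hff, hfe]; ring
  have hwe := H.symm0 hew
  have hwf := H.symm0 hfw
  obtain ⟨a, ha⟩ := exists_trace hσinv hσne (-(h w w)) (by rw [map_neg, ← H.2.2.2])
  have h1 : e + a • f + w ∈ Submodule.span F {v | v ∈ U ∧ h v v = 0} := by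
    refine Submodule.subset_span ⟨add_mem (add_mem he (U.smul_mem _ hf)) hwU, ?_⟩
    simp only [H.addL, H.addR, H.smulL, H.smulR, hee, hff, hef, hfe, hew, hfw, hwe, hwf]
    linear_combination ha
  have h2 : e ∈ Submodule.span F {v | v ∈ U ∧ h v v = 0} := Submodule.subset_span ⟨he, hee⟩
  have h3 : f ∈ Submodule.span F {v | v ∈ U ∧ h v v = 0} := Submodule.subset_span ⟨hf, hff⟩
  have : v = (e + a • f + w) + (h f v - 1) • e + (h e v - a) • f := by
    rw [hw]; module
  rw [this]
  exact add_mem (add_mem h1 (Submodule.smul_mem _ _ h2)) (Submodule.smul_mem _ _ h3)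

theorem TT_one (H : IsHermitianForm F V σ h) (hσinv : ∀ a, σ (σ a) = a)
    (hσne : σ ≠ RingEquiv.refl F) : TT h 1 := by
  refine TT.step TT_zero ?_
  intro U hp u hu v _ _
  rw [ExteriorAlgebra.ιMulti_zero_apply, mul_one]
  have := sing_span H hσinv hσne U hp hu
  clear hu
  induction this using Submodule.span_induction with
  | mem x hx =>
    refine Submodule.subset_span ⟨fun _ => x, fun _ => hx.1, fun _ _ => hx.2, ?_⟩
    simp [ExteriorAlgebra.ιMulti_apply]
  | zero => simp
  | add x y _ _ hx hy => rw [map_add]; exact add_mem hx hy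
  | smul a x _ hx => rw [map_smul]; exact Submodule.smul_mem _ _ hx

theorem swap' (x y : V) (z : ExteriorAlgebra F V) :
    ExteriorAlgebra.ι F x * (ExteriorAlgebra.ι F y * z) =
      -(ExteriorAlgebra.ι F y * (ExteriorAlgebra.ι F x * z)) := by
  rw [← mul_assoc, ← mul_assoc, ← neg_mul]
  congr 1
  exact eq_neg_of_add_eq_zero_left (ExteriorAlgebra.ι_add_mul_swap x y)

theorem ι_mem_ext {U : Submodule F V} {u : V} (hu : u ∈ U) :
    ExteriorAlgebra.ι F u ∈ extPowOf F V U 1 := by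
  refine Submodule.subset_span ⟨fun _ => u, fun _ => hu, ?_⟩
  simp [ExteriorAlgebra.ιMulti_apply]

/-- a hyperbolic pair -/
theorem pair_mem (H : IsHermitianForm F V σ h) (hσinv : ∀ a, σ (σ a) = a)
    (hσne : σ ≠ RingEquiv.refl F) (U : Submodule F V) (hp : HP h 2 U) (u v : V) (hu : u ∈ U)
    (hv : v ∈ U) (huu : h u u = 0) (hvv : h v v = 0) (huv : h u v = 1) :
    ExteriorAlgebra.ι F u * ExteriorAlgebra.ι F v ∈ GS h U 2 := by
  have hvu : h v u = 1 := by rw [H.2.2.2 u v, huv, map_one]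
  have hP : ∀ x ∈ U, ∀ y ∈ U, h x x = 0 → h x y = 0 →
      ExteriorAlgebra.ι F x * ExteriorAlgebra.ι F y ∈ GS h U 2 := fun x hx y hy hxx hxy =>
    TT.P H (TT_one H hσinv hσne) hp hx hxx (ι_mem_ext ⟨hy, hxy⟩)
  obtain ⟨e, f, he, hf, hee, hff, hef⟩ :=
    (HP.modify H u v hu huu (by rw [hvu]; exact one_ne_zero) (hp.perp H u)).2
  replace he := he 0
  replace hf := hf 0
  replace hee := hee 0 0
  replace hff := hff 0 0
  replace hef := hef 0 0
  generalize e 0 = e at *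
  generalize f 0 = f at *
  simp only [if_true] at hef
  obtain ⟨⟨heU, hue⟩, hve⟩ := he
  obtain ⟨⟨hfU, huf⟩, hvf⟩ := hf
  rw [SetLike.mem_coe, H.mem_perp] at hue hve huf hvf
  have heu := H.symm0 hue
  have hev := H.symm0 hve
  have hfu := H.symm0 huf
  have hfv := H.symm0 hvf
  have key : ∀ a b : F, σ a * b = -1 →
      ExteriorAlgebra.ι F u * ExteriorAlgebra.ι F v +
        (a * b) • (ExteriorAlgebra.ι F e * ExteriorAlgebra.ι F f) ∈ GS h U 2 := by
    intro a b hab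
    have h1 := hP (u + a • e) (add_mem hu (U.smul_mem _ heU)) (v + b • f)
      (add_mem hv (U.smul_mem _ hfU))
      (by simp [H.addL, H.addR, H.smulL, H.smulR, huu, hue, heu, hee])
      (by simp only [H.addL, H.addR, H.smulL, H.smulR, huv, huf, hev, hef]
          linear_combination hab)
    have h2 := hP e heU v hv hee hev
    have h3 := hP u hu f hfU huu huf
    have h4 := sub_mem (sub_mem h1 (Submodule.smul_mem _ a h2)) (Submodule.smul_mem _ b h3)
    convert h4 using 1
    simp only [map_add, map_smul, mul_add, add_mul, smul_mul_assoc, mul_smul_comm, smul_smul]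
    module
  have ht : ∃ t, σ t ≠ t := by
    by_contra! ht
    exact hσne (RingEquiv.ext ht)
  obtain ⟨t, ht⟩ := ht
  have ht0 : t ≠ 0 := by rintro rfl; simp at ht
  have hst0 : σ t ≠ 0 := by simpa using ht0
  have k1 := key 1 (-1) (by simp)
  have k2 := key t (-(σ t)⁻¹) (by field_simp)
  -- eliminate
  have k3 := sub_mem (Submodule.smul_mem _ t k1) (Submodule.smul_mem _ (σ t) k2)
  have k4 : t • (ExteriorAlgebra.ι F u * ExteriorAlgebra.ι F v +
        (1 * -1 : F) • (ExteriorAlgebra.ι F e * ExteriorAlgebra.ι F f)) -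
      σ t • (ExteriorAlgebra.ι F u * ExteriorAlgebra.ι F v +
        (t * -(σ t)⁻¹) • (ExteriorAlgebra.ι F e * ExteriorAlgebra.ι F f)) =
      (t - σ t) • (ExteriorAlgebra.ι F u * ExteriorAlgebra.ι F v) := by
    have : σ t * (t * -(σ t)⁻¹) = -t := by field_simp
    rw [smul_add, smul_add, smul_smul, smul_smul, this]
    module
  rw [k4] at k3
  exact (Submodule.smul_mem_iff _ (sub_ne_zero.2 ht.symm)).1 k3

theorem TT_two (H : IsHermitianForm F V σ h) (hσinv : ∀ a, σ (σ a) = a)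
    (hσne : σ ≠ RingEquiv.refl F) : TT h 2 := by
  refine TT.step (TT_one H hσinv hσne) ?_
  intro U hp u hu w hw hww
  have hiw : ExteriorAlgebra.ιMulti F 1 w = ExteriorAlgebra.ι F (w 0) := by
    simp [ExteriorAlgebra.ιMulti_apply]
  rw [hiw]
  have hv := hw 0
  have hvv := hww 0 0
  generalize w 0 = v at *
  have := sing_span H hσinv hσne U (hp.mono one_le_two) hu
  clear hu
  induction this using Submodule.span_induction with
  | mem x hx =>
    obtain ⟨hxU, hxx⟩ := hx
    by_cases hxv : h x v = 0
    · exact TT.P H (TT_one H hσinv hσne) hp hxU hxx (ι_mem_ext ⟨hv, hxv⟩)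
    · have := pair_mem H hσinv hσne U hp x ((h x v)⁻¹ • v) hxU (U.smul_mem _ hv) hxx
        (by simp [H.smulL, H.smulR, hvv]) (by rw [H.smulR]; field_simp)
      rw [map_smul, mul_smul_comm] at this
      exact (Submodule.smul_mem_iff _ (inv_ne_zero hxv)).1 this
  | zero => simp
  | add x y _ _ hx hy => rw [map_add, add_mul]; exact add_mem hx hy
  | smul a x _ hx => rw [map_smul, smul_mul_assoc]; exact Submodule.smul_mem _ _ hx

theorem TT_succ (H : IsHermitianForm F V σ h) {k : ℕ} (T : TT h (k + 2)) : TT h (k + 3) := by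
  refine TT.step T ?_
  intro U hp u hu w hw hww
  rw [ext_uncons, ext_uncons]
  set R := ExteriorAlgebra.ιMulti F k (fun i => w i.succ.succ) with hR
  have hRm : ∀ W : Submodule F V, (∀ i, w i ∈ W) → R ∈ extPowOf F V W k := fun W hW =>
    Submodule.subset_span ⟨_, fun i => hW _, rfl⟩
  show ExteriorAlgebra.ι F u * (ExteriorAlgebra.ι F (w 0) *
    (ExteriorAlgebra.ι F (w 1) * R)) ∈ _
  by_cases h0 : h (w 0) u = 0
  · rw [swap']
    refine neg_mem (TT.P H T hp (hw 0) (hww 0 0) ?_)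
    have hW : ∀ i, w i ∈ U ⊓ H.perp (w 0) := fun i => ⟨hw i, hww 0 i⟩
    exact ext_mem ⟨hu, h0⟩ (ext_mem (hW 1) (hRm _ hW))
  · have h0' : h u (w 0) ≠ 0 := fun h' => h0 (H.symm0 h')
    set r := w 1 - (h u (w 1) / h u (w 0)) • w 0 with hr
    have hur : h r u = 0 := H.symm0 (by rw [hr, H.subR, H.smulR]; field_simp; ring)
    have hrw : ∀ i, h r (w i) = 0 := fun i => by
      rw [hr, H.subL, H.smulL, hww, hww]; simp
    have hrr : h r r = 0 := by
      conv_lhs => rw [hr]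
      rw [← hr, H.subL, H.smulL, H.symm0 (hrw 1), H.symm0 (hrw 0)]; simp
    have hrU : r ∈ U := sub_mem (hw 1) (U.smul_mem _ (hw 0))
    have e1 : ExteriorAlgebra.ι F (w 0) * (ExteriorAlgebra.ι F (w 1) * R) =
        ExteriorAlgebra.ι F (w 0) * (ExteriorAlgebra.ι F r * R) := by
      rw [hr, map_sub, map_smul, sub_mul, mul_sub, smul_mul_assoc, mul_smul_comm,
        ← mul_assoc (ExteriorAlgebra.ι F (w 0)) (ExteriorAlgebra.ι F (w 0)),
        ExteriorAlgebra.ι_sq_zero]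
      simp
    rw [e1, swap' (w 0) r, mul_neg, swap' u r, neg_neg]
    have hW : ∀ i, w i ∈ U ⊓ H.perp r := fun i => ⟨hw i, hrw i⟩
    exact TT.P H T hp hrU hrr (ext_mem ⟨hu, hur⟩ (ext_mem (hW 0) (hRm _ hW)))

theorem TT_all (H : IsHermitianForm F V σ h) (hσinv : ∀ a, σ (σ a) = a)
    (hσne : σ ≠ RingEquiv.refl F) : ∀ k, TT h k
  | 0 => TT_zero
  | 1 => TT_one H hσinv hσne
  | 2 => TT_two H hσinv hσne
  | k + 3 => TT_succ H (TT_all H hσinv hσne (k + 2))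

theorem GS_le (H : IsHermitianForm F V σ h) (k : ℕ) :
    GS h ⊤ k ≤ grassmann F V (TotSingB F V h) k := by
  refine Submodule.span_le.2 ?_
  rintro _ ⟨v, hv, hvv, rfl⟩
  by_cases hli : LinearIndependent F v
  · refine Submodule.subset_span ⟨v, hv, hli, ?_, rfl⟩
    have h1 : ∀ i, ∀ y ∈ Submodule.span F (Set.range v), h (v i) y = 0 := by
      intro i y hy
      have : Submodule.span F (Set.range v) ≤ H.perp (v i) := by
        refine Submodule.span_le.2 ?_
        rintro _ ⟨j, rfl⟩
        exact hvv i j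
      exact this hy
    intro x hx y hy
    have : Submodule.span F (Set.range v) ≤ H.perp y := by
      refine Submodule.span_le.2 ?_
      rintro _ ⟨j, rfl⟩
      exact H.symm0 (h1 j y hy)
    exact H.symm0 (this hx)
  · rw [AlternatingMap.map_linearDependent _ _ hli]
    exact zero_mem _

theorem HP_of_decomp (H : IsHermitianForm F V σ h) {n d₀ : ℕ}
    (hdec : HasWittDecomp F V h (fun v => h v v = 0) (radSetB F V h) n d₀ 0) : HP h n ⊤ := by
  obtain ⟨W, W₀, R, -, hort, hpl, -⟩ := hdec
  choose e f hW he hf hef using hpl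
  have heW : ∀ i, e i ∈ W i := fun i => by
    rw [hW]; exact Submodule.subset_span (by simp)
  have hfW : ∀ i, f i ∈ W i := fun i => by
    rw [hW]; exact Submodule.subset_span (by simp)
  have ho : ∀ i j, i ≠ j → ∀ x ∈ W i, ∀ y ∈ W j, h x y = 0 := fun i j hij x hx y hy =>
    hort (Sum.inl i) (Sum.inl j) (by simpa using hij) x hx y hy
  refine ⟨e, f, fun _ => trivial, fun _ => trivial, fun i j => ?_, fun i j => ?_, fun i j => ?_⟩
  · by_cases hij : i = j
    · subst hij; exact he i
    · exact ho i j hij _ (heW i) _ (heW j)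
  · by_cases hij : i = j
    · subst hij; exact hf i
    · exact ho i j hij _ (hfW i) _ (hfW j)
  · by_cases hij : i = j
    · subst hij; simpa using hef i
    · rw [if_neg hij]; exact ho i j hij _ (heW i) _ (hfW j)

end PolarGrass

open PolarGrass Module in
/-- a non-degenerate σ-Hermitian form with Witt index `n ≥ 2` and arbitrary
anisotropic defect `d₀ = N - 2n`. For `1 ≤ k ≤ n` the Grassmann image is all of `⋀^k V`,
of dimension `N.choose k`. -/
theorem stmt13 (F : Type*) [Field F] (V : Type*) [AddCommGroup V] [Module F V]
    [FiniteDimensional F V]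
    (σ : F ≃+* F) (hσinv : ∀ a, σ (σ a) = a) (hσne : σ ≠ RingEquiv.refl F)
    (h : V → V → F) (hherm : IsHermitianForm F V σ h)
    (hndeg : ∀ v : V, (∀ w : V, h v w = 0) → v = 0)
    (n d₀ N : ℕ) (hn : 2 ≤ n)
    (hdec : HasWittDecomp F V h (fun v => h v v = 0) (radSetB F V h) n d₀ 0)
    (hNV : Module.finrank F V = N) (hN : N = 2 * n + d₀) :
    ∀ k : ℕ, 1 ≤ k → k ≤ n →
      grassmann F V (TotSingB F V h) k = ⋀[F]^k V ∧
      Module.finrank F ↥(grassmann F V (TotSingB F V h) k) = N.choose k := by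
  intro k _ hkn
  have heq : grassmann F V (TotSingB F V h) k = ⋀[F]^k V := by
    apply le_antisymm
    · rw [← ExteriorAlgebra.ιMulti_span_fixedDegree]
      refine Submodule.span_mono ?_
      rintro _ ⟨v, -, -, -, rfl⟩
      exact ⟨v, rfl⟩
    · refine le_trans ?_ (GS_le hherm k)
      refine le_trans ?_ (TT_all hherm hσinv hσne k ⊤ ((HP_of_decomp hherm hdec).mono hkn))
      rw [← ExteriorAlgebra.ιMulti_span_fixedDegree]
      refine Submodule.span_mono ?_
      rintro _ ⟨v, rfl⟩
      exact ⟨v, fun _ => trivial, rfl⟩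
  refine ⟨heq, ?_⟩
  rw [heq, exteriorPower.finrank_eq, hNV]
end
end

section
/- Suppose char(F) ≠ 2 and q is non-degenerate with Witt index n ≥ 2 and arbitrary anisotropic defect d₀ = N − 2n, i.e., V is an f_q-orthogonal direct sum V = V₁ ⊕ ⋯ ⊕ Vₙ ⊕ V₀ with each Vᵢ a hyperbolic plane for q and V₀ anisotropic of dimension d₀. Then for every integer k with 1 ≤ k ≤ n, the Grassmann image G_k(q) equals all of ⋀^k V; in particular dim G_k(q) = binom(N, k). -/
noncomputable section

namespace PolarGrass

open Module QuadraticMap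

section helpers

variable {F : Type*} [Field F] {V : Type*} [AddCommGroup V] [Module F V]

/-- Pure wedges of mutually orthogonal singular vectors lie in the Grassmann image. -/
lemma mem_grassmann_of_gram_zero (h2 : (2 : F) ≠ 0) (q : QuadraticForm F V) {k : ℕ}
    (v : Fin k → V) (hv : ∀ s s', polarBilin q (v s) (v s') = 0) :
    ExteriorAlgebra.ιMulti F k v ∈ grassmann F V (TotSingQ F V q) k := by
  by_cases hli : LinearIndependent F v
  · refine Submodule.subset_span ⟨v, fun _ => trivial, hli, ?_, rfl⟩
    have h1 : ∀ s, ∀ y ∈ Submodule.span F (Set.range v), polarBilin q (v s) y = 0 := by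
      intro s y hy
      have : Submodule.span F (Set.range v) ≤ LinearMap.ker (polarBilin q (v s)) := by
        rw [Submodule.span_le]
        rintro _ ⟨s', rfl⟩
        exact hv s s'
      exact this hy
    intro x hx
    have h3 : Submodule.span F (Set.range v) ≤ LinearMap.ker ((polarBilin q).flip x) := by
      rw [Submodule.span_le]
      rintro _ ⟨s', rfl⟩
      exact h1 s' x hx
    have h4 : polarBilin q x x = 0 := h3 hx
    rw [polarBilin_apply_apply, polar_self, nsmul_eq_mul] at h4
    simpa [h2] using h4
  · rw [AlternatingMap.map_linearDependent _ _ hli]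
    exact Submodule.zero_mem _

open Classical in
/-- The key induction: a tuple whose Gram matrix is a partial matching, together with enough
free hyperbolic planes orthogonal to it and to each other, has its wedge in the image. -/
lemma key (h2 : (2 : F) ≠ 0) (q : QuadraticForm F V) {k : ℕ} {ι : Type*}
    (e f : ι → V) (he : ∀ i, q (e i) = 0) (hf : ∀ i, q (f i) = 0)
    (hef : ∀ i, polarBilin q (e i) (f i) = 1)
    (hee' : ∀ i j, i ≠ j → polarBilin q (e i) (e j) = 0)
    (hef' : ∀ i j, i ≠ j → polarBilin q (e i) (f j) = 0)
    (hff' : ∀ i j, i ≠ j → polarBilin q (f i) (f j) = 0)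
    (m : ℕ) : ∀ (T : Finset ι) (v : Fin k → V), T.card = m →
    (∀ j ∈ T, ∀ t, polarBilin q (e j) (v t) = 0 ∧ polarBilin q (f j) (v t) = 0) →
    (∀ t t' t'', polarBilin q (v t) (v t') ≠ 0 → polarBilin q (v t) (v t'') ≠ 0 → t' = t'') →
    ((Finset.univ : Finset (Fin k × Fin k)).filter
      (fun p => p.1 ≤ p.2 ∧ polarBilin q (v p.1) (v p.2) ≠ 0)).card ≤ T.card →
    ExteriorAlgebra.ιMulti F k v ∈ grassmann F V (TotSingQ F V q) k := by
  have sy : ∀ x y, polarBilin q x y = polarBilin q y x := fun x y => by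
    simp only [polarBilin_apply_apply]; exact polar_comm _ _ _
  have self : ∀ x, polarBilin q x x = 2 * q x := fun x => by
    rw [polarBilin_apply_apply, polar_self, nsmul_eq_mul]; norm_num
  induction m with
  | zero =>
    intro T v hT _ _ hE
    apply mem_grassmann_of_gram_zero h2
    rw [hT, Nat.le_zero, Finset.card_eq_zero, Finset.filter_eq_empty_iff] at hE
    intro s s'
    by_contra h
    rcases le_total s s' with h' | h'
    · exact hE (Finset.mem_univ (s, s')) ⟨h', h⟩
    · exact hE (Finset.mem_univ (s', s)) ⟨h', by rwa [sy]⟩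
  | succ m ih =>
    intro T v hT hfree hmat hE
    by_cases hall : ∀ s s', polarBilin q (v s) (v s') = 0
    · exact mem_grassmann_of_gram_zero h2 q v hall
    have hex : ∃ t t', t ≤ t' ∧ polarBilin q (v t) (v t') ≠ 0 := by
      push Not at hall
      obtain ⟨s, s', h⟩ := hall
      rcases le_total s s' with h' | h'
      · exact ⟨s, s', h', h⟩
      · exact ⟨s', s, h', by rwa [sy]⟩
    obtain ⟨t, t', htt, hB⟩ := hex
    obtain ⟨j, hj⟩ : T.Nonempty := by rw [← Finset.card_pos]; omega
    -- the inductive step in abstract form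
    have step : ∀ w : Fin k → V, (∀ s, s ≠ t → s ≠ t' → w s = v s) →
        (∀ s s', (s = t ∨ s = t') → polarBilin q (w s) (w s') = 0) →
        (∀ i ∈ T, i ≠ j → ∀ s, (s = t ∨ s = t') →
          polarBilin q (e i) (w s) = 0 ∧ polarBilin q (f i) (w s) = 0) →
        ExteriorAlgebra.ιMulti F k w ∈ grassmann F V (TotSingQ F V q) k := by
      intro w hw1 hw2 hw3
      have hle : ∀ s s', polarBilin q (w s) (w s') ≠ 0 →
          s ≠ t ∧ s ≠ t' ∧ s' ≠ t ∧ s' ≠ t' ∧ polarBilin q (v s) (v s') ≠ 0 := by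
        intro s s' h
        have a1 : ¬ (s = t ∨ s = t') := fun h' => h (hw2 s s' h')
        have a2 : ¬ (s' = t ∨ s' = t') := fun h' => h (by rw [sy]; exact hw2 s' s h')
        push Not at a1 a2
        rw [hw1 s a1.1 a1.2, hw1 s' a2.1 a2.2] at h
        exact ⟨a1.1, a1.2, a2.1, a2.2, h⟩
      refine ih (T.erase j) w ?_ ?_ ?_ ?_
      · rw [Finset.card_erase_of_mem hj]; omega
      · intro i hi s
        rw [Finset.mem_erase] at hi
        by_cases hs : s = t ∨ s = t'
        · exact hw3 i hi.2 hi.1 s hs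
        · push Not at hs
          rw [hw1 s hs.1 hs.2]
          exact hfree i hi.2 s
      · intro a b c h h'
        exact hmat a b c (hle _ _ h).2.2.2.2 (hle _ _ h').2.2.2.2
      · rw [Finset.card_erase_of_mem hj]
        refine le_trans (Finset.card_le_card (t := Finset.erase (Finset.filter
          (fun p : Fin k × Fin k => p.1 ≤ p.2 ∧ polarBilin q (v p.1) (v p.2) ≠ 0)
            Finset.univ) (t, t')) ?_) ?_
        · rintro ⟨a, b⟩ hab
          simp only [Finset.mem_filter, Finset.mem_univ, true_and, Finset.mem_erase, ne_eq,
            Prod.mk.injEq] at hab ⊢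
          have := hle _ _ hab.2
          exact ⟨fun h => this.1 h.1, hab.1, this.2.2.2.2⟩
        · rw [Finset.card_erase_of_mem (by simp [htt]; simpa using hB)]
          omega
    by_cases hne : t = t'
    · subst hne
      have hvt : ∀ s, s ≠ t → polarBilin q (v t) (v s) = 0 := by
        intro s hs
        by_contra h
        exact hs (hmat t s t h hB)
      have one : ∀ x, q x = 0 → (∀ s, s ≠ t → polarBilin q x (v s) = 0) →
          (∀ i ∈ T, i ≠ j → polarBilin q (e i) x = 0 ∧ polarBilin q (f i) x = 0) →
          ExteriorAlgebra.ιMulti F k (Function.update v t x) ∈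
            grassmann F V (TotSingQ F V q) k := by
        intro x hx hxv hxT
        apply step
        · intro s hs _; simp [hs]
        · intro s s' hs
          have : s = t := by tauto
          subst this
          by_cases h : s' = s
          · subst h; simp only [Function.update_self]; rw [self, hx, mul_zero]
          · rw [Function.update_self, Function.update_of_ne h]
            exact hxv s' h
        · intro i hi hij s hs
          have : s = t := by tauto
          subst this
          rw [Function.update_self]
          exact hxT i hi hij
      have m1 := one (e j) (he j) (fun s _ => (hfree j hj s).1) (fun i _ hij =>
        ⟨hee' i j hij, by rw [sy]; exact hef' j i hij.symm⟩)
      have m2 := one (f j) (hf j) (fun s _ => (hfree j hj s).2) (fun i _ hij =>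
        ⟨hef' i j hij, hff' i j hij⟩)
      have m3 := one (v t + e j + (- q (v t)) • f j) (by
          have e1 := self (v t + e j + (- q (v t)) • f j)
          simp only [map_add, map_smul, LinearMap.add_apply, LinearMap.smul_apply, self, he, hf,
            hef, sy (v t) (e j), sy (v t) (f j), sy (f j) (e j), (hfree j hj t).1, (hfree j hj t).2,
            smul_eq_mul] at e1
          have : (2:F) * q (v t + e j + (- q (v t)) • f j) = 0 := by rw [← e1]; ring
          simpa [h2] using this)
        (fun s hs => by simp [hvt s hs, hfree j hj s, -polarBilin_apply_apply])
        (fun i hi hij => by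
          simp [hfree i hi t, hee' i j hij, hef' i j hij, hff' i j hij, sy (f i) (e j),
            hef' j i hij.symm, -polarBilin_apply_apply])
      have : ExteriorAlgebra.ιMulti F k v =
          ExteriorAlgebra.ιMulti F k (Function.update v t (v t + e j + (- q (v t)) • f j))
          - ExteriorAlgebra.ιMulti F k (Function.update v t (e j))
          + q (v t) • ExteriorAlgebra.ιMulti F k (Function.update v t (f j)) := by
        rw [AlternatingMap.map_update_add, AlternatingMap.map_update_add,
          AlternatingMap.map_update_smul, Function.update_eq_self]
        module
      rw [this]
      exact add_mem (sub_mem m3 m1) (Submodule.smul_mem _ _ m2)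
    · have hvt : ∀ s, s ≠ t' → polarBilin q (v t) (v s) = 0 := by
        intro s hs
        by_contra h
        exact hs (hmat t s t' h hB)
      have hvt' : ∀ s, s ≠ t → polarBilin q (v t') (v s) = 0 := by
        intro s hs
        by_contra h
        exact hs (hmat t' s t h (by rwa [sy]))
      have q1 : q (v t) = 0 := by
        have := hvt t hne
        rw [self] at this
        simpa [h2] using this
      have q2 : q (v t') = 0 := by
        have := hvt' t' (Ne.symm hne)
        rw [self] at this
        simpa [h2] using this
      obtain ⟨c, hc⟩ : ∃ c, c = polarBilin q (v t) (v t') := ⟨_, rfl⟩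
      have two : ∀ x y, polarBilin q x x = 0 → polarBilin q y y = 0 → polarBilin q x y = 0 →
          (∀ s, s ≠ t → s ≠ t' → polarBilin q x (v s) = 0) →
          (∀ s, s ≠ t → s ≠ t' → polarBilin q y (v s) = 0) →
          (∀ i ∈ T, i ≠ j → polarBilin q (e i) x = 0 ∧ polarBilin q (f i) x = 0) →
          (∀ i ∈ T, i ≠ j → polarBilin q (e i) y = 0 ∧ polarBilin q (f i) y = 0) →
          ExteriorAlgebra.ιMulti F k (Function.update (Function.update v t x) t' y) ∈
            grassmann F V (TotSingQ F V q) k := by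
        intro x y hx hy hxy hxv hyv hxT hyT
        have u1 : Function.update (Function.update v t x) t' y t = x := by
          rw [Function.update_of_ne hne, Function.update_self]
        have u2 : Function.update (Function.update v t x) t' y t' = y := Function.update_self _ _ _
        have u3 : ∀ s, s ≠ t → s ≠ t' → Function.update (Function.update v t x) t' y s = v s := by
          intro s h h'
          rw [Function.update_of_ne h', Function.update_of_ne h]
        have hyx : polarBilin q y x = 0 := by rw [sy]; exact hxy
        apply step
        · exact u3
        · intro s s' hs
          by_cases h1 : s' = t
          · subst h1
            rcases hs with rfl | rfl
            · rw [u1, hx]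
            · rw [u1, u2, hyx]
          by_cases h3 : s' = t'
          · subst h3
            rcases hs with rfl | rfl
            · rw [u1, u2, hxy]
            · rw [u2, hy]
          rw [u3 s' h1 h3]
          rcases hs with rfl | rfl
          · rw [u1]; exact hxv _ h1 h3
          · rw [u2]; exact hyv _ h1 h3
        · rintro i hi hij s (rfl | rfl)
          · rw [u1]; exact hxT i hi hij
          · rw [u2]; exact hyT i hi hij
      have E1 : ∀ s, polarBilin q (e j) (v s) = 0 := fun s => (hfree j hj s).1
      have E2 : ∀ s, polarBilin q (f j) (v s) = 0 := fun s => (hfree j hj s).2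
      have E1' : ∀ s, polarBilin q (v s) (e j) = 0 := fun s => by rw [sy]; exact E1 s
      have E2' : ∀ s, polarBilin q (v s) (f j) = 0 := fun s => by rw [sy]; exact E2 s
      have T1 : ∀ i ∈ T, i ≠ j → polarBilin q (e i) (e j) = 0 := fun i _ h => hee' i j h
      have T2 : ∀ i ∈ T, i ≠ j → polarBilin q (e i) (f j) = 0 := fun i _ h => hef' i j h
      have T3 : ∀ i ∈ T, i ≠ j → polarBilin q (f i) (e j) = 0 := fun i _ h => by
        rw [sy]; exact hef' j i h.symm
      have T4 : ∀ i ∈ T, i ≠ j → polarBilin q (f i) (f j) = 0 := fun i _ h => hff' i j h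
      have T5 : ∀ i ∈ T, ∀ s, polarBilin q (e i) (v s) = 0 := fun i hi s => (hfree i hi s).1
      have T6 : ∀ i ∈ T, ∀ s, polarBilin q (f i) (v s) = 0 := fun i hi s => (hfree i hi s).2
      have S1 : polarBilin q (e j) (e j) = 0 := by rw [self, he, mul_zero]
      have S2 : polarBilin q (f j) (f j) = 0 := by rw [self, hf, mul_zero]
      have S3 : polarBilin q (v t) (v t) = 0 := by rw [self, q1, mul_zero]
      have S4 : polarBilin q (v t') (v t') = 0 := by rw [self, q2, mul_zero]
      have S5 : polarBilin q (f j) (e j) = 1 := by rw [sy]; exact hef j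
      have S6 := hef j
      have m1 := two (v t + e j) (v t' + (-c) • f j)
        (by simp only [map_add, map_smul, LinearMap.add_apply, LinearMap.smul_apply, E1, E1', S1, S3, add_zero])
        (by simp [map_add, map_smul, LinearMap.add_apply, LinearMap.smul_apply, E2, E2', S2, S4,
          -polarBilin_apply_apply])
        (by simp [E1, E2', S6, ← hc, -polarBilin_apply_apply])
        (fun s h h' => by simp [hvt s h', E1, -polarBilin_apply_apply])
        (fun s h h' => by simp [hvt' s h, E2, -polarBilin_apply_apply])
        (fun i hi h => by simp [T1 i hi h, T3 i hi h, T5 i hi, T6 i hi, -polarBilin_apply_apply])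
        (fun i hi h => by simp [T2 i hi h, T4 i hi h, T5 i hi, T6 i hi, -polarBilin_apply_apply])
      have m2 := two (v t + f j) (v t' + (-c) • e j)
        (by simp [E2, E2', S2, S3, -polarBilin_apply_apply])
        (by simp [E1, E1', S1, S4, -polarBilin_apply_apply])
        (by simp [E2, E1', S5, ← hc, -polarBilin_apply_apply])
        (fun s h h' => by simp [hvt s h', E2, -polarBilin_apply_apply])
        (fun s h h' => by simp [hvt' s h, E1, -polarBilin_apply_apply])
        (fun i hi h => by simp [T2 i hi h, T4 i hi h, T5 i hi, T6 i hi, -polarBilin_apply_apply])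
        (fun i hi h => by simp [T1 i hi h, T3 i hi h, T5 i hi, T6 i hi, -polarBilin_apply_apply])
      have m3 := two (v t) (f j) S3 S2 (E2' t) (fun s _ h' => hvt s h') (fun s _ _ => E2 s)
        (fun i hi _ => ⟨T5 i hi t, T6 i hi t⟩) (fun i hi h => ⟨T2 i hi h, T4 i hi h⟩)
      have m4 := two (v t) (e j) S3 S1 (E1' t) (fun s _ h' => hvt s h') (fun s _ _ => E1 s)
        (fun i hi _ => ⟨T5 i hi t, T6 i hi t⟩) (fun i hi h => ⟨T1 i hi h, T3 i hi h⟩)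
      have m5 := two (e j) (v t') S1 S4 (E1 t') (fun s _ _ => E1 s) (fun s h _ => hvt' s h)
        (fun i hi h => ⟨T1 i hi h, T3 i hi h⟩) (fun i hi _ => ⟨T5 i hi t', T6 i hi t'⟩)
      have m6 := two (f j) (v t') S2 S4 (E2 t') (fun s _ _ => E2 s) (fun s h _ => hvt' s h)
        (fun i hi h => ⟨T2 i hi h, T4 i hi h⟩) (fun i hi _ => ⟨T5 i hi t', T6 i hi t'⟩)
      let M : V → V → ExteriorAlgebra F V := fun x y =>
        ExteriorAlgebra.ιMulti F k (Function.update (Function.update v t x) t' y)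
      have Ma2 : ∀ x y z, M x (y + z) = M x y + M x z := fun x y z =>
        AlternatingMap.map_update_add _ _ _ _ _
      have Ms2 : ∀ x (a : F) z, M x (a • z) = a • M x z := fun x a z =>
        AlternatingMap.map_update_smul _ _ _ _ _
      have Ma1 : ∀ x y z, M (x + y) z = M x z + M y z := fun x y z => by
        simp only [M]
        rw [Function.update_comm hne, Function.update_comm hne, Function.update_comm hne]
        exact AlternatingMap.map_update_add _ _ _ _ _
      have Mself : ∀ x, M x x = 0 := fun x => by
        refine AlternatingMap.map_eq_zero_of_eq _ _ (i := t) (j := t') ?_ hne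
        rw [Function.update_of_ne hne, Function.update_self, Function.update_self]
      have Mswap : M (f j) (e j) = - M (e j) (f j) := by
        have := Mself (e j + f j)
        rw [Ma1, Ma2, Ma2, Mself, Mself, zero_add, add_zero] at this
        exact eq_neg_of_add_eq_zero_right this
      have Mv : M (v t) (v t') = ExteriorAlgebra.ιMulti F k v := by
        simp only [M]
        rw [Function.update_eq_self, Function.update_eq_self]
      have key2 : (2 : F) • ExteriorAlgebra.ιMulti F k v =
          M (v t + e j) (v t' + (-c) • f j) + M (v t + f j) (v t' + (-c) • e j)
          + c • M (v t) (f j) + c • M (v t) (e j) - M (e j) (v t') - M (f j) (v t') := by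
        rw [Ma1, Ma1, Ma2, Ma2, Ma2, Ma2, Ms2, Ms2, Ms2, Ms2, Mswap, Mv]
        module
      have hmem : (2 : F) • ExteriorAlgebra.ιMulti F k v ∈ grassmann F V (TotSingQ F V q) k := by
        rw [key2]
        exact sub_mem (sub_mem (add_mem (add_mem (add_mem m1 m2) (Submodule.smul_mem _ _ m3))
          (Submodule.smul_mem _ _ m4)) m5) m6
      exact (Submodule.smul_mem_iff _ h2).1 hmem

/-- The partner of an index: `eᵢ ↔ fᵢ`, while anisotropic basis vectors pair with themselves. -/
def partner {ι κ : Type*} : ι ⊕ ι ⊕ κ → ι ⊕ ι ⊕ κ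
  | .inl i => .inr (.inl i)
  | .inr (.inl i) => .inl i
  | .inr (.inr x) => .inr (.inr x)

/-- The hyperbolic plane of an index, if any. -/
def plane {ι κ : Type*} : ι ⊕ ι ⊕ κ → Option ι
  | .inl i => some i
  | .inr (.inl i) => some i
  | .inr (.inr _) => none

open Classical in
lemma wedge_mem (h2 : (2 : F) ≠ 0) (q : QuadraticForm F V) {k n : ℕ} (hk : k ≤ n)
    {κ : Type*} (g : Fin n ⊕ Fin n ⊕ κ → V)
    (he : ∀ i, q (g (.inl i)) = 0) (hf : ∀ i, q (g (.inr (.inl i))) = 0)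
    (hef : ∀ i, polarBilin q (g (.inl i)) (g (.inr (.inl i))) = 1)
    (hg : ∀ a b, polarBilin q (g a) (g b) ≠ 0 → b = partner a)
    (c : Fin k → Fin n ⊕ Fin n ⊕ κ) :
    ExteriorAlgebra.ιMulti F k (fun t => g (c t)) ∈ grassmann F V (TotSingQ F V q) k := by
  by_cases hc : Function.Injective c
  swap
  · rw [AlternatingMap.map_eq_zero_of_not_injective]
    · exact Submodule.zero_mem _
    · intro h
      exact hc (fun a b hab => h (by simp [hab]))
  have hpp : ∀ a : Fin n ⊕ Fin n ⊕ κ, plane (partner a) = plane a := by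
    rintro (_ | _ | _) <;> rfl
  have hps : ∀ (a : Fin n ⊕ Fin n ⊕ κ) i, plane a = some i → partner a ≠ a := by
    rintro (_ | _ | _) i h <;> simp_all [plane, partner]
  have sy : ∀ x y, polarBilin q x y = polarBilin q y x := fun x y => by
    simp only [polarBilin_apply_apply]; exact polar_comm _ _ _
  have hmat : ∀ t t' t'', polarBilin q (g (c t)) (g (c t')) ≠ 0 →
      polarBilin q (g (c t)) (g (c t'')) ≠ 0 → t' = t'' := fun t t' t'' h h' =>
    hc ((hg _ _ h).trans (hg _ _ h').symm)
  let T : Finset (Fin n) := Finset.univ.filter (fun j => ∀ t, plane (c t) ≠ some j)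
  refine key h2 q (fun i => g (.inl i)) (fun i => g (.inr (.inl i))) he hf hef ?_ ?_ ?_
    T.card T _ rfl ?_ hmat ?_
  · intro i j hij
    by_contra h
    simpa [partner] using hg _ _ h
  · intro i j hij
    by_contra h
    have := hg _ _ h
    simp [partner] at this
    exact hij this.symm
  · intro i j hij
    by_contra h
    simpa [partner] using hg _ _ h
  · intro j hj t
    simp only [T, Finset.mem_filter, Finset.mem_univ, true_and] at hj
    constructor
    · by_contra h
      exact hj t (by rw [hg _ _ h]; rfl)
    · by_contra h
      exact hj t (by rw [hg _ _ h]; rfl)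
  · set E := (Finset.univ : Finset (Fin k × Fin k)).filter
      (fun p => p.1 ≤ p.2 ∧ polarBilin q (g (c p.1)) (g (c p.2)) ≠ 0) with hE
    have memE : ∀ a b, (a, b) ∈ E ↔ a ≤ b ∧ polarBilin q (g (c a)) (g (c b)) ≠ 0 := by
      intro a b
      rw [hE, Finset.mem_filter]
      exact ⟨fun h => h.2, fun h => ⟨Finset.mem_univ _, h⟩⟩
    let S := E.image Prod.snd
    have hS : S.card = E.card := by
      apply Finset.card_image_of_injOn
      rintro ⟨a, b⟩ hab ⟨a', b'⟩ hab' h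
      have h : b = b' := h
      subst h
      have h1 := ((memE _ _).1 hab).2
      have h3 := ((memE _ _).1 hab').2
      rw [sy] at h1 h3
      rw [hmat _ _ _ h1 h3]
    have hsub : Tᶜ.image some ⊆ Sᶜ.image (fun t => plane (c t)) := by
      intro o ho
      obtain ⟨i, hi, rfl⟩ := Finset.mem_image.1 ho
      have : ∃ t, plane (c t) = some i := by
        simpa [T] using hi
      obtain ⟨t, ht⟩ := this
      rw [Finset.mem_image]
      by_cases hts : t ∈ S
      · obtain ⟨⟨s, t₁⟩, hst, h⟩ := Finset.mem_image.1 hts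
        have h : t₁ = t := h
        subst h
        obtain ⟨hle, hB⟩ := (memE _ _).1 hst
        have hp := hg _ _ hB
        have hs : plane (c s) = some i := by rw [← hpp, ← hp, ht]
        refine ⟨s, ?_, hs⟩
        rw [Finset.mem_compl]
        intro hsS
        obtain ⟨⟨r, s₁⟩, hrs, h⟩ := Finset.mem_image.1 hsS
        have h : s₁ = s := h
        subst h
        obtain ⟨hle', hB'⟩ := (memE _ _).1 hrs
        rw [sy] at hB'
        have : t₁ = r := hmat _ _ _ hB hB'
        subst this
        have : t₁ = s₁ := le_antisymm hle' hle
        subst this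
        exact hps _ i ht hp.symm
      · exact ⟨t, by simpa using hts, ht⟩
    have h1 := Finset.card_le_card hsub
    rw [Finset.card_image_of_injective _ (Option.some_injective _)] at h1
    have h3 := h1.trans Finset.card_image_le
    rw [Finset.card_compl, Finset.card_compl, hS, Fintype.card_fin, Fintype.card_fin] at h3
    have h4 : E.card ≤ k := by
      rw [← hS]; exact (Finset.card_le_univ S).trans (by simp)
    have h5 : T.card ≤ n := (Finset.card_le_univ T).trans (by simp)
    omega

end helpers

end PolarGrass

open PolarGrass Module in
/-- `char F ≠ 2`, a non-degenerate quadratic form with Witt index `n ≥ 2`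
and arbitrary anisotropic defect `d₀ = N - 2n`. For `1 ≤ k ≤ n` the Grassmann image is
all of `⋀^k V`, of dimension `N.choose k`. -/
theorem stmt15 (F : Type*) [Field F] (V : Type*) [AddCommGroup V] [Module F V]
    [FiniteDimensional F V]
    (hchar : ringChar F ≠ 2)
    (q : QuadraticForm F V)
    (hndeg : ∀ v : V, q v = 0 → (∀ w : V, polarF F V q v w = 0) → v = 0)
    (n d₀ N : ℕ) (hn : 2 ≤ n)
    (hdec : HasWittDecomp F V (polarF F V q) (fun v => q v = 0) (radSetQ F V q) n d₀ 0)
    (hNV : Module.finrank F V = N) (hN : N = 2 * n + d₀) :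
    ∀ k : ℕ, 1 ≤ k → k ≤ n →
      grassmann F V (TotSingQ F V q) k = ⋀[F]^k V ∧
      Module.finrank F ↥(grassmann F V (TotSingQ F V q) k) = N.choose k := by
  intro k hk1 hkn
  have h2 : (2 : F) ≠ 0 := Ring.two_ne_zero hchar
  have main : grassmann F V (TotSingQ F V q) k = ⋀[F]^k V := by
    apply le_antisymm
    · refine Submodule.span_le.2 ?_
      rintro _ ⟨v, -, -, -, rfl⟩
      exact ExteriorAlgebra.ιMulti_range F k ⟨v, rfl⟩
    obtain ⟨W, W₀, R, hint, horth, hhyp, -, -, -, hR⟩ := hdec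
    choose e f hW he hf hef using hhyp
    have hRbot : R = ⊥ := Submodule.finrank_eq_zero.1 hR
    have sy : ∀ x y, QuadraticMap.polarBilin q x y = QuadraticMap.polarBilin q y x := fun x y => by
      simp only [QuadraticMap.polarBilin_apply_apply]; exact QuadraticMap.polar_comm _ _ _
    have hinv : Invertible (2 : F) := invertibleOfNonzero h2
    obtain ⟨u, hu⟩ := LinearMap.BilinForm.exists_orthogonal_basis
      (B := LinearMap.BilinForm.restrict (QuadraticMap.polarBilin q) W₀) ⟨fun x y => sy x y⟩
    let g : Fin n ⊕ Fin n ⊕ Fin (finrank F W₀) → V :=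
      Sum.elim e (Sum.elim f (fun x => (u x : V)))
    let loc : Fin n ⊕ Fin n ⊕ Fin (finrank F W₀) → Fin n ⊕ Fin 2 :=
      Sum.elim Sum.inl (Sum.elim Sum.inl (fun _ => Sum.inr 0))
    have heW : ∀ i, e i ∈ W i := fun i => by
      rw [hW]; exact Submodule.subset_span (by simp)
    have hfW : ∀ i, f i ∈ W i := fun i => by
      rw [hW]; exact Submodule.subset_span (by simp)
    have hloc : ∀ a, g a ∈ Sum.elim W ![W₀, R] (loc a) := by
      rintro (i | i | x)
      · exact heW i
      · exact hfW i
      · exact (u x).2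
    have hself : ∀ x, q x = 0 → QuadraticMap.polarBilin q x x = 0 := fun x hx => by
      rw [QuadraticMap.polarBilin_apply_apply, QuadraticMap.polar_self, hx, smul_zero]
    have hg : ∀ a b, QuadraticMap.polarBilin q (g a) (g b) ≠ 0 → b = partner a := by
      intro a b h
      have hl : loc a = loc b := by
        by_contra hne
        exact h (horth _ _ hne _ (hloc a) _ (hloc b))
      rcases a with i | i | x <;> rcases b with i' | i' | x' <;> simp [loc] at hl
      · subst hl; exact absurd (hself _ (he i)) h
      · subst hl; rfl
      · subst hl; rfl
      · subst hl; exact absurd (hself _ (hf i)) h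
      · by_contra hne
        have hne : x ≠ x' := fun h' => hne (by rw [h']; rfl)
        exact h (hu hne)
    have hspan : Submodule.span F (Set.range g) = ⊤ := by
      rw [eq_top_iff, ← hint.submodule_iSup_eq_top, iSup_le_iff]
      rintro (i | i)
      · change W i ≤ _
        rw [hW, Submodule.span_le]
        rintro _ (rfl | rfl)
        · exact Submodule.subset_span ⟨.inl i, rfl⟩
        · exact Submodule.subset_span ⟨.inr (.inl i), rfl⟩
      · fin_cases i
        · change W₀ ≤ _
          have h1 : W₀ = (Submodule.span F (Set.range u)).map W₀.subtype := by
            rw [u.span_eq, Submodule.map_top, Submodule.range_subtype]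
          refine h1.le.trans ?_
          rw [Submodule.map_span, Submodule.span_le]
          rintro _ ⟨_, ⟨x, rfl⟩, rfl⟩
          exact Submodule.subset_span ⟨.inr (.inr x), rfl⟩
        · change R ≤ _
          rw [hRbot]; exact bot_le
    rw [← exteriorPower.ιMulti_span_fixedDegree_of_span_eq_top F k V hspan, Submodule.span_le]
    rintro _ ⟨v, hv, rfl⟩
    have : ∀ t, ∃ a, g a = v t := fun t => hv ⟨t, rfl⟩
    choose c hc using this
    have hvc : v = fun t => g (c t) := funext fun t => (hc t).symm
    rw [hvc]
    exact wedge_mem h2 q hkn g he hf hef hg c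
  refine ⟨main, ?_⟩
  rw [main, exteriorPower.finrank_eq, hNV]
end
end
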